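/- Second-order liminf inequality for the one-dimensional weighted functional: let v_eps be global minimizers of J_eps (with delta > 0 sufficiently small). Then liminf_{eps->0+} ( G_eps^(1)(v_eps) - 2 c_W eta(t_0) ) / eps >= 2 eta'(t_0) ( tau_0 c_W + c_sym ) + ( lambda_0^2 / (2 l) ) * (integral over I of eta dt) when q = 1, and liminf_{eps->0+} ( G_eps^(1)(v_eps) - 2 c_W eta(t_0) ) / eps >= 2 eta'(t_0) ( tau_0 c_W + c_sym ) when q in (0,1). -/

import Mathlib

open MeasureTheory Set Filter Topology Asymptotics
open scoped ENNReal Classical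

noncomputable section

/-- The double-well potential hypotheses \eqref{W_Smooth}-\eqref{WGurtin_Assumption}:
`W ≥ 0` is `C²` away from its two zeros `a < b`, the second derivative behaves like
`l * |s - a|^(q-1)` (resp. `l * |s - b|^(q-1)`) near the wells, `W'` has exactly the
three zeros `a < c < b` with `W'' (c) < 0`, and `|W'|` stays bounded away from `0`
at infinity. -/
structure DoubleWell (W : ℝ → ℝ) (a b c q l : ℝ) : Prop where
  lt_ab : a < b
  lt_ac : a < c
  lt_cb : c < b
  nonneg : ∀ s, 0 ≤ W s
  smooth : ContDiffOn ℝ 2 W (({a, b} : Set ℝ)ᶜ)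
  zeros : ∀ s, W s = 0 ↔ s = a ∨ s = b
  q_mem : q ∈ Set.Ioc (0 : ℝ) 1
  l_pos : 0 < l
  lim_a : Filter.Tendsto (fun s => deriv (deriv W) s / |s - a| ^ (q - 1)) (𝓝[≠] a) (𝓝 l)
  lim_b : Filter.Tendsto (fun s => deriv (deriv W) s / |s - b| ^ (q - 1)) (𝓝[≠] b) (𝓝 l)
  deriv_zeros : ∀ s, deriv W s = 0 ↔ s = a ∨ s = c ∨ s = b
  concave_c : deriv (deriv W) c < 0
  coercive : ∃ L > 0, ∃ R : ℝ, ∀ s : ℝ, R ≤ |s| → L ≤ |deriv W s|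

/-- The hypotheses \eqref{etaSmooth}-\eqref{etaPrimeRatio} on the weight `η` on
`I = (-T,T)`: positivity, `C^{1,β}` regularity, power-like behaviour
`(t+T)^(n₁-1)` resp. `(T-t)^(n₂-1)` at the two endpoints, and the bound
`|η'| ≤ d₅ η / min{T-t, t+T}`. -/
structure GoodWeight (T : ℝ) (η : ℝ → ℝ) (β : ℝ) (n₁ n₂ : ℕ)
    (d₁ d₂ d₃ d₄ d₅ tstar : ℝ) : Prop where
  pos : ∀ t ∈ Set.Ioo (-T) T, 0 < η t
  integrable : MeasureTheory.IntegrableOn η (Set.Ioo (-T) T)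
  beta_mem : β ∈ Set.Ioc (0 : ℝ) 1
  smooth : ContDiffOn ℝ 1 η (Set.Ioo (-T) T)
  holder : ∀ K : Set ℝ, K ⊆ Set.Ioo (-T) T → IsCompact K →
    ∃ C : ℝ, ∀ x ∈ K, ∀ y ∈ K, |deriv η x - deriv η y| ≤ C * |x - y| ^ β
  n₁_pos : 1 ≤ n₁
  n₂_pos : 1 ≤ n₂
  d₁_pos : 0 < d₁
  d₂_pos : 0 < d₂
  d₃_pos : 0 < d₃
  d₄_pos : 0 < d₄
  d₅_pos : 0 < d₅
  tstar_mem : tstar ∈ Set.Ioo (0 : ℝ) T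
  tail₁ : ∀ t ∈ Set.Ioc (-T) (-T + tstar),
    d₁ * (t + T) ^ (n₁ - 1) ≤ η t ∧ η t ≤ d₂ * (t + T) ^ (n₁ - 1)
  tail₂ : ∀ t ∈ Set.Ico (T - tstar) T,
    d₃ * (T - t) ^ (n₂ - 1) ≤ η t ∧ η t ≤ d₄ * (T - t) ^ (n₂ - 1)
  deriv_bound : ∀ t ∈ Set.Ioo (-T) T, |deriv η t| ≤ d₅ * η t / min (T - t) (t + T)

/-- The heteroclinic profile: solution of `z' = √(W ∘ z)`, `z 0 = c`, `z ∈ [a,b]`. -/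
structure CauchyProfile (W : ℝ → ℝ) (a b c : ℝ) (z : ℝ → ℝ) : Prop where
  ode : ∀ t, HasDerivAt z (Real.sqrt (W (z t))) t
  init : z 0 = c
  range : ∀ t, z t ∈ Set.Icc a b

/-- The weighted `L¹` distance on `(-T,T)`. -/
def dist1 (T : ℝ) (η v w : ℝ → ℝ) : ℝ :=
  ∫ t in Set.Ioo (-T) T, |v t - w t| * η t

/-- Membership in the weighted space `H¹_η`. -/
def MemH1 (T : ℝ) (η v : ℝ → ℝ) : Prop :=
  (∀ t ∈ Set.Ioo (-T) T, DifferentiableAt ℝ v t) ∧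
  MeasureTheory.IntegrableOn (fun t => ((v t) ^ 2 + (deriv v t) ^ 2) * η t) (Set.Ioo (-T) T)

/-- Membership in the weighted space `L¹_η`. -/
def MemL1 (T : ℝ) (η v : ℝ → ℝ) : Prop :=
  MeasureTheory.IntegrableOn (fun t => |v t| * η t) (Set.Ioo (-T) T)

/-- The mass constraint `∫_I v η dt = m`. -/
def massEq (T : ℝ) (η : ℝ → ℝ) (m : ℝ) (v : ℝ → ℝ) : Prop :=
  (∫ t in Set.Ioo (-T) T, v t * η t) = m

/-- The weighted Cahn–Hilliard energy `∫_I (W(v) + ε² v'²) η dt` (real-valued). -/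
def energy (T : ℝ) (W η : ℝ → ℝ) (ε : ℝ) (v : ℝ → ℝ) : ℝ :=
  ∫ t in Set.Ioo (-T) T, (W (v t) + ε ^ 2 * (deriv v t) ^ 2) * η t

/-- The rescaled energy `G_ε^{(1)}(v) = ∫_I (W(v)/ε + ε v'²) η dt` (real-valued). -/
def energy1 (T : ℝ) (W η : ℝ → ℝ) (ε : ℝ) (v : ℝ → ℝ) : ℝ :=
  ∫ t in Set.Ioo (-T) T, (W (v t) / ε + ε * (deriv v t) ^ 2) * η t

/-- The weighted energy as an extended-real-valued integral. -/
def ennEnergy (T : ℝ) (W η : ℝ → ℝ) (ε : ℝ) (v : ℝ → ℝ) : ℝ≥0∞ :=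
  ∫⁻ t in Set.Ioo (-T) T, ENNReal.ofReal ((W (v t) + ε ^ 2 * (deriv v t) ^ 2) * η t)

/-- The functional `G_ε` on `L¹_η` : the energy if `v ∈ H¹_η` satisfies the
mass constraint, `+∞` otherwise. -/
def GepsE (T : ℝ) (W η : ℝ → ℝ) (m ε : ℝ) (v : ℝ → ℝ) : ℝ≥0∞ :=
  if MemH1 T η v ∧ massEq T η m v then ennEnergy T W η ε v else ⊤

/-- The functional `G_ε^{(1)} = G_ε / ε` on `L¹_η`. -/
def Geps1E (T : ℝ) (W η : ℝ → ℝ) (m ε : ℝ) (v : ℝ → ℝ) : ℝ≥0∞ :=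
  if MemH1 T η v ∧ massEq T η m v then
    ∫⁻ t in Set.Ioo (-T) T, ENNReal.ofReal ((W (v t) / ε + ε * (deriv v t) ^ 2) * η t)
  else ⊤

/-- The zeroth order Γ-limit `G⁽⁰⁾`. -/
def G0E (T : ℝ) (W η : ℝ → ℝ) (m : ℝ) (v : ℝ → ℝ) : ℝ≥0∞ :=
  if MemL1 T η v ∧ massEq T η m v then
    ∫⁻ t in Set.Ioo (-T) T, ENNReal.ofReal (W (v t) * η t)
  else ⊤

/-- The set of values whose supremum is the weighted total variation
`∫_I η d|Dv| = sup { ∫_I v φ' dt : φ ∈ C¹_c(I), |φ| ≤ η }`. -/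
def wTVvals (T : ℝ) (η v : ℝ → ℝ) : Set ℝ :=
  { r | ∃ φ : ℝ → ℝ, ContDiff ℝ 1 φ ∧ HasCompactSupport φ ∧
      tsupport φ ⊆ Set.Ioo (-T) T ∧ (∀ t ∈ Set.Ioo (-T) T, |φ t| ≤ η t) ∧
      r = ∫ t in Set.Ioo (-T) T, v t * deriv φ t }

/-- The weighted total variation `∫_I η d|Dv|`. -/
def wTV (T : ℝ) (η v : ℝ → ℝ) : ℝ := sSup (wTVvals T η v)

/-- The class `𝒞` of `BV_η` functions with values in `{a,b}` satisfying the mass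
constraint. -/
def memC (T : ℝ) (η : ℝ → ℝ) (a b m : ℝ) (v : ℝ → ℝ) : Prop :=
  (∀ᵐ t ∂(MeasureTheory.volume.restrict (Set.Ioo (-T) T)), v t = a ∨ v t = b) ∧
  BddAbove (wTVvals T η v) ∧ massEq T η m v

/-- The single-interface step function `sgn_{a,b}(· - t₀)`. -/
def stepAB (a b t₀ : ℝ) : ℝ → ℝ := fun t => if t ≤ t₀ then a else b

/-- Admissibility for the localized functional `J_ε`: `H¹_η` membership, mass
constraint, and distance at most `δ` from `v₀` in `L¹_η`. -/
def Adm (T : ℝ) (η : ℝ → ℝ) (m δ : ℝ) (v₀ v : ℝ → ℝ) : Prop :=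
  MemH1 T η v ∧ massEq T η m v ∧ dist1 T η v v₀ ≤ δ

/-- `v` is a global minimizer of the localized functional `J_ε`. -/
def IsJMin (T : ℝ) (W η : ℝ → ℝ) (m δ ε : ℝ) (v₀ v : ℝ → ℝ) : Prop :=
  Adm T η m δ v₀ v ∧
  ∀ w, Adm T η m δ v₀ w → ennEnergy T W η ε v ≤ ennEnergy T W η ε w

end

section

/-! ### Part 1: derivative-free facts on the potential -/

/-- Quadratic lower bound near a well. -/
def QL (W : ℝ → ℝ) (e Λ : ℝ) : Prop := ∃ κ > 0, ∀ s, |s - e| ≤ κ → Λ * (s - e) ^ 2 ≤ W s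

structure WF (W : ℝ → ℝ) (a b c : ℝ) : Prop where
  ac : a < c
  cb : c < b
  nonneg : ∀ s, 0 ≤ W s
  Wa : W a = 0
  Wb : W b = 0
  pos : ∀ s, s ≠ a → s ≠ b → 0 < W s
  mono : MonotoneOn W (Icc a c)
  anti : AntitoneOn W (Icc c b)
  cont : ContinuousOn W (Icc a b)
  antiL : AntitoneOn W (Iic a)
  monoR : MonotoneOn W (Ici b)
  growth : ∃ L > 0, ∃ R : ℝ, ∀ s, R ≤ |s| → L * |s| ≤ W s
  meas : Measurable W
  quad : ∃ Λ > 0, QL W a Λ ∧ QL W b Λ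

lemma ql_aux (U U' U'' : ℝ → ℝ) (κ Λ : ℝ) (hU : ∀ σ ∈ Ioo 0 κ, 0 ≤ U σ)
    (h1 : ∀ σ ∈ Ioo 0 κ, HasDerivAt U (U' σ) σ) (h2 : ∀ σ ∈ Ioo 0 κ, HasDerivAt U' (U'' σ) σ)
    (hU' : ∀ σ ∈ Ioo 0 κ, 0 ≤ U' σ) (hU'' : ∀ σ ∈ Ioo 0 κ, 2 * Λ ≤ U'' σ) :
    ∀ σ ∈ Ioo 0 κ, Λ * σ ^ 2 ≤ U σ := by
  have A : MonotoneOn (fun σ => U' σ - 2 * Λ * σ) (Ioo 0 κ) := by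
    have hd : ∀ σ ∈ Ioo 0 κ, HasDerivAt (fun σ => U' σ - 2 * Λ * σ) (U'' σ - 2 * Λ * 1) σ :=
      fun σ hσ => (h2 σ hσ).sub ((hasDerivAt_id σ).const_mul (2 * Λ))
    apply monotoneOn_of_deriv_nonneg (convex_Ioo 0 κ)
    · exact fun σ hσ => (hd σ hσ).continuousAt.continuousWithinAt
    · rw [interior_Ioo]; exact fun σ hσ => (hd σ hσ).differentiableAt.differentiableWithinAt
    · rw [interior_Ioo]; intro σ hσ; rw [(hd σ hσ).deriv]; linarith [hU'' σ hσ]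
  have lim0 : ∀ k : ℝ, ∀ p : ℕ, p ≠ 0 → Tendsto (fun σ : ℝ => - k * σ ^ p) (𝓝[>] 0) (𝓝 0) := by
    intro k p hp
    have : Tendsto (fun σ : ℝ => - k * σ ^ p) (𝓝 0) (𝓝 (- k * 0 ^ p)) :=
      (by fun_prop : Continuous (fun σ : ℝ => - k * σ ^ p)).tendsto 0
    rw [zero_pow hp, mul_zero] at this
    exact this.mono_left nhdsWithin_le_nhds
  have B : ∀ σ ∈ Ioo 0 κ, 2 * Λ * σ ≤ U' σ := by
    intro σ hσ
    have : 0 ≤ U' σ - 2 * Λ * σ := by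
      refine le_of_tendsto (lim0 (2 * Λ) 1 one_ne_zero) ?_
      filter_upwards [Ioo_mem_nhdsGT hσ.1] with r hr
      have := A ⟨hr.1, hr.2.trans hσ.2⟩ hσ hr.2.le
      have h3 := hU' r ⟨hr.1, hr.2.trans hσ.2⟩
      simp only [pow_one] at *
      linarith
    linarith
  have A2 : MonotoneOn (fun σ => U σ - Λ * σ ^ 2) (Ioo 0 κ) := by
    have hd : ∀ σ ∈ Ioo 0 κ, HasDerivAt (fun σ => U σ - Λ * σ ^ 2) (U' σ - Λ * (2 * σ)) σ := by
      intro σ hσ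
      have := (h1 σ hσ).sub ((hasDerivAt_pow 2 σ).const_mul Λ)
      exact this.congr_deriv (by simp)
    apply monotoneOn_of_deriv_nonneg (convex_Ioo 0 κ)
    · exact fun σ hσ => (hd σ hσ).continuousAt.continuousWithinAt
    · rw [interior_Ioo]; exact fun σ hσ => (hd σ hσ).differentiableAt.differentiableWithinAt
    · rw [interior_Ioo]; intro σ hσ; rw [(hd σ hσ).deriv]; linarith [B σ hσ]
  intro σ hσ
  have : 0 ≤ U σ - Λ * σ ^ 2 := by
    refine le_of_tendsto (lim0 Λ 2 two_ne_zero) ?_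
    filter_upwards [Ioo_mem_nhdsGT hσ.1] with r hr
    have := A2 ⟨hr.1, hr.2.trans hσ.2⟩ hσ hr.2.le
    have h3 := hU r ⟨hr.1, hr.2.trans hσ.2⟩
    simp only at *
    linarith
  linarith

/-- no jump at the well -/
lemma zcont_aux (W z : ℝ → ℝ) (a c w : ℝ) (hac : a < c) (hw : 0 < w)
    (hWw : ∀ s ∈ Ioc a c, w ≤ W s) (hWa : W a = 0)
    (ode : ∀ t, HasDerivAt z (Real.sqrt (W (z t))) t) (h0 : z 0 = c) (hr : ∀ t, a ≤ z t) : False := by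
  have hmono : Monotone z := by
    apply monotone_of_deriv_nonneg (fun t => (ode t).differentiableAt)
    intro t; rw [(ode t).deriv]; exact Real.sqrt_nonneg _
  have hzc : ∀ t ≤ 0, z t ≤ c := fun t ht => h0 ▸ hmono ht
  have hk : 0 < Real.sqrt w := Real.sqrt_pos.mpr hw
  by_cases H : ∃ t ≤ 0, z t = a
  · obtain ⟨t, ht, hta⟩ := H
    obtain ⟨r, hr1, hr2⟩ := exists_hasDerivWithinAt_eq_of_gt_of_lt (f := z) (m := Real.sqrt w / 2)
      (f' := fun t => Real.sqrt (W (z t))) ht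
      (fun x _ => (ode x).hasDerivWithinAt)
      (by simp only [hta, hWa, Real.sqrt_zero]; linarith)
      (by
        simp only [h0]
        have := Real.sqrt_le_sqrt (hWw c ⟨hac, le_rfl⟩)
        linarith)
    simp only at hr2
    rcases eq_or_lt_of_le (hr r) with h | h
    · rw [← h, hWa, Real.sqrt_zero] at hr2; linarith
    · have := Real.sqrt_le_sqrt (hWw (z r) ⟨h, hzc r hr1.2.le⟩)
      linarith
  · push Not at H
    have hd : ∀ t ∈ Iic (0:ℝ), Real.sqrt w ≤ Real.sqrt (W (z t)) := fun t ht =>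
      Real.sqrt_le_sqrt (hWw _ ⟨lt_of_le_of_ne (hr t) (Ne.symm (H t ht)), hzc t ht⟩)
    have key := Convex.mul_sub_le_image_sub_of_le_deriv (convex_Iic (0:ℝ)) (f := z) (C := Real.sqrt w)
      (fun t _ => (ode t).continuousAt.continuousWithinAt)
      (fun t _ => (ode t).differentiableAt.differentiableWithinAt)
      (fun t ht => by rw [(ode t).deriv]; exact hd t (interior_subset ht))
    have hneg : -((c - a + 1) / Real.sqrt w) ≤ 0 := by
      have : 0 ≤ (c - a + 1) / Real.sqrt w := by apply div_nonneg <;> linarith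
      linarith
    have := key _ (show -((c - a + 1) / Real.sqrt w) ∈ Iic (0:ℝ) from hneg) 0 (by simp) hneg
    rw [h0] at this
    have e : Real.sqrt w * (0 - -((c - a + 1) / Real.sqrt w)) = c - a + 1 := by field_simp; ring
    rw [e] at this
    linarith [hr (-((c - a + 1) / Real.sqrt w))]

lemma ql_of_lim (W : ℝ → ℝ) (e q l Λ : ℝ) (hq : q ≤ 1) (hl : 0 < l)
    (hΛl : q = 1 → 2 * Λ < l)
    (lim : Tendsto (fun s => deriv (deriv W) s / |s - e| ^ (q - 1)) (𝓝[≠] e) (𝓝 l))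
    (hW0 : ∀ s, 0 ≤ W s) (hWe : W e = 0)
    (hd : ∀ᶠ s in 𝓝[≠] e, DifferentiableAt ℝ W s ∧ DifferentiableAt ℝ (deriv W) s)
    (hsgn : ∀ᶠ s in 𝓝[≠] e, (s < e → deriv W s ≤ 0) ∧ (e < s → 0 ≤ deriv W s)) :
    QL W e Λ := by
  have h2 : ∀ᶠ s in 𝓝[≠] e, 2 * Λ ≤ deriv (deriv W) s := by
    rcases eq_or_lt_of_le hq with h | h
    · subst h
      have := lim.eventually (lt_mem_nhds (hΛl rfl))
      filter_upwards [this] with s hs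
      simp at hs; exact hs.le
    · have l1 := lim.eventually (lt_mem_nhds (show l / 2 < l by linarith))
      have l2 : Tendsto (fun s => |s - e| ^ (q - 1)) (𝓝[≠] e) atTop := by
        have t1 : Tendsto (fun s : ℝ => |s - e|) (𝓝[≠] e) (𝓝[>] 0) := by
          rw [tendsto_nhdsWithin_iff]
          constructor
          · have : Tendsto (fun s : ℝ => |s - e|) (𝓝 e) (𝓝 |e - e|) :=
              (by fun_prop : Continuous (fun s : ℝ => |s - e|)).tendsto e
            simp only [sub_self, abs_zero] at this
            exact this.mono_left nhdsWithin_le_nhds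
          · filter_upwards [self_mem_nhdsWithin] with s hs
            exact abs_pos.mpr (sub_ne_zero.mpr hs)
        exact (tendsto_rpow_neg_nhdsGT_zero (by linarith)).comp t1
      filter_upwards [l1, l2.eventually_ge_atTop (4 * Λ / l), l2.eventually_gt_atTop 0] with s h1 h2 h3
      rw [lt_div_iff₀ h3] at h1
      rw [div_le_iff₀ hl] at h2
      nlinarith
  have hall := (h2.and (hd.and hsgn))
  rw [eventually_nhdsWithin_iff, Metric.eventually_nhds_iff] at hall
  obtain ⟨κ, hκ, H⟩ := hall
  have H' : ∀ s, 0 < |s - e| → |s - e| < κ → _ := fun s h1 h2 =>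
    H (y := s) (by rwa [Real.dist_eq]) (by
      intro h; rw [mem_singleton_iff] at h; rw [h] at h1; simp at h1)
  refine ⟨κ / 2, by linarith, ?_⟩
  have R := ql_aux (fun σ => W (e + σ)) (fun σ => deriv W (e + σ)) (fun σ => deriv (deriv W) (e + σ)) κ Λ
    (fun σ _ => hW0 _)
    (fun σ hσ => by
      have := H' (e + σ) (by simp; exact hσ.1.ne') (by simpa [abs_of_pos hσ.1] using hσ.2)
      exact HasDerivAt.comp_const_add e σ this.2.1.1.hasDerivAt)
    (fun σ hσ => by
      have := H' (e + σ) (by simp; exact hσ.1.ne') (by simpa [abs_of_pos hσ.1] using hσ.2)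
      exact HasDerivAt.comp_const_add e σ this.2.1.2.hasDerivAt)
    (fun σ hσ => by
      have := H' (e + σ) (by simp; exact hσ.1.ne') (by simpa [abs_of_pos hσ.1] using hσ.2)
      exact this.2.2.2 (by linarith [hσ.1]))
    (fun σ hσ => by
      have := H' (e + σ) (by simp; exact hσ.1.ne') (by simpa [abs_of_pos hσ.1] using hσ.2)
      exact this.1)
  have Lh := ql_aux (fun σ => W (e - σ)) (fun σ => - deriv W (e - σ)) (fun σ => deriv (deriv W) (e - σ)) κ Λ
    (fun σ _ => hW0 _)
    (fun σ hσ => by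
      have := H' (e - σ) (by simp; exact hσ.1.ne') (by simpa [abs_of_pos hσ.1] using hσ.2)
      exact HasDerivAt.comp_const_sub e σ this.2.1.1.hasDerivAt)
    (fun σ hσ => by
      have := H' (e - σ) (by simp; exact hσ.1.ne') (by simpa [abs_of_pos hσ.1] using hσ.2)
      have h := (HasDerivAt.comp_const_sub e σ this.2.1.2.hasDerivAt).neg
      rw [neg_neg] at h
      exact h)
    (fun σ hσ => by
      have := H' (e - σ) (by simp; exact hσ.1.ne') (by simpa [abs_of_pos hσ.1] using hσ.2)
      have := this.2.2.1 (by linarith [hσ.1])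
      linarith)
    (fun σ hσ => by
      have := H' (e - σ) (by simp; exact hσ.1.ne') (by simpa [abs_of_pos hσ.1] using hσ.2)
      exact this.1)
  intro s hs
  rcases lt_trichotomy s e with h | h | h
  · have := Lh (e - s) ⟨by linarith, by rw [abs_of_neg (by linarith)] at hs; linarith⟩
    simp only [sub_sub_cancel] at this
    nlinarith
  · simp [h, hWe]
  · have := R (s - e) ⟨by linarith, by rw [abs_of_pos (by linarith)] at hs; linarith⟩
    simp only [add_sub_cancel] at this
    nlinarith

section DW
variable {W : ℝ → ℝ} {a b c q l : ℝ}

lemma DoubleWell.diffAt (h : DoubleWell W a b c q l) {s : ℝ} (ha : s ≠ a) (hb : s ≠ b) :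
    DifferentiableAt ℝ W s ∧ DifferentiableAt ℝ (deriv W) s := by
  have hs : ({a, b} : Set ℝ)ᶜ ∈ 𝓝 s :=
    (Set.toFinite _).isClosed.isOpen_compl.mem_nhds (by simp [ha, hb])
  have := h.smooth.contDiffAt hs
  refine ⟨this.differentiableAt (by norm_num), ?_⟩
  have h2 : ContDiffAt ℝ 1 (deriv W) s := this.derivWithin (by norm_num)
  exact h2.differentiableAt (by norm_num)

lemma DoubleWell.sgnL (h : DoubleWell W a b c q l) : ∀ s < a, deriv W s < 0 := by
  have D := hasDerivWithinAt_forall_lt_or_forall_gt_of_forall_ne (convex_Iio a) (f := W)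
    (f' := deriv W) (m := 0)
    (fun s hs => (h.diffAt (ne_of_lt hs) (ne_of_lt (lt_trans hs h.lt_ab))).1.hasDerivAt.hasDerivWithinAt)
    (fun s hs h0 => by
      have := (h.deriv_zeros s).mp h0
      have h1 : s < a := hs
      have := h.lt_ac; have := h.lt_ab
      rcases ‹s = a ∨ _› with r | r | r <;> linarith)
  rcases D with D | D
  · exact fun s hs => D s hs
  exfalso
  obtain ⟨L, hL, R, hR⟩ := h.coercive
  set s1 := min (a - 1) (-|R|) with hs1
  have hs1a : s1 < a := lt_of_le_of_lt (min_le_left _ _) (by linarith)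
  have hs1R : s1 ≤ -|R| := min_le_right _ _
  have key := Convex.mul_sub_le_image_sub_of_le_deriv (convex_Iic s1) (f := W) (C := L)
    (fun s hs => (h.diffAt (ne_of_lt (lt_of_le_of_lt hs hs1a))
      (ne_of_lt (lt_trans (lt_of_le_of_lt hs hs1a) h.lt_ab))).1.continuousAt.continuousWithinAt)
    (fun s hs => by
      have hs : s ≤ s1 := mem_Iic.mp (interior_subset hs)
      exact (h.diffAt (ne_of_lt (lt_of_le_of_lt hs hs1a))
      (ne_of_lt (lt_trans (lt_of_le_of_lt hs hs1a) h.lt_ab))).1.differentiableWithinAt)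
    (fun s hs => by
      have hs : s ≤ s1 := mem_Iic.mp (interior_subset hs)
      have := hR s (by
        rw [abs_of_nonpos (by linarith [abs_nonneg R])]; linarith [le_abs_self R])
      rwa [abs_of_pos (D s (lt_of_le_of_lt hs hs1a))] at this)
  have hW1 := h.nonneg s1
  have hx : s1 - (W s1 + 1) / L ≤ s1 := by
    have : 0 ≤ (W s1 + 1) / L := by positivity
    linarith
  have := key (s1 - (W s1 + 1) / L) hx s1 (by simp) hx
  have e : L * (s1 - (s1 - (W s1 + 1) / L)) = W s1 + 1 := by field_simp; ring
  rw [e] at this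
  linarith [h.nonneg (s1 - (W s1 + 1) / L)]

lemma DoubleWell.sgnR (h : DoubleWell W a b c q l) : ∀ s, b < s → 0 < deriv W s := by
  have D := hasDerivWithinAt_forall_lt_or_forall_gt_of_forall_ne (convex_Ioi b) (f := W)
    (f' := deriv W) (m := 0)
    (fun s hs => (h.diffAt (ne_of_gt (lt_trans h.lt_ab hs)) (ne_of_gt hs)).1.hasDerivAt.hasDerivWithinAt)
    (fun s hs h0 => by
      have := (h.deriv_zeros s).mp h0
      have h1 : b < s := hs
      have := h.lt_cb; have := h.lt_ab
      rcases ‹s = a ∨ _› with r | r | r <;> linarith)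
  rcases D with D | D
  swap
  · exact fun s hs => D s hs
  exfalso
  obtain ⟨L, hL, R, hR⟩ := h.coercive
  set s1 := max (b + 1) (|R|) with hs1
  have hs1a : b < s1 := lt_of_lt_of_le (by linarith) (le_max_left _ _)
  have hs1R : |R| ≤ s1 := le_max_right _ _
  have key := Convex.image_sub_le_mul_sub_of_deriv_le (convex_Ici s1) (f := W) (C := -L)
    (fun s hs => (h.diffAt (ne_of_gt (lt_trans h.lt_ab (lt_of_lt_of_le hs1a hs)))
      (ne_of_gt (lt_of_lt_of_le hs1a hs))).1.continuousAt.continuousWithinAt)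
    (fun s hs => by
      have hs : s1 ≤ s := interior_subset hs
      exact (h.diffAt (ne_of_gt (lt_trans h.lt_ab (lt_of_lt_of_le hs1a hs)))
      (ne_of_gt (lt_of_lt_of_le hs1a hs))).1.differentiableWithinAt)
    (fun s hs => by
      have hs : s1 ≤ s := interior_subset hs
      have := hR s (by
        rw [abs_of_nonneg (by linarith [abs_nonneg R])]; linarith [le_abs_self R])
      rw [abs_of_neg (D s (lt_of_lt_of_le hs1a hs))] at this
      linarith)
  have hW1 := h.nonneg s1
  have hx : s1 ≤ s1 + (W s1 + 1) / L := by
    have : 0 ≤ (W s1 + 1) / L := by positivity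
    linarith
  have := key s1 (by simp) (s1 + (W s1 + 1) / L) hx hx
  have e : -L * ((s1 + (W s1 + 1) / L) - s1) = -(W s1 + 1) := by field_simp; ring
  rw [e] at this
  linarith [h.nonneg (s1 + (W s1 + 1) / L)]

lemma DoubleWell.near_c (h : DoubleWell W a b c q l) :
    ∀ᶠ s in 𝓝[≠] c, (s < c → 0 < deriv W s) ∧ (c < s → deriv W s < 0) := by
  have hd : DifferentiableAt ℝ (deriv W) c := differentiableAt_of_deriv_ne_zero h.concave_c.ne
  have hs := (hasDerivAt_iff_tendsto_slope.mp hd.hasDerivAt).eventually (gt_mem_nhds h.concave_c)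
  have hc : deriv W c = 0 := (h.deriv_zeros c).mpr (by simp)
  filter_upwards [hs] with s hs
  rw [slope_def_field, hc, sub_zero] at hs
  constructor
  · intro h1
    by_contra h2
    push Not at h2
    have := div_nonneg_of_nonpos h2 (by linarith : s - c ≤ 0)
    linarith
  · intro h1
    by_contra h2
    push Not at h2
    have := div_nonneg h2 (by linarith : 0 ≤ s - c)
    linarith

lemma DoubleWell.sgnac (h : DoubleWell W a b c q l) : ∀ s ∈ Ioo a c, 0 < deriv W s := by
  have D := hasDerivWithinAt_forall_lt_or_forall_gt_of_forall_ne (convex_Ioo a c) (f := W)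
    (f' := deriv W) (m := 0)
    (fun s hs => (h.diffAt (ne_of_gt hs.1) (ne_of_lt (hs.2.trans h.lt_cb))).1.hasDerivAt.hasDerivWithinAt)
    (fun s hs h0 => by
      have := (h.deriv_zeros s).mp h0
      have h1 := hs.1; have h2 := hs.2
      have := h.lt_cb
      rcases ‹s = a ∨ _› with r | r | r <;> linarith)
  rcases D with D | D
  swap
  · exact fun s hs => D s hs
  exfalso
  have h1 := h.near_c.filter_mono (nhdsWithin_mono c (show Iio c ⊆ {c}ᶜ from fun x hx => (ne_of_lt hx : x ≠ c)))
  have h2 := h1.and (Ioo_mem_nhdsLT h.lt_ac)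
  obtain ⟨s, hs, hs2⟩ := h2.exists
  linarith [hs.1 hs2.2, D s hs2]

lemma DoubleWell.sgncb (h : DoubleWell W a b c q l) : ∀ s ∈ Ioo c b, deriv W s < 0 := by
  have D := hasDerivWithinAt_forall_lt_or_forall_gt_of_forall_ne (convex_Ioo c b) (f := W)
    (f' := deriv W) (m := 0)
    (fun s hs => (h.diffAt (ne_of_gt (h.lt_ac.trans hs.1)) (ne_of_lt hs.2)).1.hasDerivAt.hasDerivWithinAt)
    (fun s hs h0 => by
      have := (h.deriv_zeros s).mp h0
      have h1 := hs.1; have h2 := hs.2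
      have := h.lt_ac
      rcases ‹s = a ∨ _› with r | r | r <;> linarith)
  rcases D with D | D
  · exact fun s hs => D s hs
  exfalso
  have h1 := h.near_c.filter_mono (nhdsWithin_mono c (show Ioi c ⊆ {c}ᶜ from fun x hx => (ne_of_gt hx : x ≠ c)))
  have h2 := h1.and (Ioo_mem_nhdsGT h.lt_cb)
  obtain ⟨s, hs, hs2⟩ := h2.exists
  linarith [hs.2 hs2.1, D s hs2]

lemma DoubleWell.qlA (h : DoubleWell W a b c q l) (Λ : ℝ) (hΛ : q = 1 → 2 * Λ < l) : QL W a Λ := by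
  apply ql_of_lim W a q l Λ h.q_mem.2 h.l_pos hΛ h.lim_a h.nonneg ((h.zeros a).mpr (by simp))
  · have : ∀ᶠ s in 𝓝[≠] a, s < b := nhdsWithin_le_nhds (Iio_mem_nhds h.lt_ab)
    filter_upwards [self_mem_nhdsWithin, this] with s hs h2
    exact h.diffAt hs (ne_of_lt h2)
  · have : ∀ᶠ s in 𝓝[≠] a, s < c := nhdsWithin_le_nhds (Iio_mem_nhds h.lt_ac)
    filter_upwards [this] with s hs
    exact ⟨fun h1 => (h.sgnL s h1).le, fun h1 => (h.sgnac s ⟨h1, hs⟩).le⟩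

lemma DoubleWell.qlB (h : DoubleWell W a b c q l) (Λ : ℝ) (hΛ : q = 1 → 2 * Λ < l) : QL W b Λ := by
  apply ql_of_lim W b q l Λ h.q_mem.2 h.l_pos hΛ h.lim_b h.nonneg ((h.zeros b).mpr (by simp))
  · have : ∀ᶠ s in 𝓝[≠] b, a < s := nhdsWithin_le_nhds (Ioi_mem_nhds h.lt_ab)
    filter_upwards [self_mem_nhdsWithin, this] with s hs h2
    exact h.diffAt (ne_of_gt h2) hs
  · have : ∀ᶠ s in 𝓝[≠] b, c < s := nhdsWithin_le_nhds (Ioi_mem_nhds h.lt_cb)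
    filter_upwards [this] with s hs
    exact ⟨fun h1 => (h.sgncb s ⟨hs, h1⟩).le, fun h1 => (h.sgnR s h1).le⟩

lemma DoubleWell.measurable (h : DoubleWell W a b c q l) : Measurable W := by
  have hm : MeasurableSet (({a, b} : Set ℝ)ᶜ) := (Set.toFinite _).measurableSet.compl
  have := h.smooth.continuousOn.measurable_piecewise (continuousOn_const (c := (0:ℝ)) ) hm
    (s := ({a, b} : Set ℝ)ᶜ)
  convert this using 1
  funext s
  by_cases hs : s ∈ (({a, b} : Set ℝ)ᶜ)
  · rw [Set.piecewise_eq_of_mem _ _ _ hs]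
  · rw [Set.piecewise_eq_of_notMem _ _ _ hs]
    rw [h.zeros]; simp only [mem_compl_iff, mem_insert_iff, mem_singleton_iff, not_not] at hs; exact hs

lemma DoubleWell.growth (h : DoubleWell W a b c q l) : ∃ L > 0, ∃ R : ℝ, ∀ s, R ≤ |s| → L * |s| ≤ W s := by
  obtain ⟨L, hL, R, hR⟩ := h.coercive
  set r := |R| + |a| + |b| + 1 with hr
  have hab := h.lt_ab
  have e1 := abs_nonneg R
  have e2 := abs_nonneg a
  have e3 := abs_nonneg b
  have e4 := neg_abs_le a
  have e5 := le_abs_self b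
  have e6 := le_abs_self R
  have dr : ∀ s, r ≤ s → DifferentiableAt ℝ W s := fun s hs =>
    (h.diffAt (by intro h; linarith) (by intro h; linarith)).1
  have dl : ∀ s, s ≤ -r → DifferentiableAt ℝ W s := fun s hs =>
    (h.diffAt (by intro h; linarith) (by intro h; linarith)).1
  have kR := Convex.mul_sub_le_image_sub_of_le_deriv (convex_Ici r) (f := W) (C := L)
    (fun s hs => (dr s hs).continuousAt.continuousWithinAt)
    (fun s hs => (dr s (interior_subset hs)).differentiableWithinAt)
    (fun s hs => by
      have hs : r ≤ s := interior_subset hs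
      have := hR s (by rw [abs_of_nonneg (by linarith)]; linarith)
      rwa [abs_of_pos (h.sgnR s (by linarith))] at this)
  have kL := Convex.image_sub_le_mul_sub_of_deriv_le (convex_Iic (-r)) (f := W) (C := -L)
    (fun s hs => (dl s hs).continuousAt.continuousWithinAt)
    (fun s hs => (dl s (mem_Iic.mp (interior_subset hs))).differentiableWithinAt)
    (fun s hs => by
      have hs : s ≤ -r := mem_Iic.mp (interior_subset hs)
      have := hR s (by rw [abs_of_nonpos (by linarith)]; linarith)
      rw [abs_of_neg (h.sgnL s (by linarith))] at this
      linarith)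
  refine ⟨L / 2, by linarith, 2 * r, fun s hs => ?_⟩
  rcases le_or_gt 0 s with h0 | h0
  · rw [abs_of_nonneg h0] at hs ⊢
    have := kR r (by simp) s (show r ≤ s by linarith) (by linarith)
    nlinarith [h.nonneg r]
  · rw [abs_of_neg h0] at hs ⊢
    have := kL s (show s ≤ -r by linarith) (-r) (by simp) (by linarith)
    nlinarith [h.nonneg (-r)]

lemma cont_right_aux (W : ℝ → ℝ) (a c : ℝ) (hac : a < c) (h0 : ∀ s, 0 ≤ W s) (hWa : W a = 0)
    (hm : MonotoneOn W (Icc a c)) (hno : ¬ ∃ w > 0, ∀ s ∈ Ioc a c, w ≤ W s) :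
    ContinuousWithinAt W (Ici a) a := by
  rw [Metric.continuousWithinAt_iff]
  intro w hw
  push Not at hno
  obtain ⟨s, hs, hsw⟩ := hno w hw
  refine ⟨s - a, by linarith [hs.1], fun {x} hx hd => ?_⟩
  have hx : a ≤ x := hx
  rw [Real.dist_eq, abs_of_nonneg (by linarith)] at hd
  rw [Real.dist_eq, hWa, sub_zero, abs_of_nonneg (h0 x)]
  exact lt_of_le_of_lt (hm ⟨hx, by linarith [hs.2]⟩ ⟨hs.1.le, hs.2⟩ (by linarith)) hsw

lemma DoubleWell.toWF (h : DoubleWell W a b c q l) {z : ℝ → ℝ} (hz : CauchyProfile W a b c z) :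
    WF W a b c := by
  have hWa : W a = 0 := (h.zeros a).mpr (by simp)
  have hWb : W b = 0 := (h.zeros b).mpr (by simp)
  have hac := h.lt_ac
  have hcb := h.lt_cb
  have hmono : MonotoneOn W (Icc a c) := by
    have m1 : MonotoneOn W (Ioc a c) := by
      apply monotoneOn_of_deriv_nonneg (convex_Ioc a c)
      · exact fun s hs => (h.diffAt (ne_of_gt hs.1)
          (ne_of_lt (lt_of_le_of_lt hs.2 hcb))).1.continuousAt.continuousWithinAt
      · exact fun s hs => (h.diffAt (ne_of_gt (interior_subset hs).1)
          (ne_of_lt (lt_of_le_of_lt (interior_subset hs).2 hcb))).1.differentiableWithinAt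
      · rw [interior_Ioc]; exact fun s hs => (h.sgnac s hs).le
    intro x hx y hy hxy
    rcases eq_or_lt_of_le hx.1 with e | e
    · rw [← e, hWa]; exact h.nonneg y
    · exact m1 ⟨e, hx.2⟩ ⟨e.trans_le hxy, hy.2⟩ hxy
  have hanti : AntitoneOn W (Icc c b) := by
    have m1 : AntitoneOn W (Ico c b) := by
      apply antitoneOn_of_deriv_nonpos (convex_Ico c b)
      · exact fun s hs => (h.diffAt (ne_of_gt (lt_of_lt_of_le hac hs.1))
          (ne_of_lt hs.2)).1.continuousAt.continuousWithinAt
      · exact fun s hs => (h.diffAt (ne_of_gt (lt_of_lt_of_le hac (interior_subset hs).1))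
          (ne_of_lt (interior_subset hs).2)).1.differentiableWithinAt
      · rw [interior_Ico]; exact fun s hs => (h.sgncb s hs).le
    intro x hx y hy hxy
    rcases eq_or_lt_of_le hy.2 with e | e
    · rw [e, hWb]; exact h.nonneg x
    · exact m1 ⟨hx.1, lt_of_le_of_lt hxy e⟩ ⟨hy.1, e⟩ hxy
  have ca : ContinuousWithinAt W (Ici a) a := by
    refine cont_right_aux W a c hac h.nonneg hWa hmono ?_
    rintro ⟨w, hw, H⟩
    exact zcont_aux W z a c w hac hw H hWa hz.ode hz.init (fun t => (hz.range t).1)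
  have cb : ContinuousWithinAt W (Iic b) b := by
    have : ContinuousWithinAt (fun s => W (-s)) (Ici (-b)) (-b) := by
      refine cont_right_aux (fun s => W (-s)) (-b) (-c) (by linarith) (fun s => h.nonneg _) (by simpa) ?_ ?_
      · intro x hx y hy hxy
        exact hanti ⟨by linarith [hy.2], by linarith [hy.1]⟩ ⟨by linarith [hx.2], by linarith [hx.1]⟩
          (by linarith)
      · rintro ⟨w, hw, H⟩
        refine zcont_aux (fun s => W (-s)) (fun t => - z (-t)) (-b) (-c) w (by linarith) hw H (by simpa)
          ?_ (by simp [hz.init]) (fun t => by simpa using (hz.range (-t)).2)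
        intro t
        have := (HasDerivAt.scomp t (hz.ode (-t)) (hasDerivAt_neg t)).neg
        have e : HasDerivAt (fun t => - z (-t)) (-((-1:ℝ) • Real.sqrt (W (z (-t))))) t := this
        exact e.congr_deriv (by simp)
    have h2 := ContinuousWithinAt.comp (x := b) (f := fun s : ℝ => -s) (s := Iic b) this
      continuous_neg.continuousWithinAt (fun x (hx : x ≤ b) => by simpa using hx)
    simpa [Function.comp_def] using h2
  refine ⟨hac, hcb, h.nonneg, hWa, hWb, ?_, hmono, hanti, ?_, ?_, ?_, h.growth, h.measurable, ?_⟩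
  · intro s h1 h2
    exact lt_of_le_of_ne (h.nonneg s) (fun e => by
      rcases (h.zeros s).mp e.symm with h | h <;> contradiction)
  · intro s hs
    rcases eq_or_lt_of_le hs.1 with e | e
    · rw [← e]; exact ca.mono (fun x hx => hx.1)
    rcases eq_or_lt_of_le hs.2 with e' | e'
    · rw [e']; exact cb.mono (fun x hx => hx.2)
    exact (h.diffAt e.ne' e'.ne).1.continuousAt.continuousWithinAt
  · have m1 : AntitoneOn W (Iio a) := by
      apply antitoneOn_of_deriv_nonpos (convex_Iio a)
      · exact fun s hs => (h.diffAt (ne_of_lt hs) (ne_of_lt (lt_trans hs h.lt_ab))).1.continuousAt.continuousWithinAt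
      · rw [interior_Iio]; exact fun s hs => (h.diffAt (ne_of_lt hs) (ne_of_lt (lt_trans hs h.lt_ab))).1.differentiableWithinAt
      · rw [interior_Iio]; exact fun s hs => (h.sgnL s hs).le
    intro x hx y hy hxy
    rcases eq_or_lt_of_le (show y ≤ a from hy) with e | e
    · rw [e, hWa]; exact h.nonneg x
    · exact m1 (lt_of_le_of_lt hxy e) e hxy
  · have m1 : MonotoneOn W (Ioi b) := by
      apply monotoneOn_of_deriv_nonneg (convex_Ioi b)
      · exact fun s hs => (h.diffAt (ne_of_gt (lt_trans h.lt_ab hs)) (ne_of_gt hs)).1.continuousAt.continuousWithinAt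
      · rw [interior_Ioi]; exact fun s hs => (h.diffAt (ne_of_gt (lt_trans h.lt_ab hs)) (ne_of_gt hs)).1.differentiableWithinAt
      · rw [interior_Ioi]; exact fun s hs => (h.sgnR s hs).le
    intro x hx y hy hxy
    rcases eq_or_lt_of_le (show b ≤ x from hx) with e | e
    · rw [← e, hWb]; exact h.nonneg y
    · exact m1 e (lt_of_lt_of_le e hxy) hxy
  · have hl := h.l_pos
    exact ⟨l / 4, by linarith, h.qlA _ (fun _ => by linarith), h.qlB _ (fun _ => by linarith)⟩

end DW

/-- reflection -/
lemma WF.reflect {W : ℝ → ℝ} {a b c : ℝ} (h : WF W a b c) :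
    WF (fun s => W (a + b - s)) a b (a + b - c) := by
  have hac := h.ac
  have hcb := h.cb
  refine ⟨by linarith, by linarith, fun s => h.nonneg _, by simpa using h.Wb, by simpa using h.Wa,
    ?_, ?_, ?_, ?_, ?_, ?_, ?_, ?_, ?_⟩
  · intro s h1 h2
    exact h.pos _ (fun e => h2 (by linarith)) (fun e => h1 (by linarith))
  · intro x hx y hy hxy
    exact h.anti ⟨by linarith [hy.2], by linarith [hy.1]⟩ ⟨by linarith [hx.2], by linarith [hx.1]⟩ (by linarith)
  · intro x hx y hy hxy
    exact h.mono ⟨by linarith [hy.2], by linarith [hy.1]⟩ ⟨by linarith [hx.2], by linarith [hx.1]⟩ (by linarith)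
  · refine h.cont.comp (by fun_prop) ?_
    intro x hx
    exact ⟨by linarith [hx.2], by linarith [hx.1]⟩
  · intro x hx y hy hxy
    simp only [mem_Iic] at hx hy
    exact h.monoR (show b ≤ _ by linarith) (show b ≤ _ by linarith) (by linarith)
  · intro x hx y hy hxy
    simp only [mem_Ici] at hx hy
    exact h.antiL (show _ ≤ a by linarith) (show _ ≤ a by linarith) (by linarith)
  · obtain ⟨L, hL, R, hR⟩ := h.growth
    refine ⟨L / 2, by linarith, |R| + 2 * |a + b|, fun s hs => ?_⟩
    have e1 : |s| - |a + b| ≤ |a + b - s| := by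
      have := abs_sub_abs_le_abs_sub s (a + b)
      rw [abs_sub_comm] at this; exact this
    have e2 := le_abs_self R
    have e3 := abs_nonneg (a + b)
    have e4 := abs_nonneg R
    have := hR (a + b - s) (by linarith)
    have : |s| / 2 ≤ |a + b - s| := by linarith
    nlinarith
  · exact h.meas.comp (by fun_prop)
  · obtain ⟨Λ, hΛ, ⟨k1, hk1, h1⟩, ⟨k2, hk2, h2⟩⟩ := h.quad
    refine ⟨Λ, hΛ, ⟨k2, hk2, fun s hs => ?_⟩, ⟨k1, hk1, fun s hs => ?_⟩⟩
    · have := h2 (a + b - s) (by rw [show a + b - s - b = -(s - a) by ring, abs_neg]; exact hs)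
      rwa [show (a + b - s - b) ^ 2 = (s - a) ^ 2 by ring] at this
    · have := h1 (a + b - s) (by rw [show a + b - s - a = -(s - b) by ring, abs_neg]; exact hs)
      rwa [show (a + b - s - a) ^ 2 = (s - b) ^ 2 by ring] at this

lemma QL.reflect {W : ℝ → ℝ} {a b Λ : ℝ} (h : QL W a Λ) : QL (fun s => W (a + b - s)) b Λ := by
  obtain ⟨k, hk, h1⟩ := h
  refine ⟨k, hk, fun s hs => ?_⟩
  have := h1 (a + b - s) (by rw [show a + b - s - a = -(s - b) by ring, abs_neg]; exact hs)
  rwa [show (a + b - s - a) ^ 2 = (s - b) ^ 2 by ring] at this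

end

section

/-! ### Part 2: truncated root of the potential and its primitive -/

/-- `√W` truncated to `[a,b]`. -/
noncomputable def ff (W : ℝ → ℝ) (a b s : ℝ) : ℝ := Real.sqrt (W (max a (min b s)))

/-- `∫_s^b √W`. -/
noncomputable def psi (W : ℝ → ℝ) (a b s : ℝ) : ℝ := ∫ σ in s..b, ff W a b σ

/-- regularised corrector integral -/
noncomputable def JJ (W : ℝ → ℝ) (a b : ℝ) (h : ℝ → ℝ) (ε s : ℝ) : ℝ :=
  ∫ σ in s..b, h σ * (ff W a b σ / (ff W a b σ ^ 2 + ε ^ 2))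

section WFs
variable {W : ℝ → ℝ} {a b c : ℝ}

lemma WF.ab (h : WF W a b c) : a < b := h.ac.trans h.cb

lemma ff_nonneg (W : ℝ → ℝ) (a b s : ℝ) : 0 ≤ ff W a b s := Real.sqrt_nonneg _

lemma WF.ff_cont (h : WF W a b c) : Continuous (ff W a b) := by
  unfold ff
  apply Real.continuous_sqrt.comp
  apply h.cont.comp_continuous (by fun_prop)
  intro s
  exact ⟨le_max_left _ _, max_le h.ab.le (min_le_left _ _)⟩

lemma ff_eq {s : ℝ} (h1 : a ≤ s) (h2 : s ≤ b) : ff W a b s = Real.sqrt (W s) := by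
  unfold ff; rw [min_eq_right h2, max_eq_right h1]

lemma WF.ff_sq (h : WF W a b c) {s : ℝ} (h1 : a ≤ s) (h2 : s ≤ b) : ff W a b s ^ 2 = W s := by
  rw [ff_eq h1 h2, Real.sq_sqrt (h.nonneg s)]

lemma WF.ff_ge (h : WF W a b c) {s : ℝ} (h2 : b ≤ s) : ff W a b s = 0 := by
  unfold ff; rw [min_eq_left h2, max_eq_right h.ab.le, h.Wb, Real.sqrt_zero]

lemma WF.ff_le (h : WF W a b c) {s : ℝ} (h2 : s ≤ a) : ff W a b s = 0 := by
  unfold ff; rw [min_eq_right (h2.trans h.ab.le), max_eq_left h2, h.Wa, Real.sqrt_zero]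

lemma WF.ff_sq_le (h : WF W a b c) (s : ℝ) : ff W a b s ^ 2 ≤ W s := by
  rcases le_total s a with h1 | h1
  · rw [h.ff_le h1]; simpa using h.nonneg s
  rcases le_total b s with h2 | h2
  · rw [h.ff_ge h2]; simpa using h.nonneg s
  rw [h.ff_sq h1 h2]

lemma WF.W_le_c (h : WF W a b c) {s : ℝ} (h1 : a ≤ s) (h2 : s ≤ b) : W s ≤ W c := by
  rcases le_total s c with hc | hc
  · exact h.mono ⟨h1, hc⟩ ⟨h.ac.le, le_rfl⟩ hc
  · exact h.anti ⟨le_rfl, h.cb.le⟩ ⟨hc, h2⟩ hc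

lemma WF.ff_bdd (h : WF W a b c) (s : ℝ) : ff W a b s ≤ Real.sqrt (W c) := by
  unfold ff
  apply Real.sqrt_le_sqrt
  exact h.W_le_c (le_max_left _ _) (max_le h.ab.le (min_le_left _ _))

lemma WF.ff_pos (h : WF W a b c) {s : ℝ} (h1 : a < s) (h2 : s < b) : 0 < ff W a b s := by
  rw [ff_eq h1.le h2.le]
  exact Real.sqrt_pos.mpr (h.pos s h1.ne' h2.ne)

lemma WF.psi_deriv (h : WF W a b c) (s : ℝ) : HasDerivAt (psi W a b) (- ff W a b s) s :=
  intervalIntegral.integral_hasDerivAt_left (h.ff_cont.intervalIntegrable _ _)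
    h.ff_cont.stronglyMeasurable.stronglyMeasurableAtFilter h.ff_cont.continuousAt

lemma WF.psi_cont (h : WF W a b c) : Continuous (psi W a b) :=
  continuous_iff_continuousAt.mpr fun s => (h.psi_deriv s).continuousAt

lemma WF.psi_anti (h : WF W a b c) : Antitone (psi W a b) := by
  apply antitone_of_deriv_nonpos (fun s => (h.psi_deriv s).differentiableAt)
  intro s; rw [(h.psi_deriv s).deriv]; linarith [ff_nonneg W a b s]

lemma psi_b (W : ℝ → ℝ) (a b : ℝ) : psi W a b b = 0 := by simp [psi]

lemma WF.psi_ge (h : WF W a b c) {s : ℝ} (hs : b ≤ s) : psi W a b s = 0 := by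
  unfold psi
  rw [intervalIntegral.integral_symm, neg_eq_zero]
  apply intervalIntegral.integral_zero_ae
  refine Eventually.of_forall fun x hx => ?_
  rw [uIoc_of_le hs] at hx
  exact h.ff_ge hx.1.le

lemma WF.psi_nonneg (h : WF W a b c) (s : ℝ) : 0 ≤ psi W a b s := by
  rcases le_total b s with hs | hs
  · rw [h.psi_ge hs]
  · rw [← psi_b W a b]; exact h.psi_anti hs

lemma WF.psi_a_le (h : WF W a b c) {s : ℝ} (hs : s ≤ a) : psi W a b s = psi W a b a := by
  unfold psi
  rw [← intervalIntegral.integral_add_adjacent_intervals (b := a) (h.ff_cont.intervalIntegrable _ _)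
    (h.ff_cont.intervalIntegrable _ _)]
  rw [add_eq_right]
  apply intervalIntegral.integral_zero_ae
  refine Eventually.of_forall fun x hx => ?_
  rw [uIoc_of_le hs] at hx
  exact h.ff_le hx.2

lemma WF.psi_le (h : WF W a b c) (s : ℝ) : psi W a b s ≤ psi W a b a := by
  rcases le_total a s with hs | hs
  · exact h.psi_anti hs
  · rw [h.psi_a_le hs]

lemma WF.psi_a_eq (h : WF W a b c) : psi W a b a = ∫ s in a..b, Real.sqrt (W s) := by
  unfold psi
  apply intervalIntegral.integral_congr
  intro s hs
  rw [uIcc_of_le h.ab.le] at hs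
  exact ff_eq hs.1 hs.2

lemma WF.psi_lin (h : WF W a b c) {s : ℝ} (hs : s ≤ b) : psi W a b s ≤ Real.sqrt (W c) * (b - s) := by
  unfold psi
  calc ∫ σ in s..b, ff W a b σ ≤ ∫ σ in s..b, Real.sqrt (W c) :=
        intervalIntegral.integral_mono_on hs (h.ff_cont.intervalIntegrable _ _)
          (intervalIntegrable_const) (fun x _ => h.ff_bdd x)
    _ = _ := by simp; ring

lemma WF.psi_strict (h : WF W a b c) {s r : ℝ} (h1 : a ≤ s) (h2 : s < r) (h3 : r ≤ b) :
    psi W a b r < psi W a b s := by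
  have : StrictAntiOn (psi W a b) (Icc a b) := by
    apply strictAntiOn_of_deriv_neg (convex_Icc a b) h.psi_cont.continuousOn
    rw [interior_Icc]
    intro x hx
    rw [(h.psi_deriv x).deriv]; linarith [h.ff_pos hx.1 hx.2]
  exact this ⟨h1, by linarith⟩ ⟨by linarith, h3⟩ h2

/-- tail estimates to the right of `α` -/
lemma WF.tail (h : WF W a b c) {α : ℝ} (h1 : a < α) (h2 : α < c) :
    ∃ K > 0, ∀ s, α ≤ s → s ≤ b → b - s ≤ K * ff W a b s ∧ psi W a b s ≤ K * ff W a b s ^ 2 := by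
  have hcb := h.cb
  obtain ⟨Λ, hΛ, -, κ, hκ, hq⟩ := h.quad
  set κ' := min κ (b - c) with hκ'
  have hκ'0 : 0 < κ' := lt_min hκ (by linarith)
  set w := min (W α) (W (b - κ')) with hw
  have hκc : κ' ≤ b - c := min_le_right _ _
  have hw0 : 0 < w := by
    apply lt_min
    · exact h.pos α h1.ne' (by intro e; linarith)
    · exact h.pos _ (by intro e; linarith [h.ac]) (by intro e; linarith)
  have hfar : ∀ s, α ≤ s → s ≤ b - κ' → w ≤ ff W a b s ^ 2 := by
    intro s hs1 hs2
    rw [h.ff_sq (by linarith) (by linarith)]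
    rcases le_total s c with hc | hc
    · exact (min_le_left _ _).trans (h.mono ⟨h1.le, h2.le⟩ ⟨by linarith, hc⟩ hs1)
    · exact (min_le_right _ _).trans (h.anti ⟨hc, by linarith⟩ ⟨by linarith, by linarith⟩ hs2)
  have hnear : ∀ s, b - κ' ≤ s → s ≤ b → Λ * (b - s) ^ 2 ≤ ff W a b s ^ 2 := by
    intro s hs1 hs2
    rw [h.ff_sq (by linarith [h.ac]) hs2]
    have := hq s (by rw [abs_of_nonpos (by linarith)]; linarith [min_le_left κ (b - c)])
    nlinarith
  set K1 := (b - a) / Real.sqrt w + 1 / Real.sqrt Λ with hK1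
  have hsw : 0 < Real.sqrt w := Real.sqrt_pos.mpr hw0
  have hsΛ : 0 < Real.sqrt Λ := Real.sqrt_pos.mpr hΛ
  have hab := h.ab
  have p1 : 0 < (b - a) / Real.sqrt w := div_pos (by linarith) hsw
  have p2 : 0 < 1 / Real.sqrt Λ := by positivity
  have hK1p : 0 < K1 := by positivity
  have hD : ∀ s, α ≤ s → s ≤ b → b - s ≤ K1 * ff W a b s := by
    intro s hs1 hs2
    have f0 := ff_nonneg W a b s
    rcases le_total s (b - κ') with hc | hc
    · have := Real.sqrt_le_sqrt (hfar s hs1 hc)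
      rw [Real.sqrt_sq f0] at this
      calc b - s ≤ b - a := by linarith
        _ = (b - a) / Real.sqrt w * Real.sqrt w := by field_simp
        _ ≤ (b - a) / Real.sqrt w * ff W a b s := by gcongr
        _ ≤ K1 * ff W a b s := by rw [hK1]; nlinarith
    · have := Real.sqrt_le_sqrt (hnear s hc hs2)
      rw [Real.sqrt_sq f0, Real.sqrt_mul hΛ.le, Real.sqrt_sq (by linarith)] at this
      calc b - s = 1 / Real.sqrt Λ * (Real.sqrt Λ * (b - s)) := by field_simp
        _ ≤ 1 / Real.sqrt Λ * ff W a b s := by gcongr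
        _ ≤ K1 * ff W a b s := by rw [hK1]; nlinarith
  have hWα : 0 < W α := h.pos α h1.ne' (by intro e; linarith)
  set K2 := psi W a b a / W α with hK2
  have hK2p : 0 ≤ K2 := div_nonneg (h.psi_nonneg a) hWα.le
  refine ⟨K1 + K2, by positivity, fun s hs1 hs2 => ?_⟩
  have f0 := ff_nonneg W a b s
  refine ⟨(hD s hs1 hs2).trans (by nlinarith), ?_⟩
  rcases le_total s c with hc | hc
  · have : W α ≤ ff W a b s ^ 2 := by
      rw [h.ff_sq (by linarith) hs2]
      exact h.mono ⟨h1.le, h2.le⟩ ⟨by linarith, hc⟩ hs1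
    calc psi W a b s ≤ psi W a b a := h.psi_le s
      _ = K2 * W α := by rw [hK2]; field_simp
      _ ≤ K2 * ff W a b s ^ 2 := by gcongr
      _ ≤ (K1 + K2) * ff W a b s ^ 2 := by nlinarith [sq_nonneg (ff W a b s)]
  · have : psi W a b s ≤ ff W a b s * (b - s) := by
      unfold psi
      calc ∫ σ in s..b, ff W a b σ ≤ ∫ σ in s..b, ff W a b s := by
            apply intervalIntegral.integral_mono_on hs2 (h.ff_cont.intervalIntegrable _ _)
              (intervalIntegrable_const)
            intro x hx
            rw [ff_eq (by linarith [hx.1, h.ac]) hx.2, ff_eq (by linarith [h.ac]) hs2]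
            exact Real.sqrt_le_sqrt (h.anti ⟨hc, hs2⟩ ⟨hc.trans hx.1, hx.2⟩ hx.1)
        _ = _ := by simp; ring
    calc psi W a b s ≤ ff W a b s * (b - s) := this
      _ ≤ ff W a b s * (K1 * ff W a b s) := by gcongr; exact hD s hs1 hs2
      _ ≤ (K1 + K2) * ff W a b s ^ 2 := by nlinarith [sq_nonneg (ff W a b s)]

lemma WF.JJ_integrand_cont (hw : WF W a b c) {h : ℝ → ℝ} (hh : Continuous h) {ε : ℝ} (hε : 0 < ε) :
    Continuous (fun σ => h σ * (ff W a b σ / (ff W a b σ ^ 2 + ε ^ 2))) := by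
  have := hw.ff_cont
  refine hh.mul (this.div (by fun_prop) (fun x => ?_))
  positivity

lemma WF.JJ_deriv (hw : WF W a b c) {h : ℝ → ℝ} (hh : Continuous h) {ε : ℝ} (hε : 0 < ε) (s : ℝ) :
    HasDerivAt (JJ W a b h ε) (- (h s * (ff W a b s / (ff W a b s ^ 2 + ε ^ 2)))) s := by
  have := hw.JJ_integrand_cont hh hε
  exact intervalIntegral.integral_hasDerivAt_left (this.intervalIntegrable _ _)
    this.stronglyMeasurable.stronglyMeasurableAtFilter this.continuousAt

lemma WF.JJ_ge (hw : WF W a b c) (h : ℝ → ℝ) (ε : ℝ) {s : ℝ} (hs : b ≤ s) : JJ W a b h ε s = 0 := by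
  unfold JJ
  rw [intervalIntegral.integral_symm, neg_eq_zero]
  apply intervalIntegral.integral_zero_ae
  refine Eventually.of_forall fun x hx => ?_
  rw [uIoc_of_le hs] at hx
  rw [hw.ff_ge hx.1.le]; simp

lemma ratio_le (f ε : ℝ) (hε : 0 < ε) : f ^ 2 / (f ^ 2 + ε ^ 2) ≤ 1 := by
  rw [div_le_one (by positivity)]; nlinarith

lemma WF.JJ_bound (hw : WF W a b c) {h : ℝ → ℝ} (hh : Continuous h) {ε : ℝ} (hε : 0 < ε) {α K : ℝ}
    (hK : ∀ s, α ≤ s → s ≤ b → |h s| ≤ K * ff W a b s) (hK0 : 0 ≤ K) {s : ℝ} (h1 : α ≤ s) (h2 : s ≤ b) :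
    |JJ W a b h ε s| ≤ K * (b - s) := by
  unfold JJ
  have := intervalIntegral.norm_integral_le_of_norm_le_const (a := s) (b := b) (C := K)
    (f := fun σ => h σ * (ff W a b σ / (ff W a b σ ^ 2 + ε ^ 2))) ?_
  · rwa [Real.norm_eq_abs, abs_of_nonneg (by linarith : 0 ≤ b - s)] at this
  · intro x hx
    rw [uIoc_of_le h2] at hx
    have f0 := ff_nonneg W a b x
    rw [Real.norm_eq_abs, abs_mul, abs_of_nonneg (a := ff W a b x / _) (by positivity)]
    calc |h x| * (ff W a b x / (ff W a b x ^ 2 + ε ^ 2)) ≤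
        (K * ff W a b x) * (ff W a b x / (ff W a b x ^ 2 + ε ^ 2)) := by
          gcongr; exact hK x (by linarith [hx.1]) hx.2
      _ = K * (ff W a b x ^ 2 / (ff W a b x ^ 2 + ε ^ 2)) := by ring
      _ ≤ K * 1 := by gcongr; exact ratio_le _ _ hε
      _ = K := mul_one K

end WFs

end

section

/-! ### Part 3: pointwise inequalities -/

section P3
variable {W : ℝ → ℝ} {a b c : ℝ}

lemma WF.mid_pos (h : WF W a b c) {α γ : ℝ} (h1 : a < α) (h2 : γ < b) :
    ∃ w > 0, ∀ s, α ≤ s → s ≤ γ → w ≤ W s := by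
  rcases lt_or_ge γ α with hlt | hle
  · exact ⟨1, one_pos, fun s h3 h4 => by linarith⟩
  refine ⟨min (W α) (W γ), lt_min (h.pos _ h1.ne' (by intro e; linarith))
    (h.pos _ (by intro e; linarith) h2.ne), fun s h3 h4 => ?_⟩
  rcases le_total s c with hc | hc
  · exact (min_le_left _ _).trans (h.mono ⟨h1.le, by linarith⟩ ⟨by linarith, hc⟩ h3)
  · exact (min_le_right _ _).trans (h.anti ⟨hc, by linarith⟩ ⟨by linarith, by linarith⟩ h4)

lemma WF.far (h : WF W a b c) {α κ : ℝ} (h1 : a < α) (hκ : 0 < κ) :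
    ∃ k > 0, ∀ s, α ≤ s → κ ≤ |s - b| → k * |s - b| ≤ W s := by
  obtain ⟨w, hw, hmid⟩ := h.mid_pos (α := α) (γ := b - κ) h1 (by linarith)
  obtain ⟨L, hL, R, hR⟩ := h.growth
  have hab := h.ab
  have hw2 : 0 < W (b + κ) := h.pos _ (by intro e; linarith) (by intro e; linarith)
  have b1 := neg_abs_le b
  have b2 := le_abs_self b
  have r1 := le_abs_self R
  have r2 := abs_nonneg R
  have b3 := abs_nonneg b
  set R' := |R| + 2 * |b| + 1 with hR'
  have dpos : 0 < b - a := by linarith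
  have rpos : 0 < R' := by positivity
  set k := min (w / (b - a)) (min (W (b + κ) / R') (L / 2)) with hk
  have hk0 : 0 < k := by
    refine lt_min (by positivity) (lt_min (by positivity) (by positivity))
  have k1 : k ≤ w / (b - a) := min_le_left _ _
  have k2 : k ≤ W (b + κ) / R' := (min_le_right _ _).trans (min_le_left _ _)
  have k3 : k ≤ L / 2 := (min_le_right _ _).trans (min_le_right _ _)
  rw [le_div_iff₀ dpos] at k1
  rw [le_div_iff₀ rpos] at k2
  refine ⟨k, hk0, fun s hs hd => ?_⟩
  rcases le_total s b with hb | hb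
  · rw [abs_of_nonpos (by linarith)] at hd ⊢
    have := hmid s hs (by linarith)
    nlinarith
  · rw [abs_of_nonneg (by linarith)] at hd ⊢
    rcases le_total (s - b) R' with hr | hr
    · have := h.monoR (show b ≤ b + κ by linarith) (show b ≤ s from hb) (by linarith)
      nlinarith
    · have := hR s (by rw [abs_of_nonneg (by linarith)]; linarith)
      rw [abs_of_nonneg (by linarith)] at this
      have : k * (s - b) ≤ L / 2 * (s - b) := by
        apply mul_le_mul_of_nonneg_right k3 (by linarith)
      nlinarith

/-- first pointwise inequality -/
lemma WF.pt1 (h : WF W a b c) {α Λ : ℝ} (h1 : a < α) (hΛ : 0 < Λ) (hq : QL W b Λ) (M : ℝ) :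
    ∃ ε0 > 0, ∀ ε, 0 < ε → ε < ε0 → ∀ μ, |μ| ≤ M → ∀ s, α ≤ s →
      -(ε * (μ ^ 2 / (4 * Λ))) ≤ W s / ε + μ * (s - b) := by
  obtain ⟨κ, hκ, hq⟩ := hq
  obtain ⟨k, hk, hfar⟩ := h.far h1 hκ
  refine ⟨k / (|M| + 1), by positivity, fun ε hε hε0 μ hμ s hs => ?_⟩
  rw [lt_div_iff₀ (by positivity)] at hε0
  rcases le_total (|s - b|) κ with hd | hd
  · have h3 := hq s hd
    have h4 : Λ * (s - b) ^ 2 / ε ≤ W s / ε := by gcongr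
    have h5 : Λ * (s - b) ^ 2 / ε + μ * (s - b) + ε * (μ ^ 2 / (4 * Λ)) =
        (2 * Λ * (s - b) + ε * μ) ^ 2 / (4 * Λ * ε) := by field_simp; ring
    have h6 : 0 ≤ (2 * Λ * (s - b) + ε * μ) ^ 2 / (4 * Λ * ε) := by positivity
    linarith
  · have h3 := hfar s hs hd
    have h4 : |μ| * |s - b| ≤ W s / ε := by
      rw [le_div_iff₀ hε]
      have : |μ| ≤ |M| := hμ.trans (le_abs_self M)
      have : ε * |μ| ≤ k := by nlinarith
      nlinarith [abs_nonneg (s - b)]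
    have h5 := neg_abs_le (μ * (s - b))
    rw [abs_mul] at h5
    have h6 : 0 ≤ ε * (μ ^ 2 / (4 * Λ)) := by positivity
    linarith

/-- cutoff in the value variable -/
lemma exists_theta {α γ : ℝ} (h : α < γ) :
    ∃ Θ Θ' : ℝ → ℝ, ∃ B > 0, (∀ s, HasDerivAt Θ (Θ' s) s) ∧ (∀ s, |Θ' s| ≤ B) ∧
      (∀ s, 0 ≤ Θ s) ∧ (∀ s, Θ s ≤ 1) ∧ (∀ s ≤ α, Θ s = 1) ∧ (∀ s, γ ≤ s → Θ s = 0) ∧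
      (∀ s, s ≤ α ∨ γ ≤ s → Θ' s = 0) := by
  set g : ℝ → ℝ := fun s => max 0 ((s - α) * (γ - s)) with hg
  have gc : Continuous g := by fun_prop
  have g0 : ∀ s, 0 ≤ g s := fun s => le_max_left _ _
  have gz : ∀ s, s ≤ α ∨ γ ≤ s → g s = 0 := by
    intro s hs
    apply max_eq_left
    rcases hs with hs | hs
    · exact mul_nonpos_of_nonpos_of_nonneg (by linarith) (by linarith)
    · exact mul_nonpos_of_nonneg_of_nonpos (by linarith) (by linarith)
  set P : ℝ → ℝ := fun s => ∫ σ in s..γ, g σ with hP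
  have Pd : ∀ s, HasDerivAt P (- g s) s := fun s =>
    intervalIntegral.integral_hasDerivAt_left (gc.intervalIntegrable _ _)
      gc.stronglyMeasurable.stronglyMeasurableAtFilter gc.continuousAt
  have Panti : Antitone P := by
    apply antitone_of_deriv_nonpos (fun s => (Pd s).differentiableAt)
    intro s; rw [(Pd s).deriv]; linarith [g0 s]
  have Pγ : ∀ s, γ ≤ s → P s = 0 := by
    intro s hs
    simp only [hP]
    rw [intervalIntegral.integral_symm, neg_eq_zero]
    apply intervalIntegral.integral_zero_ae
    refine Eventually.of_forall fun x hx => ?_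
    rw [uIoc_of_le hs] at hx
    exact gz x (Or.inr hx.1.le)
  have Pα : ∀ s, s ≤ α → P s = P α := by
    intro s hs
    simp only [hP]
    rw [← intervalIntegral.integral_add_adjacent_intervals (b := α) (gc.intervalIntegrable _ _)
      (gc.intervalIntegrable _ _), add_eq_right]
    apply intervalIntegral.integral_zero_ae
    refine Eventually.of_forall fun x hx => ?_
    rw [uIoc_of_le hs] at hx
    exact gz x (Or.inl hx.2)
  have P0 : ∀ s, 0 ≤ P s := by
    intro s
    rcases le_total γ s with hs | hs
    · rw [Pγ s hs]
    · rw [← Pγ γ le_rfl]; exact Panti hs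
  have Ple : ∀ s, P s ≤ P α := by
    intro s
    rcases le_total α s with hs | hs
    · exact Panti hs
    · rw [Pα s hs]
  have Pp : 0 < P α := by
    apply intervalIntegral.intervalIntegral_pos_of_pos_on (gc.intervalIntegrable _ _) _ h
    intro x hx
    exact lt_max_of_lt_right (mul_pos (by linarith [hx.1]) (by linarith [hx.2]))
  refine ⟨fun s => P s / P α, fun s => - g s / P α, (γ - α) ^ 2 / P α, ?_, fun s => (Pd s).div_const _, ?_,
    fun s => div_nonneg (P0 s) Pp.le, fun s => (div_le_one Pp).mpr (Ple s), ?_, ?_, ?_⟩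
  · have : 0 < γ - α := by linarith
    positivity
  · intro s
    rw [abs_div, abs_neg, abs_of_nonneg (g0 s), abs_of_pos Pp]
    gcongr
    apply max_le (by positivity)
    nlinarith [sq_nonneg (s - α - (γ - s)), sq_nonneg (s - α), sq_nonneg (γ - s), sq_nonneg (γ - α)]
  · intro s hs; simp only [Pα s hs]; exact div_self Pp.ne'
  · intro s hs; simp [Pγ s hs]
  · intro s hs; simp [gz s hs]

/-- second pointwise inequality: outer lemma -/
lemma WF.pt2 (h : WF W a b c) {α γ B : ℝ} (h1 : a < α) (h2 : γ < b) (hB : 0 < B) (M : ℝ) :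
    ∃ C > 0, ∃ k > 0, ∀ Λ > 0, QL W b Λ → ∃ ε0 > 0, ∀ ε, 0 < ε → ε < ε0 → ∀ μ, |μ| ≤ M →
      ∀ s p θ θ' : ℝ, 0 ≤ θ → |θ'| ≤ B → (s ≤ α → θ = 1) → (s ≤ α ∨ γ ≤ s → θ' = 0) →
      - C * θ + k * |θ'| * |p| ≤ W s / ε + ε * p ^ 2 + μ * (s - b) + ε * (μ ^ 2 / (4 * Λ)) := by
  obtain ⟨w, hw, hmid⟩ := h.mid_pos (α := α) (γ := γ) h1 h2
  obtain ⟨L, hL, R, hR⟩ := h.growth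
  have hab := h.ab
  refine ⟨(|M| + 1) * (|b| + |R|  + 1), by positivity, Real.sqrt w / B, by positivity, ?_⟩
  intro Λ hΛ hq
  obtain ⟨ε1, hε1, H1⟩ := h.pt1 h1 hΛ hq M
  refine ⟨min ε1 (min (L / (|M| + 1)) (w / (2 * (|M| + 1) * (b - a)))), ?_, ?_⟩
  · have : 0 < b - a := by linarith
    exact lt_min hε1 (lt_min (by positivity) (by positivity))
  intro ε hε hε0 μ hμ s p θ θ' hθ hθ' hα hα'
  have e1 : ε < ε1 := hε0.trans_le (min_le_left _ _)
  have e2 : ε < L / (|M| + 1) := hε0.trans_le ((min_le_right _ _).trans (min_le_left _ _))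
  have e3 : ε < w / (2 * (|M| + 1) * (b - a)) := hε0.trans_le ((min_le_right _ _).trans (min_le_right _ _))
  have dab : 0 < b - a := by linarith
  rw [lt_div_iff₀ (by positivity)] at e2 e3
  have hμ' : |μ| ≤ |M| := hμ.trans (le_abs_self M)
  have hμ0 := abs_nonneg μ
  have hp : 0 ≤ ε * p ^ 2 := by positivity
  have hq4 : 0 ≤ ε * (μ ^ 2 / (4 * Λ)) := by positivity
  have hm := neg_abs_le (μ * (s - b))
  rw [abs_mul] at hm
  rcases le_or_gt s α with hs | hs
  · rw [hα hs, hα' (Or.inl hs), abs_zero]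
    have hsb : |s - b| ≤ |s| + |b| := abs_sub s b
    have h3 : |μ| * |s - b| ≤ |M| * (|s| + |b|) := by gcongr
    have hR0 := abs_nonneg R
    have hb0 := abs_nonneg b
    have hM0 := abs_nonneg M
    have hs0 := abs_nonneg s
    rcases le_total (|s|) (|R|) with hr | hr
    · have h4 : 0 ≤ W s / ε := div_nonneg (h.nonneg s) hε.le
      nlinarith
    · have h4 := hR s ((le_abs_self R).trans hr)
      have h5 : (|M| + 1) * |s| ≤ W s / ε := by
        rw [le_div_iff₀ hε]; nlinarith
      nlinarith
  · have hP := H1 ε hε e1 μ hμ s hs.le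
    have hC : 0 ≤ (|M| + 1) * (|b| + |R|  + 1) * θ := by positivity
    rcases le_or_gt γ s with hs2 | hs2
    · rw [hα' (Or.inr hs2), abs_zero]
      nlinarith
    · have h3 := hmid s hs.le hs2.le
      have hsb : |s - b| ≤ b - a := by rw [abs_of_neg (by linarith)]; linarith
      have h4 : |μ| * |s - b| ≤ |M| * (b - a) := by gcongr
      have h5 : w / ε ≤ W s / ε := by gcongr
      have h6 : (|M| + 1) * (b - a) ≤ w / ε / 2 := by
        rw [div_div, le_div_iff₀ (by positivity)]; nlinarith
      have h7 : Real.sqrt w / B * |θ'| * |p| ≤ Real.sqrt w * |p| := by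
        have : Real.sqrt w / B * |θ'| ≤ Real.sqrt w := by
          rw [div_mul_eq_mul_div, div_le_iff₀ hB]; gcongr
        gcongr
      have h8 : Real.sqrt w * |p| ≤ w / ε / 2 + ε * p ^ 2 := by
        have e : w / ε / 2 + ε * p ^ 2 - Real.sqrt w * |p| =
            ((Real.sqrt w - ε * |p|) ^ 2 + ε ^ 2 * |p| ^ 2 ) / (2 * ε) := by
          rw [sub_sq, Real.sq_sqrt hw.le, sq_abs]; field_simp; ring_nf; rw [sq_abs]; ring
        have : 0 ≤ ((Real.sqrt w - ε * |p|) ^ 2 + ε ^ 2 * |p| ^ 2 ) / (2 * ε) := by positivity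
        linarith
      have h9 : |M| * (b - a) ≤ (|M| + 1) * (b - a) := by gcongr; linarith
      have h10 : - ((|M| + 1) * (|b| + |R|  + 1)) * θ = - ((|M| + 1) * (|b| + |R|  + 1) * θ) := by ring
      rw [h10]
      linarith

set_option maxHeartbeats 2000000 in
/-- third pointwise inequality: calibration -/
lemma calib_pt {K F0 M m1 : ℝ} (hK : 0 < K) (hF0 : 0 < F0) (hM : 0 < M) (hm1 : 0 < m1) :
    ∃ C > 0, ∀ ε d τ χ f D ψ G η ηx e ex μ ω w p : ℝ, 0 < ε → 0 < d → d ≤ 1 → ε ≤ d ^ 2 →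
      0 ≤ τ → τ ≤ d → χ = 1 - τ ^ 2 / d ^ 2 → 0 ≤ f → f ≤ F0 → 0 ≤ D → D ≤ K * f → 0 ≤ ψ →
      ψ ≤ K * f ^ 2 → |G| ≤ K * f → m1 ≤ η → η ≤ M → |ηx| ≤ M → |e| ≤ M → |ex| ≤ M →
      |η - ηx| ≤ M * τ → |e - ex| ≤ ω → |μ| ≤ M → f ^ 2 ≤ w →
      (-(2 * τ / d ^ 2)) * (-2 * ψ * η + ε * G) + χ * (2 * f * p * η - 2 * ψ * e +
        ε * ((- μ * D * ηx + 2 * ψ * ex) * (f / (f ^ 2 + ε ^ 2)) * p))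
        - C * ε - C * (ω + ε / d ^ 2) * f ^ 2 ≤ (w / ε + ε * p ^ 2) * η - μ * D * η := by
  set A := 3 * K * M ^ 2 + 2 * K * M * F0 + 2 * K with hA
  set B := M ^ 2 * K + 2 * M * K * F0 with hB
  refine ⟨A ^ 2 / (2 * m1) + B + B ^ 2 / (4 * m1) + 2 * K + (4 * K * M) ^ 2 / (2 * m1), by positivity, ?_⟩
  intro ε d τ χ f D ψ G η ηx e ex μ ω w p hε hd hd1 hεd hτ hτd hχ hf hfF hD hDf hψ hψf hG hη1 hη2 hηx he hex
    hηηx hω hμ hw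
  have hη : 0 < η := hm1.trans_le hη1
  have hω0 : 0 ≤ ω := (abs_nonneg _).trans hω
  set r := τ / d with hr
  have hr0 : 0 ≤ r := by positivity
  have hr1 : r ≤ 1 := by rw [hr, div_le_one hd]; exact hτd
  have hχr : χ = 1 - r ^ 2 := by rw [hχ, hr, div_pow]
  have hr2 : r ^ 2 ≤ 1 := pow_le_one₀ hr0 hr1
  have hr3 : 0 ≤ r ^ 2 := sq_nonneg r
  have hr4 : r ^ 2 ≤ r := pow_le_of_le_one hr0 hr1 two_ne_zero
  have hχ0 : 0 ≤ χ := by rw [hχr]; linarith only [hr2]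
  have hχ1 : χ ≤ 1 := by rw [hχr]; linarith only [hr3]
  have hτr : τ ≤ r := by rw [hr, le_div_iff₀ hd]; exact mul_le_of_le_one_right hτ hd1
  set x := f * r with hx
  have hx0 : 0 ≤ x := by positivity
  set N := - μ * D * ηx + 2 * ψ * ex with hN
  set Q := f / (f ^ 2 + ε ^ 2) with hQ
  have hψ2 : ψ ≤ K * F0 * f := by
    calc ψ ≤ K * f ^ 2 := hψf
      _ = K * f * f := by ring
      _ ≤ K * F0 * f := by gcongr
  have hM0 := hM.le
  have hNB : |N| ≤ B * f := by
    rw [hN]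
    have a1 : |(-μ * D * ηx)| ≤ M * (K * f) * M := by
      rw [abs_mul, abs_mul, abs_neg, abs_of_nonneg hD]; gcongr
    have a2 : |2 * ψ * ex| ≤ 2 * (K * F0 * f) * M := by
      rw [abs_mul, abs_mul, abs_of_nonneg hψ, abs_two]; gcongr
    have := abs_add_le (-μ * D * ηx) (2 * ψ * ex)
    have e1 : B * f = M * (K * f) * M + 2 * (K * F0 * f) * M := by rw [hB]; ring
    linarith only [e1, this, a1, a2]
  have hB0 : 0 ≤ B := by positivity
  have hden : 0 < f ^ 2 + ε ^ 2 := by positivity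
  have hfQ : f * Q ≤ 1 := by rw [hQ, ← mul_div_assoc, div_le_one hden, ← pow_two]; exact le_add_of_nonneg_right (sq_nonneg ε)
  have hQ0 : 0 ≤ Q := by positivity
  have hgB : |N * Q| ≤ B := by
    rw [abs_mul, abs_of_nonneg hQ0]
    calc |N| * Q ≤ B * f * Q := by gcongr
      _ = B * (f * Q) := by ring
      _ ≤ B * 1 := by gcongr
      _ = B := mul_one B
  set g := N * Q with hg
  -- complete the square in p
  have sq : χ * (2 * f * p * η + ε * (g * p)) ≤ ε * η * p ^ 2 + χ ^ 2 * (f ^ 2 * η / ε + f * g + ε * g ^ 2 / (4 * η)) := by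
    have e1 : ε * η * p ^ 2 + χ ^ 2 * (f ^ 2 * η / ε + f * g + ε * g ^ 2 / (4 * η)) - χ * (2 * f * p * η + ε * (g * p))
        = (2 * ε * η * p - χ * (2 * f * η + ε * g)) ^ 2 / (4 * ε * η) := by
      field_simp; ring
    have e2 : 0 ≤ (2 * ε * η * p - χ * (2 * f * η + ε * g)) ^ 2 / (4 * ε * η) := by positivity
    linarith only [e1, e2]
  have hχ2 : χ ^ 2 ≤ 1 := pow_le_one₀ hχ0 hχ1
  have hχ2r : χ ^ 2 ≤ 1 - r ^ 2 := by rw [← hχr]; exact pow_le_of_le_one hχ0 hχ1 two_ne_zero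
  have t_g2 : χ ^ 2 * (ε * g ^ 2 / (4 * η)) ≤ B ^ 2 / (4 * m1) * ε := by
    have g2 : g ^ 2 ≤ B ^ 2 := by rw [← sq_abs]; gcongr
    calc χ ^ 2 * (ε * g ^ 2 / (4 * η)) ≤ 1 * (ε * B ^ 2 / (4 * m1)) := by gcongr
      _ = _ := by ring
  have t_fg : χ ^ 2 * (f * g) ≤ χ ^ 2 * N + B * ε := by
    have e1 : f * g = N - N * (ε ^ 2 / (f ^ 2 + ε ^ 2)) := by rw [hg, hQ]; field_simp; ring
    have e2 : |N * (ε ^ 2 / (f ^ 2 + ε ^ 2))| ≤ B * ε := by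
      rw [abs_mul, abs_of_nonneg (a := ε ^ 2 / _) (by positivity)]
      calc |N| * (ε ^ 2 / (f ^ 2 + ε ^ 2)) ≤ B * f * (ε ^ 2 / (f ^ 2 + ε ^ 2)) := by gcongr
        _ = B * ε * ((f * ε) / (f ^ 2 + ε ^ 2)) := by ring
        _ ≤ B * ε * 1 := by
            gcongr
            rw [div_le_one hden]; nlinarith only [sq_nonneg (f - ε), sq_nonneg f, sq_nonneg ε]
        _ = B * ε := by ring
    have e3 := (abs_le.mp e2).1
    have e4 : 0 ≤ B * ε := by positivity
    rw [e1]
    have : χ ^ 2 * (-(N * (ε ^ 2 / (f ^ 2 + ε ^ 2)))) ≤ χ ^ 2 * (B * ε) :=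
      mul_le_mul_of_nonneg_left (by linarith only [e3]) (by positivity)
    have e5 : χ ^ 2 * (B * ε) ≤ B * ε := mul_le_of_le_one_left e4 hχ2
    have e6 : χ ^ 2 * (N - N * (ε ^ 2 / (f ^ 2 + ε ^ 2))) = χ ^ 2 * N + χ ^ 2 * (-(N * (ε ^ 2 / (f ^ 2 + ε ^ 2)))) := by
      ring
    rw [e6]
    linarith only [this, e5]
  have t_w : χ ^ 2 * (f ^ 2 * η / ε) + m1 * x ^ 2 / ε ≤ w / ε * η := by
    have : χ ^ 2 * (f ^ 2 * η) + m1 * x ^ 2 ≤ w * η := by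
      have u1 : χ ^ 2 * (f ^ 2 * η) ≤ (1 - r ^ 2) * (f ^ 2 * η) := by gcongr
      have u2 : m1 * x ^ 2 ≤ η * x ^ 2 := by gcongr
      have u3 : f ^ 2 * η ≤ w * η := by gcongr
      have u4 : x ^ 2 = f ^ 2 * r ^ 2 := by rw [hx]; ring
      have u5 : (1 - r ^ 2) * (f ^ 2 * η) + η * x ^ 2 = f ^ 2 * η := by rw [u4]; ring
      linarith only [u1, u2, u3, u5]
    calc _ = (χ ^ 2 * (f ^ 2 * η) + m1 * x ^ 2) / ε := by ring
      _ ≤ w * η / ε := by gcongr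
      _ = _ := by ring
  have t_1 : μ * D * (η - χ ^ 2 * ηx) ≤ 3 * K * M ^ 2 * x := by
    have u1 : |η - χ ^ 2 * ηx| ≤ 3 * M * r := by
      have : η - χ ^ 2 * ηx = (η - ηx) + (1 - χ ^ 2) * ηx := by ring
      rw [this]
      have v1 := abs_add_le (η - ηx) ((1 - χ ^ 2) * ηx)
      have v2 : |(1 - χ ^ 2) * ηx| ≤ (2 * r) * M := by
        rw [abs_mul, abs_of_nonneg (by linarith only [hχ2])]
        gcongr
        rw [hχr]; nlinarith only [sq_nonneg (r ^ 2), hr4]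
      have v3 : M * τ ≤ M * r := by gcongr
      linarith only [v1, v2, v3, hηηx]
    calc μ * D * (η - χ ^ 2 * ηx) ≤ |μ * D * (η - χ ^ 2 * ηx)| := le_abs_self _
      _ = |μ| * D * |η - χ ^ 2 * ηx| := by rw [abs_mul, abs_mul, abs_of_nonneg hD]
      _ ≤ M * (K * f) * (3 * M * r) := by gcongr
      _ = _ := by rw [hx]; ring
  have t_2 : - (2 * ψ * (χ * e - χ ^ 2 * ex)) ≤ 2 * K * ω * f ^ 2 + 2 * K * M * F0 * x := by
    have u1 : |χ * e - χ ^ 2 * ex| ≤ ω + r ^ 2 * M := by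
      have : χ * e - χ ^ 2 * ex = χ * (e - ex) + χ * (r ^ 2 * ex) := by rw [hχr]; ring
      rw [this]
      have v1 := abs_add_le (χ * (e - ex)) (χ * (r ^ 2 * ex))
      have v2 : |χ * (e - ex)| ≤ 1 * ω := by
        rw [abs_mul, abs_of_nonneg hχ0]; gcongr
      have v3 : |χ * (r ^ 2 * ex)| ≤ 1 * (r ^ 2 * M) := by
        rw [abs_mul, abs_mul, abs_of_nonneg hχ0, abs_of_nonneg (sq_nonneg r)]; gcongr
      linarith only [v1, v2, v3]
    calc - (2 * ψ * (χ * e - χ ^ 2 * ex)) ≤ |2 * ψ * (χ * e - χ ^ 2 * ex)| := neg_le_abs _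
      _ = 2 * ψ * |χ * e - χ ^ 2 * ex| := by rw [abs_mul, abs_of_nonneg (by positivity)]
      _ ≤ 2 * ψ * (ω + r ^ 2 * M) := by gcongr
      _ = 2 * ψ * ω + 2 * ψ * (r * r) * M := by ring
      _ ≤ 2 * (K * f ^ 2) * ω + 2 * (K * F0 * f) * (r * 1) * M := by gcongr
      _ = _ := by rw [hx]; ring
  have t_3 : (2 * τ / d ^ 2) * (2 * ψ * η) ≤ m1 * x ^ 2 / ε / 2 + (4 * K * M) ^ 2 / (2 * m1) * (ε / d ^ 2) * f ^ 2 := by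
    have u1 : (2 * τ / d ^ 2) * (2 * ψ * η) ≤ (2 * τ / d ^ 2) * (2 * (K * f ^ 2) * M) := by gcongr
    have u2 : (2 * τ / d ^ 2) * (2 * (K * f ^ 2) * M) = (4 * K * M) * x * (f / d) := by
      rw [hx, hr]; field_simp; ring
    have u3 : m1 * x ^ 2 / ε / 2 + (4 * K * M) ^ 2 / (2 * m1) * (ε / d ^ 2) * f ^ 2 - (4 * K * M) * x * (f / d) =
        (m1 * x - (4 * K * M) * ε * (f / d)) ^ 2 / (2 * m1 * ε) := by field_simp; ring
    have u4 : 0 ≤ (m1 * x - (4 * K * M) * ε * (f / d)) ^ 2 / (2 * m1 * ε) := by positivity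
    linarith only [u1, u2, u3, u4]
  have t_4 : -((2 * τ / d ^ 2) * (ε * G)) ≤ 2 * K * x := by
    calc -((2 * τ / d ^ 2) * (ε * G)) ≤ |(2 * τ / d ^ 2) * (ε * G)| := neg_le_abs _
      _ = (2 * τ / d ^ 2) * (ε * |G|) := by
          rw [abs_mul, abs_mul, abs_of_nonneg (by positivity), abs_of_pos hε]
      _ ≤ (2 * τ / d ^ 2) * (d ^ 2 * (K * f)) := by gcongr
      _ = 2 * K * f * τ := by field_simp
      _ ≤ 2 * K * f * r := by gcongr
      _ = _ := by rw [hx]; ring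
  have t_A : A * x ≤ m1 * x ^ 2 / ε / 2 + A ^ 2 / (2 * m1) * ε := by
    have u3 : m1 * x ^ 2 / ε / 2 + A ^ 2 / (2 * m1) * ε - A * x = (m1 * x - A * ε) ^ 2 / (2 * m1 * ε) := by
      field_simp; ring
    have u4 : 0 ≤ (m1 * x - A * ε) ^ 2 / (2 * m1 * ε) := by positivity
    linarith only [u3, u4]
  have hAx : A * x = 3 * K * M ^ 2 * x + 2 * K * M * F0 * x + 2 * K * x := by rw [hA]; ring
  -- remaining nonnegative slack
  have s1 : 0 ≤ (A ^ 2 / (2 * m1) + B + B ^ 2 / (4 * m1) + (4 * K * M) ^ 2 / (2 * m1)) * (ω * f ^ 2) := by positivity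
  have s2 : 0 ≤ (A ^ 2 / (2 * m1) + B + B ^ 2 / (4 * m1) + 2 * K) * (ε / d ^ 2 * f ^ 2) := by positivity
  have s3 : 0 ≤ (2 * K + (4 * K * M) ^ 2 / (2 * m1)) * ε := by positivity
  have eN : χ ^ 2 * N = - χ ^ 2 * μ * D * ηx + 2 * ψ * (χ ^ 2 * ex) := by rw [hN]; ring
  have key : (-(2 * τ / d ^ 2)) * (-2 * ψ * η + ε * G) + χ * (2 * f * p * η - 2 * ψ * e + ε * (g * p))
      = (2 * τ / d ^ 2) * (2 * ψ * η) + -((2 * τ / d ^ 2) * (ε * G)) + χ * (2 * f * p * η + ε * (g * p))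
        - 2 * ψ * (χ * e) := by ring
  have key2 : χ ^ 2 * (f ^ 2 * η / ε + f * g + ε * g ^ 2 / (4 * η)) =
    χ ^ 2 * (f ^ 2 * η / ε) + χ ^ 2 * (f * g) + χ ^ 2 * (ε * g ^ 2 / (4 * η)) := by ring
  rw [key2] at sq
  rw [key]
  linarith only [sq, t_g2, t_fg, t_w, t_1, t_2, t_3, t_4, t_A, hAx, s1, s2, s3, eN]

end P3

end

section

/-! ### Part 4: calibration near the interface -/

/-- energy density with Lagrange multiplier -/
noncomputable def FF (W η v : ℝ → ℝ) (ε μ b t : ℝ) : ℝ :=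
  (W (v t) / ε + ε * (deriv v t) ^ 2) * η t + μ * (v t - b) * η t

section P4
variable {W : ℝ → ℝ} {a b c : ℝ}

set_option maxHeartbeats 1000000 in
lemma WF.calib (h : WF W a b c) {α M m1 : ℝ} (h1 : a < α) (h2 : α < c) (hM : 0 < M) (hm1 : 0 < m1) :
    ∃ C > 0, ∃ ε0 > 0, ∀ ε d x μ ω : ℝ, ∀ η v : ℝ → ℝ, 0 < ε → ε < ε0 → 0 < d → d ≤ 1 → ε ≤ d ^ 2 → |μ| ≤ M →
      (∀ t ∈ Icc x (x + d), DifferentiableAt ℝ η t ∧ m1 ≤ η t ∧ η t ≤ M ∧ |deriv η t| ≤ M ∧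
        |deriv η t - deriv η x| ≤ ω) →
      (∀ t ∈ Icc x (x + d), DifferentiableAt ℝ v t ∧ α ≤ v t) →
      IntervalIntegrable (FF W η v ε μ b) volume x (x + d) →
      2 * psi W a b (v x) * η x - ε * (μ * η x * JJ W a b (fun s => b - s) ε (v x)
        - 2 * deriv η x * JJ W a b (psi W a b) ε (v x))
        - C * ε * d - C * (ω + ε / d ^ 2) * (∫ t in x..(x + d), ff W a b (v t) ^ 2)
        ≤ ∫ t in x..(x + d), FF W η v ε μ b t := by
  obtain ⟨K1, hK1, htail⟩ := h.tail h1 h2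
  obtain ⟨Λ, hΛ, -, hq⟩ := h.quad
  obtain ⟨ε1, hε1, hpt1⟩ := h.pt1 h1 hΛ hq M
  set F0 := Real.sqrt (W c) with hF0
  have hF0p : 0 < F0 := Real.sqrt_pos.mpr (h.pos c h.ac.ne' h.cb.ne)
  set K := K1 + M ^ 2 * K1 ^ 2 + 2 * M * (K1 ^ 2 * F0) with hK
  have hKp : 0 < K := by positivity
  have hK1K : K1 ≤ K := by
    have : 0 ≤ M ^ 2 * K1 ^ 2 + 2 * M * (K1 ^ 2 * F0) := by positivity
    linarith
  obtain ⟨C, hC, hcal⟩ := calib_pt hKp hF0p hM hm1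
  refine ⟨C + M ^ 3 / (4 * Λ), by positivity, ε1, hε1, ?_⟩
  intro ε d x μ ω η v hε hεε1 hd hd1 hεd hμ hη hv hIntg
  set J1 := JJ W a b (fun s => b - s) ε with hJ1
  set J2 := JJ W a b (psi W a b) ε with hJ2
  have hω : 0 ≤ ω := by
    have := (hη x ⟨le_rfl, by linarith⟩).2.2.2.2
    simpa using this
  have xmem : x ∈ Icc x (x + d) := ⟨le_rfl, by linarith⟩
  set ηx := η x with hηx
  set ex := deriv η x with hex
  set G : ℝ → ℝ := fun s => μ * ηx * J1 s - 2 * ex * J2 s with hG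
  set S : ℝ → ℝ := fun t => (1 - (t - x) ^ 2 / d ^ 2) * (-2 * psi W a b (v t) * η t + ε * G (v t)) with hS
  set S' : ℝ → ℝ := fun t => (-(2 * (t - x) / d ^ 2)) * (-2 * psi W a b (v t) * η t + ε * G (v t)) +
    (1 - (t - x) ^ 2 / d ^ 2) * (2 * ff W a b (v t) * deriv v t * η t - 2 * psi W a b (v t) * deriv η t +
        ε * ((- μ * (b - v t) * ηx + 2 * psi W a b (v t) * ex) *
          (ff W a b (v t) / (ff W a b (v t) ^ 2 + ε ^ 2)) * deriv v t)) with hS'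
  have hdS : ∀ t ∈ Icc x (x + d), HasDerivAt S (S' t) t := by
    intro t ht
    have d1 := (hv t ht).1.hasDerivAt
    have d2 := (hη t ht).1.hasDerivAt
    have d3 := (h.psi_deriv (v t)).comp t d1
    have d4 := (h.JJ_deriv (h := fun s => b - s) (by fun_prop) hε (v t)).comp t d1
    have d5 := (h.JJ_deriv h.psi_cont hε (v t)).comp t d1
    have d6 : HasDerivAt (fun t => 1 - (t - x) ^ 2 / d ^ 2) (-(2 * (t - x) / d ^ 2)) t := by
      have := ((((hasDerivAt_id t).sub_const x).pow 2).div_const (d ^ 2)).const_sub 1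
      refine this.congr_deriv ?_
      simp
    have d7 := ((d3.const_mul (-2)).mul d2).add (((d4.const_mul (μ * ηx)).sub (d5.const_mul (2 * ex))).const_mul ε)
    have d8 := d6.mul d7
    refine d8.congr_deriv ?_
    simp only [hS', Function.comp, hG, hJ1, hJ2, Pi.add_apply, Pi.sub_apply, Pi.mul_apply]
    ring
  have hvc : ContinuousOn v (Icc x (x + d)) := fun t ht => (hv t ht).1.continuousAt.continuousWithinAt
  have hfc : ContinuousOn (fun t => ff W a b (v t) ^ 2) (Icc x (x + d)) :=
    (h.ff_cont.comp_continuousOn hvc).pow 2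
  have hxd : x ≤ x + d := by linarith
  have hfint : IntervalIntegrable (fun t => ff W a b (v t) ^ 2) volume x (x + d) := by
    apply ContinuousOn.intervalIntegrable; rwa [uIcc_of_le hxd]
  set C' := C + M ^ 3 / (4 * Λ) with hC'
  have hC'C : C ≤ C' := by
    have : 0 ≤ M ^ 3 / (4 * Λ) := by positivity
    linarith
  have hi2 : IntervalIntegrable (fun t => FF W η v ε μ b t + C' * ε + C' * (ω + ε / d ^ 2) * ff W a b (v t) ^ 2)
      volume x (x + d) := (hIntg.add intervalIntegrable_const).add (hfint.const_mul _)
  have hbound : ∀ t ∈ Ioo x (x + d), S' t ≤ FF W η v ε μ b t + C' * ε + C' * (ω + ε / d ^ 2) * ff W a b (v t) ^ 2 := by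
    intro t ht
    have ht' : t ∈ Icc x (x + d) := ⟨ht.1.le, ht.2.le⟩
    obtain ⟨-, e1, e2, e3, e4⟩ := hη t ht'
    obtain ⟨-, y1, y2, y3, -⟩ := hη x xmem
    have hα := (hv t ht').2
    have hηt : 0 < η t := hm1.trans_le e1
    have f0 := ff_nonneg W a b (v t)
    rcases le_total b (v t) with hb | hb
    · have q1 := hpt1 ε hε hεε1 μ hμ (v t) hα
      have q2 : S' t = 0 := by
        simp only [hS', hG, hJ1, hJ2, h.psi_ge hb, h.ff_ge hb, h.JJ_ge _ ε hb]; ring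
      rw [q2, h.ff_ge hb]
      have q3 : 0 ≤ ε * (deriv v t) ^ 2 * η t := by positivity
      have q4 : -(ε * (μ ^ 2 / (4 * Λ))) * η t ≤ (W (v t) / ε + μ * (v t - b)) * η t :=
        mul_le_mul_of_nonneg_right q1 hηt.le
      have q5 : ε * (μ ^ 2 / (4 * Λ)) * η t ≤ ε * (M ^ 2 / (4 * Λ)) * M := by
        have : μ ^ 2 ≤ M ^ 2 := by rw [← sq_abs]; gcongr
        gcongr
      have q6 : ε * (M ^ 2 / (4 * Λ)) * M = M ^ 3 / (4 * Λ) * ε := by ring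
      have q7 : M ^ 3 / (4 * Λ) * ε ≤ C' * ε := by gcongr; linarith
      unfold FF
      linarith
    · obtain ⟨k1, k2⟩ := htail (v t) hα hb
      have ψ0 := h.psi_nonneg (v t)
      have hψ3 : ∀ s, α ≤ s → s ≤ b → |psi W a b s| ≤ K1 * F0 * ff W a b s := by
        intro s hs1 hs2
        rw [abs_of_nonneg (h.psi_nonneg s)]
        have := ff_nonneg W a b s
        have g3 := h.ff_bdd s
        calc psi W a b s ≤ K1 * ff W a b s ^ 2 := (htail s hs1 hs2).2
          _ = K1 * ff W a b s * ff W a b s := by ring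
          _ ≤ K1 * F0 * ff W a b s := by gcongr
      have g1 : |J1 (v t)| ≤ K1 ^ 2 * ff W a b (v t) := by
        have := h.JJ_bound (h := fun s => b - s) (by fun_prop) hε (α := α) (K := K1)
          (fun s hs1 hs2 => by rw [abs_of_nonneg (by linarith)]; exact (htail s hs1 hs2).1) hK1.le hα hb
        calc |J1 (v t)| ≤ K1 * (b - v t) := this
          _ ≤ K1 * (K1 * ff W a b (v t)) := by gcongr
          _ = _ := by ring
      have g2 : |J2 (v t)| ≤ K1 ^ 2 * F0 * ff W a b (v t) := by
        have := h.JJ_bound h.psi_cont hε (α := α) (K := K1 * F0) hψ3 (by positivity) hα hb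
        calc |J2 (v t)| ≤ K1 * F0 * (b - v t) := this
          _ ≤ K1 * F0 * (K1 * ff W a b (v t)) := by gcongr
          _ = _ := by ring
      have hGb : |G (v t)| ≤ K * ff W a b (v t) := by
        have w1 : |μ * ηx * J1 (v t)| ≤ M * M * (K1 ^ 2 * ff W a b (v t)) := by
          rw [abs_mul, abs_mul]; gcongr; rw [abs_of_pos (hm1.trans_le y1)]; exact y2
        have w2 : |2 * ex * J2 (v t)| ≤ 2 * M * (K1 ^ 2 * F0 * ff W a b (v t)) := by
          rw [abs_mul, abs_mul, abs_two]; gcongr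
        have w3 := abs_sub (μ * ηx * J1 (v t)) (2 * ex * J2 (v t))
        have w4 : K * ff W a b (v t) = K1 * ff W a b (v t) + M * M * (K1 ^ 2 * ff W a b (v t)) +
          2 * M * (K1 ^ 2 * F0 * ff W a b (v t)) := by rw [hK]; ring
        have w5 : 0 ≤ K1 * ff W a b (v t) := by positivity
        simp only [hG]
        linarith
      have hηη : |η t - ηx| ≤ M * (t - x) := by
        have := Convex.norm_image_sub_le_of_norm_hasDerivWithin_le (f := η) (f' := deriv η) (s := Icc x (x + d))
          (C := M) (fun y hy => (hη y hy).1.hasDerivAt.hasDerivWithinAt) (fun y hy => (hη y hy).2.2.2.1)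
          (convex_Icc _ _) xmem ht'
        rw [Real.norm_eq_abs, Real.norm_eq_abs, abs_of_pos (by linarith [ht.1] : 0 < t - x)] at this
        exact this
      have := hcal ε d (t - x) (1 - (t - x) ^ 2 / d ^ 2) (ff W a b (v t)) (b - v t) (psi W a b (v t)) (G (v t))
        (η t) ηx (deriv η t) ex μ ω (W (v t)) (deriv v t) hε hd hd1 hεd (by linarith [ht.1]) (by linarith [ht.2])
        rfl f0 (h.ff_bdd _) (by linarith) (k1.trans (by gcongr)) ψ0 (k2.trans (by gcongr)) hGb e1 e2
        (by rw [abs_of_pos (hm1.trans_le y1)]; exact y2) e3 y3 hηη e4 hμ (h.ff_sq_le _)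
      have q7 : C * ε ≤ C' * ε := by gcongr
      have q8 : C * (ω + ε / d ^ 2) * ff W a b (v t) ^ 2 ≤ C' * (ω + ε / d ^ 2) * ff W a b (v t) ^ 2 := by gcongr
      simp only [FF, hS']
      have q9 : μ * (v t - b) * η t = - (μ * (b - v t) * η t) := by ring
      rw [q9]
      linarith
  have main := intervalIntegral.sub_le_integral_of_hasDeriv_right_of_le hxd
    (fun t ht => (hdS t ht).continuousAt.continuousWithinAt)
    (fun t ht => (hdS t ⟨ht.1.le, ht.2.le⟩).hasDerivWithinAt)
    ((intervalIntegrable_iff_integrableOn_Icc_of_le hxd).mp hi2) hbound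
  rw [intervalIntegral.integral_add (hIntg.add intervalIntegrable_const) (hfint.const_mul _),
    intervalIntegral.integral_add hIntg intervalIntegrable_const, intervalIntegral.integral_const,
    intervalIntegral.integral_const_mul (C' * (ω + ε / d ^ 2))] at main
  have s1 : S (x + d) = 0 := by
    simp only [hS]
    have : 1 - (x + d - x) ^ 2 / d ^ 2 = 0 := by
      rw [add_sub_cancel_left, div_self (by positivity)]; ring
    rw [this]; ring
  have s2 : S x = -2 * psi W a b (v x) * ηx + ε * G (v x) := by
    simp only [hS]; rw [sub_self]; simp [hηx]
  rw [s1, s2] at main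
  simp only [smul_eq_mul, add_sub_cancel_left] at main
  have e1 : ε * G (v x) = ε * (μ * ηx * J1 (v x) - 2 * ex * J2 (v x)) := rfl
  rw [e1] at main
  linarith

end P4

end

section

/-! ### Part 5: outer region -/

section P5
variable {W : ℝ → ℝ} {a b c : ℝ}

set_option maxHeartbeats 1000000 in
lemma WF.outer (h : WF W a b c) {α γ : ℝ} (h1 : a < α) (hαγ : α < γ) (h2 : γ < b) (M : ℝ) :
    ∃ k0 > 0, ∀ Λ > 0, QL W b Λ → ∃ ε0 > 0, ∀ ε μ T1 p T : ℝ, ∀ η v : ℝ → ℝ, 0 < ε → ε < ε0 → |μ| ≤ M →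
      T1 < p → p < T → (∀ t ∈ Ioo T1 T, 0 < η t) → ContinuousOn η (Ioo T1 T) →
      IntervalIntegrable η volume p T → (∀ t ∈ Ico p T, (∫ r in t..T, η r) ≤ k0 * η t) →
      (∀ t ∈ Ico p T, DifferentiableAt ℝ v t) → γ ≤ v p →
      IntervalIntegrable (FF W η v ε μ b) volume p T →
      -(ε * (μ ^ 2 / (4 * Λ))) * (∫ t in p..T, η t) ≤ ∫ t in p..T, FF W η v ε μ b t := by
  obtain ⟨Θ, Θ', B, hB, hΘd, hΘB, hΘ0, -, hΘα, hΘγ, hΘ'0⟩ := exists_theta hαγ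
  obtain ⟨C, hC, k, hk, H⟩ := h.pt2 h1 h2 hB M
  refine ⟨k / C, by positivity, fun Λ hΛ hq => ?_⟩
  obtain ⟨ε0, hε0, H⟩ := H Λ hΛ hq
  refine ⟨ε0, hε0, ?_⟩
  intro ε μ T1 p T η v hε hεε0 hμ hT1p hpT hηpos hηc hηi hratio hv hvp hF
  set Q : ℝ → ℝ := fun t => ∫ r in t..T, η r with hQ
  set S : ℝ → ℝ := fun t => Θ (v t) * (C * Q t) with hS
  have hηi' : ∀ t ∈ Ico p T, IntervalIntegrable η volume t T := fun t ht =>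
    hηi.mono_set (by rw [uIcc_of_le ht.2.le, uIcc_of_le hpT.le]; exact Icc_subset_Icc ht.1 le_rfl)
  have hsub : ∀ t ∈ Ico p T, t ∈ Ioo T1 T := fun t ht => ⟨hT1p.trans_le ht.1, ht.2⟩
  have hdQ : ∀ t ∈ Ico p T, HasDerivAt Q (- η t) t := fun t ht =>
    intervalIntegral.integral_hasDerivAt_left (hηi' t ht)
      (hηc.stronglyMeasurableAtFilter isOpen_Ioo t (hsub t ht))
      (hηc.continuousAt (isOpen_Ioo.mem_nhds (hsub t ht)))
  have hQ0 : ∀ t ∈ Ico p T, 0 ≤ Q t := fun t ht =>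
    intervalIntegral.integral_nonneg_of_ae_restrict ht.2.le (by
      have : ∀ᵐ r ∂(volume.restrict (Icc t T)), r ≠ T :=
        ae_restrict_of_ae (by simp [ae_iff])
      filter_upwards [this, ae_restrict_mem measurableSet_Icc] with r hr hr2
      exact (hηpos r ⟨hT1p.trans_le (ht.1.trans hr2.1), lt_of_le_of_ne hr2.2 hr⟩).le)
  have hdS : ∀ t ∈ Ico p T, HasDerivAt S (Θ' (v t) * deriv v t * (C * Q t) + Θ (v t) * (C * (- η t))) t := by
    intro t ht
    exact ((hΘd (v t)).comp t (hv t ht).hasDerivAt).mul ((hdQ t ht).const_mul C)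
  set κ := ε * (μ ^ 2 / (4 * Λ)) with hκ
  have hb : ∀ t ∈ Ico p T, Θ' (v t) * deriv v t * (C * Q t) + Θ (v t) * (C * (- η t)) ≤
      FF W η v ε μ b t + κ * η t := by
    intro t ht
    have e1 := H ε hε hεε0 μ hμ (v t) (deriv v t) (Θ (v t)) (Θ' (v t)) (hΘ0 _) (hΘB _) (hΘα _) (hΘ'0 _)
    have ηp := hηpos t (hsub t ht)
    have e2 := mul_le_mul_of_nonneg_right e1 ηp.le
    have e3 := hratio t ht
    have e4 : C * Q t ≤ k * η t := by
      calc C * Q t ≤ C * (k / C * η t) := by gcongr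
        _ = k * η t := by field_simp
    have e5 : Θ' (v t) * deriv v t * (C * Q t) ≤ |Θ' (v t)| * |deriv v t| * (k * η t) := by
      calc Θ' (v t) * deriv v t * (C * Q t) ≤ |Θ' (v t) * deriv v t| * (C * Q t) := by
            have : 0 ≤ C * Q t := mul_nonneg hC.le (hQ0 t ht)
            gcongr; exact le_abs_self _
        _ ≤ |Θ' (v t)| * |deriv v t| * (k * η t) := by rw [abs_mul]; gcongr
    unfold FF
    rw [hκ]
    linarith
  have hsum : IntervalIntegrable (fun t => FF W η v ε μ b t + κ * η t) volume p T := hF.add (hηi.const_mul κ)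
  have hsumI : IntegrableOn (fun t => FF W η v ε μ b t + κ * η t) (Icc p T) :=
    (intervalIntegrable_iff_integrableOn_Icc_of_le hpT.le).mp hsum
  have hpart : ∀ u ∈ Ico p T, 0 ≤ ∫ t in p..u, (FF W η v ε μ b t + κ * η t) := by
    intro u hu
    have := intervalIntegral.sub_le_integral_of_hasDeriv_right_of_le hu.1 (g := S)
      (fun t ht => (hdS t ⟨ht.1, ht.2.trans_lt hu.2⟩).continuousAt.continuousWithinAt)
      (fun t ht => (hdS t ⟨ht.1.le, ht.2.trans hu.2⟩).hasDerivWithinAt)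
      (hsumI.mono_set (Icc_subset_Icc le_rfl hu.2.le)) (fun t ht => hb t ⟨ht.1.le, ht.2.trans hu.2⟩)
    have s0 : S p = 0 := by simp only [hS]; rw [hΘγ _ hvp]; ring
    have s1 : 0 ≤ S u := mul_nonneg (hΘ0 _) (mul_nonneg hC.le (hQ0 u hu))
    linarith
  have hlim : 0 ≤ ∫ t in p..T, (FF W η v ε μ b t + κ * η t) := by
    have cont := intervalIntegral.continuousOn_primitive_interval (a := p) (b := T) (μ := volume)
      (f := fun t => FF W η v ε μ b t + κ * η t) (by rw [uIcc_of_le hpT.le]; exact hsumI)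
    rw [uIcc_of_le hpT.le] at cont
    have ct := (cont T ⟨hpT.le, le_rfl⟩).mono (Ico_subset_Icc_self)
    have nb : (𝓝[Ico p T] T).NeBot := by
      rw [← mem_closure_iff_nhdsWithin_neBot, closure_Ico hpT.ne]; exact ⟨hpT.le, le_rfl⟩
    exact ge_of_tendsto ct (by filter_upwards [self_mem_nhdsWithin] with u hu using hpart u hu)
  rw [intervalIntegral.integral_add hF (hηi.const_mul κ), intervalIntegral.integral_const_mul] at hlim
  linarith

end P5

end

section

/-! ### Part 6: one-sided lower bound -/

section P6
variable {W : ℝ → ℝ} {a b c : ℝ}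

set_option maxHeartbeats 1000000 in
lemma WF.right (h : WF W a b c) {α γ M : ℝ} (h1 : a < α) (hαc : α < c) (hαγ : α < γ) (h2 : γ < b) (hM : 0 < M) :
    ∃ k0 > 0, ∀ m1 > 0, ∃ C > 0, ∀ Λ > 0, QL W b Λ → ∃ ε0 > 0, ∀ ε d x μ ω T1 p T : ℝ, ∀ η v : ℝ → ℝ,
      0 < ε → ε < ε0 → 0 < d → d ≤ 1 → ε ≤ d ^ 2 → |μ| ≤ M →
      T1 < x → x + d ≤ p → p < T → (∀ t ∈ Ioo T1 T, 0 < η t) → (∀ t ∈ Ioo T1 T, DifferentiableAt ℝ η t) →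
      IntervalIntegrable η volume x T →
      (∀ t ∈ Icc x (x + d), m1 ≤ η t ∧ η t ≤ M ∧ |deriv η t| ≤ M ∧ |deriv η t - deriv η x| ≤ ω) →
      (∀ t ∈ Ico p T, (∫ r in t..T, η r) ≤ k0 * η t) →
      (∀ t ∈ Ioo T1 T, DifferentiableAt ℝ v t) → (∀ t ∈ Icc x p, α ≤ v t) → γ ≤ v p →
      IntervalIntegrable (FF W η v ε μ b) volume x T →
      2 * psi W a b (v x) * η x - ε * (μ * η x * JJ W a b (fun s => b - s) ε (v x)
        - 2 * deriv η x * JJ W a b (psi W a b) ε (v x)) - ε * (μ ^ 2 / (4 * Λ)) * (∫ t in x..T, η t)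
        - C * ε * d - C * (ω + ε / d ^ 2) * (∫ t in x..(x + d), ff W a b (v t) ^ 2)
        ≤ ∫ t in x..T, FF W η v ε μ b t := by
  obtain ⟨k0, hk0, Hout⟩ := h.outer h1 hαγ h2 M
  refine ⟨k0, hk0, fun m1 hm1 => ?_⟩
  obtain ⟨C, hC, ε1, hε1, Hcal⟩ := h.calib h1 hαc hM hm1
  refine ⟨C, hC, fun Λ hΛ hq => ?_⟩
  obtain ⟨ε2, hε2, Hout⟩ := Hout Λ hΛ hq
  obtain ⟨ε3, hε3, Hpt⟩ := h.pt1 h1 hΛ hq M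
  refine ⟨min ε1 (min ε2 ε3), lt_min hε1 (lt_min hε2 hε3), ?_⟩
  intro ε d x μ ω T1 p T η v hε hεε hd hd1 hεd hμ hT1x hxp hpT hηp hηd hηi hη hratio hv hα hγ hF
  have e1 : ε < ε1 := hεε.trans_le (min_le_left _ _)
  have e2 : ε < ε2 := hεε.trans_le ((min_le_right _ _).trans (min_le_left _ _))
  have e3 : ε < ε3 := hεε.trans_le ((min_le_right _ _).trans (min_le_right _ _))
  have sub : ∀ {g : ℝ → ℝ}, IntervalIntegrable g volume x T → ∀ u w, x ≤ u → u ≤ w → w ≤ T →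
      IntervalIntegrable g volume u w := by
    intro g hg u w h1 h2 h3
    refine hg.mono_set ?_
    rw [uIcc_of_le h2, uIcc_of_le (by linarith)]
    exact Icc_subset_Icc h1 h3
  have c1 := Hcal ε d x μ ω η v hε e1 hd hd1 hεd hμ
    (fun t ht => ⟨hηd t ⟨by linarith [ht.1], by linarith [ht.2]⟩, hη t ht⟩)
    (fun t ht => ⟨hv t ⟨by linarith [ht.1], by linarith [ht.2]⟩, hα t ⟨ht.1, by linarith [ht.2]⟩⟩)
    (sub hF _ _ le_rfl (by linarith) (by linarith))
  have c3 := Hout ε μ T1 p T η v hε e2 hμ (by linarith) hpT hηp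
    (fun t ht => (hηd t ht).continuousAt.continuousWithinAt)
    (sub hηi _ _ (by linarith) hpT.le le_rfl) hratio
    (fun t ht => hv t ⟨by linarith [ht.1], ht.2⟩) hγ (sub hF _ _ (by linarith) hpT.le le_rfl)
  set κ := ε * (μ ^ 2 / (4 * Λ)) with hκ
  have hκ0 : 0 ≤ κ := by positivity
  have c2 : -κ * (∫ t in (x + d)..p, η t) ≤ ∫ t in (x + d)..p, FF W η v ε μ b t := by
    rw [← intervalIntegral.integral_const_mul]
    apply intervalIntegral.integral_mono_on hxp ((sub hηi _ _ (by linarith) hxp hpT.le).const_mul _)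
      (sub hF _ _ (by linarith) hxp hpT.le)
    intro t ht
    have ηp := hηp t ⟨by linarith [ht.1], by linarith [ht.2]⟩
    have q := mul_le_mul_of_nonneg_right (Hpt ε hε e3 μ hμ (v t) (hα t ⟨by linarith [ht.1], ht.2⟩)) ηp.le
    have q3 : 0 ≤ ε * (deriv v t) ^ 2 * η t := by positivity
    unfold FF
    linarith
  have η0 : 0 ≤ ∫ t in x..(x + d), η t := by
    apply intervalIntegral.integral_nonneg (by linarith)
    intro t ht
    exact (hηp t ⟨by linarith [ht.1], by linarith [ht.2]⟩).le
  have a1 := intervalIntegral.integral_add_adjacent_intervals (sub hF x (x + d) le_rfl (by linarith) (by linarith))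
    (sub hF (x + d) p (by linarith) hxp hpT.le)
  have a2 := intervalIntegral.integral_add_adjacent_intervals (sub hF x p le_rfl (by linarith) (by linarith))
    (sub hF p T (by linarith) hpT.le le_rfl)
  have a3 := intervalIntegral.integral_add_adjacent_intervals (sub hηi x (x + d) le_rfl (by linarith) (by linarith))
    (sub hηi (x + d) p (by linarith) hxp hpT.le)
  have a4 := intervalIntegral.integral_add_adjacent_intervals (sub hηi x p le_rfl (by linarith) (by linarith))
    (sub hηi p T (by linarith) hpT.le le_rfl)
  rw [← a2, ← a1, ← a4, ← a3]
  have := mul_nonneg hκ0 η0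
  linarith

end P6

end

section

lemma ff_refl (W : ℝ → ℝ) (a b s : ℝ) (hab : a < b) : ff (fun s => W (a + b - s)) a b (a + b - s) = ff W a b s := by
  unfold ff
  congr 2
  rcases le_total s a with h1 | h1
  · rw [min_eq_left (by linarith), max_eq_right hab.le, min_eq_right (by linarith), max_eq_left h1]; ring_nf
  rcases le_total s b with h2 | h2
  · rw [min_eq_right (by linarith), max_eq_right (by linarith), min_eq_right h2, max_eq_right h1]; ring_nf
  · rw [min_eq_right (by linarith), max_eq_left (by linarith), min_eq_left h2, max_eq_right hab.le]; ring_nf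

lemma psi_refl {W : ℝ → ℝ} {a b c : ℝ} (h : WF W a b c) (s : ℝ) :
    psi (fun s => W (a + b - s)) a b (a + b - s) = psi W a b a - psi W a b s := by
  have hi : ∀ x y, IntervalIntegrable (ff W a b) volume x y := fun x y => h.ff_cont.intervalIntegrable _ _
  have : psi (fun s => W (a + b - s)) a b (a + b - s) = ∫ r in a..s, ff W a b r := by
    unfold psi
    have e : (∫ r in (a + b - s)..b, ff (fun s => W (a + b - s)) a b r)
        = ∫ r in (a + b - s)..b, ff W a b (a + b - r) := by
      apply intervalIntegral.integral_congr
      intro r _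
      have := ff_refl W a b (a + b - r) h.ab
      show _ = ff W a b (a + b - r)
      rw [← this]; congr 1; ring
    rw [e, intervalIntegral.integral_comp_sub_left (fun r => ff W a b r) (a + b)]
    congr 1 <;> ring
  rw [this]
  unfold psi
  rw [← intervalIntegral.integral_add_adjacent_intervals (hi a s) (hi s b)]
  ring

lemma FF_refl (W η v : ℝ → ℝ) (ε μ a b t : ℝ) :
    FF (fun s => W (a + b - s)) (fun t => η (-t)) (fun t => a + b - v (-t)) ε (-μ) b t = FF W η v ε μ a (-t) := by
  unfold FF
  have : deriv (fun t => a + b - v (-t)) t = deriv v (-t) := by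
    rw [deriv_const_sub, deriv_comp_neg, neg_neg]
  simp only [this]
  rw [show a + b - (a + b - v (-t)) = v (-t) by ring]
  ring

lemma WF.left {W : ℝ → ℝ} {a b c α γ M : ℝ} (h : WF W a b c) (h1 : a < α) (hcγ : c < γ) (hαγ : α < γ) (h2 : γ < b) (hM : 0 < M) :
    ∃ k0 > 0, ∀ m1 > 0, ∃ C > 0, ∀ Λ > 0, QL W a Λ → ∃ ε0 > 0, ∀ ε d x μ ω T1 p T : ℝ, ∀ η v : ℝ → ℝ,
      0 < ε → ε < ε0 → 0 < d → d ≤ 1 → ε ≤ d ^ 2 → |μ| ≤ M → x < T1 → p ≤ x - d → T < p →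
      (∀ t ∈ Ioo T T1, 0 < η t) → (∀ t ∈ Ioo T T1, DifferentiableAt ℝ η t) →
      IntervalIntegrable η volume T x →
      (∀ t ∈ Icc (x - d) x, m1 ≤ η t ∧ η t ≤ M ∧ |deriv η t| ≤ M ∧ |deriv η t - deriv η x| ≤ ω) →
      (∀ t ∈ Ioc T p, (∫ r in T..t, η r) ≤ k0 * η t) →
      (∀ t ∈ Ioo T T1, DifferentiableAt ℝ v t) → (∀ t ∈ Icc p x, v t ≤ γ) → v p ≤ α →
      IntervalIntegrable (FF W η v ε μ a) volume T x →
      2 * (psi W a b a - psi W a b (v x)) * η x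
        - ε * (-(μ * η x * JJ (fun s => W (a + b - s)) a b (fun s => b - s) ε (a + b - v x))
          + 2 * deriv η x * JJ (fun s => W (a + b - s)) a b (psi (fun s => W (a + b - s)) a b) ε (a + b - v x))
        - ε * (μ ^ 2 / (4 * Λ)) * (∫ t in T..x, η t) - C * ε * d
        - C * (ω + ε / d ^ 2) * (∫ t in (x - d)..x, ff W a b (v t) ^ 2) ≤ ∫ t in T..x, FF W η v ε μ a t := by
  obtain ⟨k0, hk0, H⟩ := h.reflect.right (α := a + b - γ) (γ := a + b - α) (M := M) (by linarith) (by linarith)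
    (by linarith) (by linarith) hM
  refine ⟨k0, hk0, fun m1 hm1 => ?_⟩
  obtain ⟨C, hC, H⟩ := H m1 hm1
  refine ⟨C, hC, fun Λ hΛ hQ => ?_⟩
  obtain ⟨ε0, hε0, H⟩ := H Λ hΛ hQ.reflect
  refine ⟨ε0, hε0, ?_⟩
  intro ε d x μ ω T1 p T η v e1 e2 e3 e4 e5 e6 e7 e8 e9 e10 e11 e12 e13 e14 e15 e16 e17 e18
  have K := H ε d (-x) (-μ) ω (-T1) (-p) (-T) (fun t => η (-t)) (fun t => a + b - v (-t)) e1 e2 e3 e4 e5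
    (by rwa [abs_neg]) (by linarith) (by linarith) (by linarith)
    (fun t ht => e10 (-t) ⟨by linarith [ht.2], by linarith [ht.1]⟩)
    (fun t ht => by
      have := e11 (-t) ⟨by linarith [ht.2], by linarith [ht.1]⟩
      exact this.comp t (differentiable_neg t))
    (by simpa using (e12.comp_sub_left 0).symm)
    (fun t ht => by
      have := e13 (-t) ⟨by linarith [ht.2], by linarith [ht.1]⟩
      simp only [deriv_comp_neg, abs_neg, neg_neg]
      refine ⟨this.1, this.2.1, this.2.2.1, ?_⟩
      rw [show -deriv η (-t) - -deriv η x = -(deriv η (-t) - deriv η x) by ring, abs_neg]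
      exact this.2.2.2)
    (fun t ht => by
      have := e14 (-t) ⟨by linarith [ht.2], by linarith [ht.1]⟩
      rw [intervalIntegral.integral_comp_neg (fun r => η r)]
      simpa using this)
    (fun t ht => by
      have := e15 (-t) ⟨by linarith [ht.2], by linarith [ht.1]⟩
      exact (this.comp t (differentiable_neg t)).const_sub _)
    (fun t ht => by
      have := e16 (-t) ⟨by linarith [ht.2], by linarith [ht.1]⟩
      linarith)
    (by simp only [neg_neg]; linarith)
    (by
      have : FF (fun s => W (a + b - s)) (fun t => η (-t)) (fun t => a + b - v (-t)) ε (-μ) b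
         = fun t => FF W η v ε μ a (-t) := by funext t; exact FF_refl W η v ε μ a b t
      rw [this]
      simpa using (e18.comp_sub_left 0).symm)
  simp only [FF_refl, neg_neg, deriv_comp_neg] at K
  rw [intervalIntegral.integral_comp_neg (fun r => η r),
    intervalIntegral.integral_comp_neg (fun r => FF W η v ε μ a r), psi_refl h] at K
  simp only [ff_refl W a b _ h.ab] at K
  rw [intervalIntegral.integral_comp_neg (fun r => ff W a b (v r) ^ 2)] at K
  simp only [neg_neg, neg_add, neg_sq] at K
  rw [← sub_eq_add_neg] at K
  linarith

end

section

/-! ### Part 8: two-sided lower bound -/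

/-- energy density -/
noncomputable def EN (W η v : ℝ → ℝ) (ε t : ℝ) : ℝ := (W (v t) / ε + ε * (deriv v t) ^ 2) * η t

set_option maxHeartbeats 1000000 in
lemma WF.two {W : ℝ → ℝ} {a b c α γ M : ℝ} (h : WF W a b c) (h1 : a < α) (hαc : α < c) (hcγ : c < γ)
    (h2 : γ < b) (hM : 0 < M) :
    ∃ k0 > 0, ∀ m1 > 0, ∃ C > 0, ∀ Λ > 0, QL W a Λ → QL W b Λ → ∃ ε0 > 0,
      ∀ ε d x μ ω pL pR T t0 : ℝ, ∀ η v : ℝ → ℝ,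
      0 < ε → ε < ε0 → 0 < d → d ≤ 1 → ε ≤ d ^ 2 → |μ| ≤ M → pL ≤ x - d → x + d ≤ pR → -T < pL → pR < T →
      t0 ∈ Ioo (-T) T →
      (∀ t ∈ Ioo (-T) T, 0 < η t) → (∀ t ∈ Ioo (-T) T, DifferentiableAt ℝ η t) →
      IntervalIntegrable η volume (-T) T →
      (∀ t ∈ Icc (x - d) (x + d), m1 ≤ η t ∧ η t ≤ M ∧ |deriv η t| ≤ M ∧ |deriv η t - deriv η x| ≤ ω) →
      (∀ t ∈ Ico pR T, (∫ r in t..T, η r) ≤ k0 * η t) →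
      (∀ t ∈ Ioc (-T) pL, (∫ r in (-T)..t, η r) ≤ k0 * η t) →
      (∀ t ∈ Ioo (-T) T, DifferentiableAt ℝ v t) → (∀ t ∈ Icc x pR, α ≤ v t) → (∀ t ∈ Icc pL x, v t ≤ γ) →
      γ ≤ v pR → v pL ≤ α → v x = c →
      IntervalIntegrable (EN W η v ε) volume (-T) T → IntervalIntegrable (fun t => v t * η t) volume (-T) T →
      (∫ t in (-T)..T, v t * η t) = a * (∫ t in (-T)..t0, η t) + b * (∫ t in t0..T, η t) →
      2 * psi W a b a * η x
        - ε * (μ * η x * (JJ W a b (fun s => b - s) ε c - JJ (fun s => W (a + b - s)) a b (fun s => b - s) ε (a + b - c))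
          - 2 * deriv η x * (JJ W a b (psi W a b) ε c
            - JJ (fun s => W (a + b - s)) a b (psi (fun s => W (a + b - s)) a b) ε (a + b - c)))
        - ε * (μ ^ 2 / (4 * Λ)) * (∫ t in (-T)..T, η t) - C * ε * d
        - C * (ω + ε / d ^ 2) * ε * (∫ t in (-T)..T, EN W η v ε t)
        ≤ (∫ t in (-T)..T, EN W η v ε t) + μ * (b - a) * ∫ t in t0..x, η t := by
  obtain ⟨kR, hkR, HR⟩ := h.right h1 hαc (hαc.trans hcγ) h2 hM
  obtain ⟨kL, hkL, HL⟩ := h.left h1 hcγ (hαc.trans hcγ) h2 hM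
  refine ⟨min kL kR, lt_min hkL hkR, fun m1 hm1 => ?_⟩
  obtain ⟨CR, hCR, HR⟩ := HR m1 hm1
  obtain ⟨CL, hCL, HL⟩ := HL m1 hm1
  refine ⟨CL + CR + (CL + CR) / m1, by positivity, fun Λ hΛ hqa hqb => ?_⟩
  obtain ⟨εR, hεR, HR⟩ := HR Λ hΛ hqb
  obtain ⟨εL, hεL, HL⟩ := HL Λ hΛ hqa
  refine ⟨min εL εR, lt_min hεL hεR, ?_⟩
  intro ε d x μ ω pL pR T t0 η v hε hεε hd hd1 hεd hμ hpL hpR hTL hTR ht0 hηp hηd hηi hη hrR hrL hv hα hγ hvR hvL hvx hE hvη hmass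
  have xT : x < T := by linarith
  have Tx : -T < x := by linarith
  have TT : -T < T := by linarith
  have sub : ∀ {g : ℝ → ℝ}, IntervalIntegrable g volume (-T) T → ∀ u w, u ∈ Icc (-T) T → w ∈ Icc (-T) T →
      IntervalIntegrable g volume u w := by
    intro g hg u w h1 h2
    refine hg.mono_set ?_
    rw [uIcc_of_le TT.le]
    exact uIcc_subset_Icc h1 h2
  have mT : T ∈ Icc (-T) T := ⟨TT.le, le_rfl⟩
  have mT' : -T ∈ Icc (-T) T := ⟨le_rfl, TT.le⟩
  have mx : x ∈ Icc (-T) T := ⟨Tx.le, xT.le⟩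
  have m0 : t0 ∈ Icc (-T) T := ⟨ht0.1.le, ht0.2.le⟩
  have FFe : ∀ e, FF W η v ε μ e = fun t => EN W η v ε t + (μ * (v t * η t) - μ * e * η t) := by
    intro e; funext t; unfold FF EN; ring
  have FFi : ∀ e u w, u ∈ Icc (-T) T → w ∈ Icc (-T) T → IntervalIntegrable (FF W η v ε μ e) volume u w := by
    intro e u w hu hw
    rw [FFe]
    exact (sub hE u w hu hw).add (((sub hvη u w hu hw).const_mul _).sub ((sub hηi u w hu hw).const_mul _))
  have FFint : ∀ e u w, u ∈ Icc (-T) T → w ∈ Icc (-T) T → (∫ t in u..w, FF W η v ε μ e t)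
      = (∫ t in u..w, EN W η v ε t) + (μ * (∫ t in u..w, v t * η t) - μ * e * (∫ t in u..w, η t)) := by
    intro e u w hu hw
    rw [FFe, intervalIntegral.integral_add (sub hE u w hu hw) (((sub hvη u w hu hw).const_mul _).sub ((sub hηi u w hu hw).const_mul _)),
      intervalIntegral.integral_sub ((sub hvη u w hu hw).const_mul _) ((sub hηi u w hu hw).const_mul _),
      intervalIntegral.integral_const_mul, intervalIntegral.integral_const_mul]
  have ω0 : 0 ≤ ω := by
    have := (hη x ⟨by linarith, by linarith⟩).2.2.2
    simpa using this
  have KR := HR ε d x μ ω (-T) pR T η v hε (hεε.trans_le (min_le_right _ _)) hd hd1 hεd hμ Tx hpR hTR hηp hηd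
    (sub hηi _ _ mx mT) (fun t ht => hη t ⟨by linarith [ht.1], ht.2⟩)
    (fun t ht => (hrR t ht).trans (mul_le_mul_of_nonneg_right (min_le_right _ _) (hηp t ⟨by linarith [ht.1], ht.2⟩).le))
    hv hα hvR (FFi _ _ _ mx mT)
  have KL := HL ε d x μ ω T pL (-T) η v hε (hεε.trans_le (min_le_left _ _)) hd hd1 hεd hμ xT hpL hTL hηp hηd
    (sub hηi _ _ mT' mx) (fun t ht => hη t ⟨ht.1, by linarith [ht.2]⟩)
    (fun t ht => (hrL t ht).trans (mul_le_mul_of_nonneg_right (min_le_left _ _) (hηp t ⟨ht.1, by linarith [ht.2]⟩).le))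
    hv hγ hvL (FFi _ _ _ mT' mx)
  rw [FFint _ _ _ mx mT, hvx] at KR
  rw [FFint _ _ _ mT' mx, hvx] at KL
  have a1 := intervalIntegral.integral_add_adjacent_intervals (sub hE _ _ mT' mx) (sub hE _ _ mx mT)
  have a2 := intervalIntegral.integral_add_adjacent_intervals (sub hvη _ _ mT' mx) (sub hvη _ _ mx mT)
  have a3 := intervalIntegral.integral_add_adjacent_intervals (sub hηi _ _ mT' mx) (sub hηi _ _ mx mT)
  have a4 := intervalIntegral.integral_add_adjacent_intervals (sub hηi _ _ mT' m0) (sub hηi _ _ m0 mx)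
  have a5 := intervalIntegral.integral_add_adjacent_intervals (sub hηi _ _ m0 mx) (sub hηi _ _ mx mT)
  have vc : ∀ u w, -T < u → w < T → u ≤ w → IntervalIntegrable (fun t => ff W a b (v t) ^ 2) volume u w := by
    intro u w hu hw huw
    apply ContinuousOn.intervalIntegrable
    rw [uIcc_of_le huw]
    intro t ht
    exact ((h.ff_cont.continuousAt.comp (hv t ⟨by linarith [ht.1], by linarith [ht.2]⟩).continuousAt).pow 2).continuousWithinAt
  have fb : ∀ u w, x - d ≤ u → w ≤ x + d → u ≤ w → (∫ t in u..w, ff W a b (v t) ^ 2) ≤ ε / m1 * ∫ t in (-T)..T, EN W η v ε t := by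
    intro u w hu hw huw
    have E0 : ∀ t ∈ Ioo (-T) T, 0 ≤ EN W η v ε t := by
      intro t ht; unfold EN
      have := hηp t ht
      have := h.nonneg (v t)
      positivity
    have s1 : (∫ t in u..w, ff W a b (v t) ^ 2) ≤ ∫ t in u..w, ε / m1 * EN W η v ε t := by
      apply intervalIntegral.integral_mono_on huw (vc u w (by linarith) (by linarith) huw)
        ((sub hE u w ⟨by linarith, by linarith⟩ ⟨by linarith, by linarith⟩).const_mul _)
      intro t ht
      have q1 := h.ff_sq_le (v t)
      have q2 := (hη t ⟨by linarith [ht.1], by linarith [ht.2]⟩).1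
      have q3 := h.nonneg (v t)
      unfold EN
      calc ff W a b (v t) ^ 2 ≤ W (v t) := q1
        _ = ε / m1 * ((W (v t) / ε) * m1) := by field_simp
        _ ≤ ε / m1 * ((W (v t) / ε + ε * (deriv v t) ^ 2) * η t) := by
            have : 0 ≤ ε * deriv v t ^ 2 := by positivity
            gcongr
            linarith
    refine s1.trans ?_
    rw [intervalIntegral.integral_const_mul]
    apply mul_le_mul_of_nonneg_left _ (by positivity)
    apply intervalIntegral.integral_mono_interval (by linarith) huw (by linarith) _ hE
    rw [← restrict_Ioo_eq_restrict_Ioc]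
    filter_upwards [ae_restrict_mem measurableSet_Ioo] with t ht using E0 t ht
  have f1 := fb (x - d) x le_rfl (by linarith) (by linarith)
  have f2 := fb x (x + d) (by linarith) le_rfl (by linarith)
  set E := ∫ t in (-T)..T, EN W η v ε t with hEdef
  have E0 : 0 ≤ E := by
    have := (intervalIntegral.integral_nonneg (μ := volume) (f := fun t => ff W a b (v t) ^ 2) (a := x) (b := x + d) (by linarith)
      (fun t _ => by positivity)).trans f2
    by_contra hc
    push Not at hc
    have : ε / m1 * E < 0 := mul_neg_of_pos_of_neg (by positivity) hc
    linarith
  have w0 : 0 ≤ ω + ε / d ^ 2 := by positivity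
  have g1 : CL * (ω + ε / d ^ 2) * (∫ t in (x - d)..x, ff W a b (v t) ^ 2) ≤ CL * (ω + ε / d ^ 2) * (ε / m1 * E) :=
    mul_le_mul_of_nonneg_left f1 (by positivity)
  have g2 : CR * (ω + ε / d ^ 2) * (∫ t in x..(x + d), ff W a b (v t) ^ 2) ≤ CR * (ω + ε / d ^ 2) * (ε / m1 * E) :=
    mul_le_mul_of_nonneg_left f2 (by positivity)
  have g3 : CL * (ω + ε / d ^ 2) * (ε / m1 * E) + CR * (ω + ε / d ^ 2) * (ε / m1 * E)
      ≤ (CL + CR + (CL + CR) / m1) * (ω + ε / d ^ 2) * ε * E := by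
    have : (CL + CR + (CL + CR) / m1) * (ω + ε / d ^ 2) * ε * E = (CL * (ω + ε / d ^ 2) * (ε / m1 * E) + CR * (ω + ε / d ^ 2) * (ε / m1 * E)) + (CL + CR) * (ω + ε / d ^ 2) * ε * E := by
      field_simp; ring
    rw [this]
    have : 0 ≤ (CL + CR) * (ω + ε / d ^ 2) * ε * E := by positivity
    linarith
  have g4 : CL * ε * d + CR * ε * d ≤ (CL + CR + (CL + CR) / m1) * ε * d := by
    have : 0 ≤ (CL + CR) / m1 * ε * d := by positivity
    have e : (CL + CR + (CL + CR) / m1) * ε * d = CL * ε * d + CR * ε * d + (CL + CR) / m1 * ε * d := by ring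
    rw [e]; exact le_add_of_nonneg_right this
  have mm : μ * (∫ t in (-T)..x, v t * η t) - μ * a * (∫ t in (-T)..x, η t)
     + (μ * (∫ t in x..T, v t * η t) - μ * b * (∫ t in x..T, η t)) = μ * (b - a) * ∫ t in t0..x, η t := by
    have e2 : (∫ t in x..T, v t * η t) = (a * (∫ t in (-T)..t0, η t) + b * (∫ t in t0..T, η t)) - ∫ t in (-T)..x, v t * η t := by
      linarith
    rw [e2, ← a4, ← a5]; ring
  have g5 : ε * (μ ^ 2 / (4 * Λ)) * (∫ t in (-T)..x, η t) + ε * (μ ^ 2 / (4 * Λ)) * (∫ t in x..T, η t)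
     = ε * (μ ^ 2 / (4 * Λ)) * (∫ t in (-T)..T, η t) := by rw [← a3]; ring
  linarith only [KL, KR, a1, g1, g2, g3, g4, mm, g5]

end

section

/-! ### Part 9: integrals of the heteroclinic profile -/

section P9
variable {W : ℝ → ℝ} {a b c : ℝ} {z : ℝ → ℝ}

lemma CauchyProfile.reflect (hz : CauchyProfile W a b c z) :
    CauchyProfile (fun s => W (a + b - s)) a b (a + b - c) (fun t => a + b - z (-t)) := by
  refine ⟨fun t => ?_, by simp [hz.init], fun t => ?_⟩
  · have := ((hz.ode (-t)).comp t (hasDerivAt_neg t)).const_sub (a + b)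
    refine this.congr_deriv ?_
    simp only [mul_neg, mul_one, neg_neg]
    rw [show a + b - (a + b - z (-t)) = z (-t) by ring]
  · have := hz.range (-t)
    exact ⟨by linarith [this.2], by linarith [this.1]⟩

lemma CauchyProfile.ode' (hz : CauchyProfile W a b c z) (t : ℝ) : HasDerivAt z (ff W a b (z t)) t := by
  rw [ff_eq (hz.range t).1 (hz.range t).2]; exact hz.ode t

lemma CauchyProfile.mono (hz : CauchyProfile W a b c z) : Monotone z := by
  apply monotone_of_deriv_nonneg (fun t => (hz.ode t).differentiableAt)
  intro t; rw [(hz.ode t).deriv]; exact Real.sqrt_nonneg _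

lemma CauchyProfile.cont (hz : CauchyProfile W a b c z) : Continuous z :=
  continuous_iff_continuousAt.mpr fun t => (hz.ode t).continuousAt

lemma CauchyProfile.ge_c (hz : CauchyProfile W a b c z) {t : ℝ} (ht : 0 ≤ t) : c ≤ z t := by
  rw [← hz.init]; exact hz.mono ht

lemma WF.tailc (h : WF W a b c) : ∃ K > 0, ∀ s, c ≤ s → s ≤ b → b - s ≤ K * ff W a b s ∧ psi W a b s ≤ K * ff W a b s ^ 2 := by
  have hac := h.ac
  obtain ⟨K, hK, H⟩ := h.tail (α := (a + c) / 2) (by linarith) (by linarith)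
  exact ⟨K, hK, fun s h1 h2 => H s (by linarith) h2⟩

lemma WF.z_ff_int (h : WF W a b c) (hz : CauchyProfile W a b c z) :
    IntegrableOn (fun t => ff W a b (z t)) (Ioi 0) := by
  have hb : BddAbove (range z) := ⟨b, by rintro _ ⟨t, rfl⟩; exact (hz.range t).2⟩
  exact integrableOn_Ioi_deriv_of_nonneg' (fun t _ => hz.ode' t) (fun t _ => ff_nonneg _ _ _ _)
    (tendsto_atTop_ciSup hz.mono hb)

lemma WF.z_int (h : WF W a b c) (hz : CauchyProfile W a b c z) :
    IntegrableOn (fun t => b - z t) (Ioi 0) := by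
  obtain ⟨K, hK, H⟩ := h.tailc
  refine Integrable.mono' ((h.z_ff_int hz).const_mul K) (by have := hz.cont; fun_prop) ?_
  filter_upwards [ae_restrict_mem measurableSet_Ioi] with t ht
  rw [Real.norm_eq_abs, abs_of_nonneg (by linarith [(hz.range t).2])]
  exact (H _ (hz.ge_c (le_of_lt ht)) (hz.range t).2).1

lemma WF.psiz_int (h : WF W a b c) (hz : CauchyProfile W a b c z) :
    IntegrableOn (fun t => psi W a b (z t)) (Ioi 0) := by
  obtain ⟨K, hK, H⟩ := h.tailc
  refine Integrable.mono' ((h.z_ff_int hz).const_mul (K * Real.sqrt (W c)))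
    (h.psi_cont.comp hz.cont).aestronglyMeasurable ?_
  filter_upwards [ae_restrict_mem measurableSet_Ioi] with t ht
  rw [Real.norm_eq_abs, abs_of_nonneg (h.psi_nonneg _)]
  refine (H _ (hz.ge_c (le_of_lt ht)) (hz.range t).2).2.trans ?_
  have h1 := h.ff_bdd (z t)
  have h2 := ff_nonneg W a b (z t)
  have : ff W a b (z t) ^ 2 ≤ Real.sqrt (W c) * ff W a b (z t) := by nlinarith
  nlinarith

lemma WF.z_tendsto (h : WF W a b c) (hz : CauchyProfile W a b c z) : Tendsto z atTop (𝓝 b) := by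
  have hb : BddAbove (range z) := ⟨b, by rintro _ ⟨t, rfl⟩; exact (hz.range t).2⟩
  have hL := tendsto_atTop_ciSup hz.mono hb
  set L := ⨆ i, z i with hLd
  have hLb : L ≤ b := le_of_tendsto' hL (fun t => (hz.range t).2)
  rcases hLb.eq_or_lt with e | e
  · rwa [← e]
  exfalso
  have hi := h.z_int hz
  have : IntegrableOn (fun _ : ℝ => b - L) (Ioi 0) := by
    refine Integrable.mono' hi (by fun_prop) (Eventually.of_forall fun t => ?_)
    rw [Real.norm_eq_abs, abs_of_pos (by linarith)]
    linarith [le_ciSup hb t]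
  rw [integrableOn_const_iff] at this
  simp [sub_eq_zero, e.ne'] at this

lemma WF.JJ_tendsto (h : WF W a b c) (hz : CauchyProfile W a b c z) {g : ℝ → ℝ} (hg : Continuous g) (hgb : g b = 0)
    (hgi : IntegrableOn (fun t => g (z t)) (Ioi 0)) :
    Tendsto (fun ε => JJ W a b g ε c) (𝓝[>] 0) (𝓝 (∫ t in Ioi 0, g (z t))) := by
  have hgz := hg.comp hz.cont
  have hfz := h.ff_cont.comp hz.cont
  have bd : ∀ ε > 0, ∀ t, ‖g (z t) * (ff W a b (z t) ^ 2 / (ff W a b (z t) ^ 2 + ε ^ 2))‖ ≤ ‖g (z t)‖ := by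
    intro ε hε t
    rw [norm_mul]
    have h1 := ratio_le (ff W a b (z t)) ε hε
    have h2 : 0 ≤ ff W a b (z t) ^ 2 / (ff W a b (z t) ^ 2 + ε ^ 2) := by positivity
    rw [Real.norm_eq_abs (_ / _), abs_of_nonneg h2]
    exact mul_le_of_le_one_right (norm_nonneg _) h1
  have ct : ∀ ε > 0, Continuous (fun t => g (z t) * (ff W a b (z t) ^ 2 / (ff W a b (z t) ^ 2 + ε ^ 2))) := by
    intro ε hε
    refine hgz.mul ((hfz.pow 2).div ((hfz.pow 2).add continuous_const) (fun x => ?_))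
    positivity
  have key : ∀ ε > 0, JJ W a b g ε c = ∫ t in Ioi 0, g (z t) * (ff W a b (z t) ^ 2 / (ff W a b (z t) ^ 2 + ε ^ 2)) := by
    intro ε hε
    have hd : ∀ t ∈ Ici (0:ℝ), HasDerivAt (fun t => JJ W a b g ε (z t))
        (-(g (z t) * (ff W a b (z t) ^ 2 / (ff W a b (z t) ^ 2 + ε ^ 2)))) t := by
      intro t _
      have := (h.JJ_deriv hg hε (z t)).comp t (hz.ode' t)
      exact this.congr_deriv (by ring)
    have hi : IntegrableOn (fun t => -(g (z t) * (ff W a b (z t) ^ 2 / (ff W a b (z t) ^ 2 + ε ^ 2)))) (Ioi 0) := by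
      apply Integrable.neg
      exact Integrable.mono hgi (ct ε hε).aestronglyMeasurable (Eventually.of_forall (bd ε hε))
    have hl : Tendsto (fun t => JJ W a b g ε (z t)) atTop (𝓝 0) := by
      have := ((h.JJ_deriv hg hε b).continuousAt.tendsto).comp (h.z_tendsto hz)
      rwa [h.JJ_ge g ε le_rfl] at this
    have := integral_Ioi_of_hasDerivAt_of_tendsto' hd hi hl
    rw [integral_neg, hz.init] at this
    linarith
  have lim : Tendsto (fun ε => ∫ t in Ioi 0, g (z t) * (ff W a b (z t) ^ 2 / (ff W a b (z t) ^ 2 + ε ^ 2)))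
      (𝓝[>] (0:ℝ)) (𝓝 (∫ t in Ioi 0, g (z t))) := by
    apply tendsto_integral_filter_of_dominated_convergence (fun t => ‖g (z t)‖)
    · filter_upwards [self_mem_nhdsWithin] with ε hε using (ct ε hε).aestronglyMeasurable
    · filter_upwards [self_mem_nhdsWithin] with ε hε using Eventually.of_forall (bd ε hε)
    · exact hgi.norm
    · filter_upwards [ae_restrict_mem measurableSet_Ioi] with t ht
      have hc := hz.ge_c (le_of_lt ht)
      have hac := h.ac
      rcases (hz.range t).2.eq_or_lt with e | e
      · rw [e, hgb]; simp
      · have hf : 0 < ff W a b (z t) := h.ff_pos (by linarith) e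
        have : Tendsto (fun ε : ℝ => g (z t) * (ff W a b (z t) ^ 2 / (ff W a b (z t) ^ 2 + ε ^ 2))) (𝓝 0)
            (𝓝 (g (z t) * (ff W a b (z t) ^ 2 / (ff W a b (z t) ^ 2 + 0 ^ 2)))) := by
          apply ContinuousAt.tendsto (f := fun ε : ℝ => g (z t) * (ff W a b (z t) ^ 2 / (ff W a b (z t) ^ 2 + ε ^ 2)))
          apply ContinuousAt.mul continuousAt_const
          apply ContinuousAt.div continuousAt_const (by fun_prop)
          positivity
        rw [show ff W a b (z t) ^ 2 / (ff W a b (z t) ^ 2 + 0 ^ 2) = 1 by rw [zero_pow two_ne_zero, add_zero]; exact div_self (by positivity), mul_one] at this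
        exact this.mono_left nhdsWithin_le_nhds
  refine lim.congr' ?_
  filter_upwards [self_mem_nhdsWithin] with ε hε using (key ε hε).symm

lemma WF.tW (h : WF W a b c) (hz : CauchyProfile W a b c z) :
    IntegrableOn (fun t => W (z t) * t) (Ioi 0) ∧ ∫ t in Ioi 0, W (z t) * t = ∫ t in Ioi 0, psi W a b (z t) := by
  obtain ⟨K, hK, H⟩ := h.tailc
  have hpz := h.psi_cont.comp hz.cont
  have dpsi : ∀ t, HasDerivAt (fun t => psi W a b (z t)) (-W (z t)) t := by
    intro t
    have := (h.psi_deriv (z t)).comp t (hz.ode' t)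
    refine this.congr_deriv ?_
    rw [← h.ff_sq (hz.range t).1 (hz.range t).2]; ring
  have anti : AntitoneOn (fun t => Real.exp (t / K) * psi W a b (z t)) (Ici 0) := by
    have hd : ∀ t, HasDerivAt (fun t => Real.exp (t / K) * psi W a b (z t))
        (Real.exp (t / K) * (1 / K) * psi W a b (z t) + Real.exp (t / K) * (-W (z t))) t := by
      intro t
      exact (((hasDerivAt_id t).div_const K).exp).mul (dpsi t)
    apply antitoneOn_of_deriv_nonpos (convex_Ici 0)
    · exact fun t _ => (hd t).continuousAt.continuousWithinAt
    · exact fun t _ => (hd t).differentiableAt.differentiableWithinAt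
    · intro t ht
      rw [interior_Ici] at ht
      rw [(hd t).deriv]
      have := (H _ (hz.ge_c (le_of_lt ht)) (hz.range t).2).2
      rw [h.ff_sq (hz.range t).1 (hz.range t).2] at this
      have e : (1 / K) * psi W a b (z t) ≤ W (z t) := by
        rw [one_div, inv_mul_le_iff₀ hK]; exact this
      have := Real.exp_pos (t / K)
      nlinarith
  have lim0 : Tendsto (fun t => t * psi W a b (z t)) atTop (𝓝 0) := by
    have l1 := (tendsto_rpow_mul_exp_neg_mul_atTop_nhds_zero 1 (1 / K) (by positivity)).const_mul (psi W a b c)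
    rw [mul_zero] at l1
    refine tendsto_of_tendsto_of_tendsto_of_le_of_le' tendsto_const_nhds l1 ?_ ?_
    · filter_upwards [eventually_ge_atTop 0] with t ht
      exact mul_nonneg ht (h.psi_nonneg _)
    · filter_upwards [eventually_ge_atTop 0] with t ht
      have := anti (mem_Ici.mpr le_rfl) (mem_Ici.mpr ht) ht
      simp only [zero_div, Real.exp_zero, one_mul, hz.init] at this
      have e : psi W a b (z t) ≤ psi W a b c * Real.exp (-(1 / K) * t) := by
        rw [show -(1 / K) * t = -(t / K) by ring, Real.exp_neg, ← div_eq_mul_inv, le_div_iff₀ (Real.exp_pos _)]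
        linarith
      rw [Real.rpow_one]
      nlinarith
  have pint := h.psiz_int hz
  have lim1 := intervalIntegral_tendsto_integral_Ioi 0 pint tendsto_id
  have hG : ∀ t ∈ Ici (0:ℝ), HasDerivAt (fun t => (∫ r in (0:ℝ)..t, psi W a b (z r)) - t * psi W a b (z t)) (W (z t) * t) t := by
    intro t _
    have := (intervalIntegral.integral_hasDerivAt_right (hpz.intervalIntegrable 0 t)
      hpz.stronglyMeasurable.stronglyMeasurableAtFilter hpz.continuousAt).sub ((hasDerivAt_id t).mul (dpsi t))
    refine this.congr_deriv ?_
    simp [mul_comm]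
  have hl : Tendsto (fun t => (∫ r in (0:ℝ)..t, psi W a b (z r)) - t * psi W a b (z t)) atTop
      (𝓝 ((∫ t in Ioi 0, psi W a b (z t)) - 0)) := lim1.sub lim0
  have hn : ∀ t ∈ Ioi (0:ℝ), 0 ≤ W (z t) * t := fun t ht => mul_nonneg (h.nonneg _) (le_of_lt ht)
  refine ⟨integrableOn_Ioi_deriv_of_nonneg' hG hn hl, ?_⟩
  have := integral_Ioi_of_hasDerivAt_of_nonneg' hG hn hl
  rw [this]; simp

lemma integral_split_neg {f : ℝ → ℝ} (h1 : IntegrableOn f (Ioi 0)) (h2 : IntegrableOn (fun t => f (-t)) (Ioi 0)) :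
    Integrable f ∧ ∫ t, f t = (∫ t in Ioi 0, f t) + ∫ t in Ioi 0, f (-t) := by
  have h3 : IntegrableOn f (Iic 0) := by
    have := (integrableOn_Ici_iff_integrableOn_Ioi (μ := volume)).mpr h2
    rw [← integrable_indicator_iff measurableSet_Ici] at this
    have := this.comp_neg
    rw [← integrable_indicator_iff measurableSet_Iic]
    refine this.congr (Eventually.of_forall fun t => ?_)
    by_cases ht : t ≤ 0 <;> simp [indicator, ht]
  have e : ∫ t in Ioi 0, f (-t) = ∫ t in Iic 0, f t := by
    have := integral_comp_neg_Ioi (0:ℝ) f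
    simp
  constructor
  · rw [← integrableOn_univ, ← Iic_union_Ioi (a := (0:ℝ))]
    exact h3.union h1
  · rw [e, add_comm, intervalIntegral.integral_Iic_add_Ioi h3 h1]

lemma WF.csym_eq (h : WF W a b c) (hz : CauchyProfile W a b c z) :
    ∫ t, W (z t) * t = (∫ t in Ioi 0, psi W a b (z t))
      - ∫ t in Ioi 0, psi (fun s => W (a + b - s)) a b (a + b - z (-t)) := by
  have h1 := h.tW hz
  have h2 := h.reflect.tW hz.reflect
  have e : (fun t => W (z (-t)) * -t) = fun t => -(W (a + b - (a + b - z (-t))) * t) := by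
    funext t; rw [show a + b - (a + b - z (-t)) = z (-t) by ring]; ring
  have := (integral_split_neg (f := fun t => W (z t) * t) h1.1 (by rw [e]; exact h2.1.neg)).2
  rw [this, e, integral_neg, h1.2, h2.2]
  ring

lemma WF.A_eq (h : WF W a b c) (hz : CauchyProfile W a b c z) (τ : ℝ) :
    ∫ s, (z (s - τ) - stepAB a b 0 s) = (∫ t in Ioi 0, (b - (a + b - z (-t)))) - (∫ t in Ioi 0, (b - z t)) - τ * (b - a) := by
  have h1 := h.z_int hz
  have h2 := h.reflect.z_int hz.reflect
  have h1' : IntegrableOn (fun t => z t - stepAB a b 0 t) (Ioi 0) := by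
    refine h1.neg.congr_fun ?_ measurableSet_Ioi
    intro t ht
    have : ¬ t ≤ 0 := not_le.mpr ht
    simp [stepAB, this]
  have h2' : IntegrableOn (fun t => z (-t) - stepAB a b 0 (-t)) (Ioi 0) := by
    refine h2.congr_fun ?_ measurableSet_Ioi
    intro t ht
    have : 0 ≤ t := le_of_lt ht
    simp [stepAB, this]; ring
  obtain ⟨hi, he⟩ := integral_split_neg h1' h2'
  have e1 : ∫ t in Ioi 0, (z t - stepAB a b 0 t) = - ∫ t in Ioi 0, (b - z t) := by
    rw [← integral_neg]
    apply setIntegral_congr_fun measurableSet_Ioi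
    intro t ht
    have : ¬ t ≤ 0 := not_le.mpr ht
    simp [stepAB, this]
  have e2 : ∫ t in Ioi 0, (z (-t) - stepAB a b 0 (-t)) = ∫ t in Ioi 0, (b - (a + b - z (-t))) := by
    apply setIntegral_congr_fun measurableSet_Ioi
    intro t ht
    have : 0 ≤ t := le_of_lt ht
    simp [stepAB, this]; ring
  have hs : (fun s => z (s - τ) - stepAB a b 0 s) = fun s => (z (s - τ) - stepAB a b 0 (s - τ)) +
      ((Ioc τ 0).indicator (fun _ => b - a) s - (Ioc 0 τ).indicator (fun _ => b - a) s) := by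
    funext s
    simp only [stepAB, indicator, mem_Ioc]
    by_cases q1 : s ≤ 0 <;> by_cases q2 : s ≤ τ
    · simp [q1, q2, not_lt.mpr q1, not_lt.mpr q2]
    · simp [q1, q2, not_le.mp q2, not_lt.mpr q1]
    · simp [q1, q2, not_le.mp q1]
    · simp [q1, q2]
  have i1 : Integrable ((Ioc τ 0).indicator (fun _ => b - a)) := by
    rw [integrable_indicator_iff measurableSet_Ioc]; exact integrableOn_const (by simp)
  have i2 : Integrable ((Ioc 0 τ).indicator (fun _ => b - a)) := by
    rw [integrable_indicator_iff measurableSet_Ioc]; exact integrableOn_const (by simp)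
  rw [hs, integral_add (hi.comp_sub_right τ) (i1.sub' i2), integral_sub i1 i2,
    integral_sub_right_eq_self (fun s => z s - stepAB a b 0 s) τ, he, e1, e2,
    integral_indicator measurableSet_Ioc, integral_indicator measurableSet_Ioc]
  simp
  rcases le_total τ 0 with q | q
  · rw [max_eq_left (by linarith), max_eq_right q]; ring
  · rw [max_eq_right (by linarith), max_eq_left q]; ring

end P9

end

section

/-! ### Part 10: minimizers have finite energy -/

section P10
variable {W : ℝ → ℝ} {a b c T : ℝ} {η : ℝ → ℝ}

lemma GW_contOn (hs : ContDiffOn ℝ 1 η (Ioo (-T) T)) : ContinuousOn η (Ioo (-T) T) := hs.continuousOn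

lemma bdd_mul_int (hηi : IntegrableOn η (Ioo (-T) T)) (hηp : ∀ t ∈ Ioo (-T) T, 0 < η t) {g : ℝ → ℝ} (hg : AEStronglyMeasurable g (volume.restrict (Ioo (-T) T)))
    {C : ℝ} (hC : ∀ t ∈ Ioo (-T) T, |g t| ≤ C) : IntegrableOn (fun t => g t * η t) (Ioo (-T) T) := by
  refine Integrable.mono' (hηi.const_mul C) (hg.mul hηi.aestronglyMeasurable) ?_
  filter_upwards [ae_restrict_mem measurableSet_Ioo] with t ht
  rw [norm_mul, Real.norm_eq_abs, Real.norm_eq_abs, abs_of_pos (hηp t ht)]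
  exact mul_le_mul_of_nonneg_right (hC t ht) (hηp t ht).le

lemma stepAB_meas (a b t0 : ℝ) : Measurable (stepAB a b t0) :=
  Measurable.ite measurableSet_Iic measurable_const measurable_const

lemma stepAB_bd (a b t0 t : ℝ) : |stepAB a b t0 t| ≤ |a| + |b| := by
  unfold stepAB; split_ifs
  · linarith [abs_nonneg b]
  · linarith [abs_nonneg a]

lemma WF.competitor (h : WF W a b c) (hηi : IntegrableOn η (Ioo (-T) T)) (hηp : ∀ t ∈ Ioo (-T) T, 0 < η t)
    (hηc : ContinuousOn η (Ioo (-T) T)) {m t0 δ : ℝ} (ht0 : t0 ∈ Ioo (-T) T) (hm : massEq T η m (stepAB a b t0))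
    (hδ : 0 < δ) : ∃ w, Adm T η m δ (stepAB a b t0) w ∧ ∀ ε, ennEnergy T W η ε w < ⊤ := by
  have hab := h.ab
  have hca : ContinuousAt η t0 := hηc.continuousAt (Ioo_mem_nhds ht0.1 ht0.2)
  have hη0 := hηp t0 ht0
  obtain ⟨r, hr, hr1⟩ := Metric.eventually_nhds_iff.mp
    ((hca.eventually (gt_mem_nhds (show η t0 < η t0 + 1 by linarith))).and (Ioo_mem_nhds ht0.1 ht0.2))
  set M := η t0 + 1
  have hM : 0 < M := by positivity
  -- width
  obtain ⟨hh, hh0, hhr, hhδ⟩ : ∃ hh > 0, hh < r ∧ (b - a) * M * (2 * hh) ≤ δ := by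
    have hba : 0 < b - a := by linarith
    refine ⟨min (r / 2) (δ / (2 * (b - a) * M)), lt_min (by linarith) (by positivity), ?_, ?_⟩
    · exact (min_le_left _ _).trans_lt (by linarith)
    · have := min_le_right (r / 2) (δ / (2 * (b - a) * M))
      rw [le_div_iff₀ (by positivity)] at this
      linarith
  have near : ∀ t, |t - t0| ≤ hh → t ∈ Ioo (-T) T ∧ η t ≤ M := by
    intro t ht
    have := hr1 (y := t) (by rw [Real.dist_eq]; linarith)
    exact ⟨this.2, this.1.le⟩
  set w1 : ℝ → ℝ := fun t => a + (b - a) * Real.smoothTransition ((t - t0) / hh) with hw1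
  set w2 : ℝ → ℝ := fun t => a + (b - a) * Real.smoothTransition ((t - (t0 - hh)) / hh) with hw2
  have sc : ∀ s : ℝ, ContDiff ℝ 1 (fun t => a + (b - a) * Real.smoothTransition ((t - s) / hh)) := by
    intro s
    have : ContDiff ℝ 1 Real.smoothTransition := Real.smoothTransition.contDiff
    fun_prop
  have c1 : ContDiff ℝ 1 w1 := sc t0
  have c2 : ContDiff ℝ 1 w2 := sc (t0 - hh)
  have rng : ∀ s t, a ≤ a + (b - a) * Real.smoothTransition ((t - s) / hh) ∧ a + (b - a) * Real.smoothTransition ((t - s) / hh) ≤ b := by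
    intro s t
    have q1 := Real.smoothTransition.nonneg ((t - s) / hh)
    have q2 := Real.smoothTransition.le_one ((t - s) / hh)
    constructor <;> nlinarith
  have z1 : ∀ t, t ≤ t0 → w1 t = a := by
    intro t ht
    simp only [hw1]
    rw [Real.smoothTransition.zero_of_nonpos (div_nonpos_of_nonpos_of_nonneg (by linarith) hh0.le)]; ring
  have o1 : ∀ t, t0 + hh ≤ t → w1 t = b := by
    intro t ht
    simp only [hw1]
    rw [Real.smoothTransition.one_of_one_le (by rw [le_div_iff₀ hh0]; linarith)]; ring
  have z2 : ∀ t, t ≤ t0 - hh → w2 t = a := by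
    intro t ht
    simp only [hw2]
    rw [Real.smoothTransition.zero_of_nonpos (div_nonpos_of_nonpos_of_nonneg (by linarith) hh0.le)]; ring
  have o2 : ∀ t, t0 ≤ t → w2 t = b := by
    intro t ht
    simp only [hw2]
    rw [Real.smoothTransition.one_of_one_le (by rw [le_div_iff₀ hh0]; linarith)]; ring
  have le1 : ∀ t, w1 t ≤ stepAB a b t0 t := by
    intro t; unfold stepAB; split_ifs with ht
    · rw [z1 t ht]
    · exact (rng t0 t).2
  have le2 : ∀ t, stepAB a b t0 t ≤ w2 t := by
    intro t; unfold stepAB; split_ifs with ht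
    · exact (rng (t0 - hh) t).1
    · rw [o2 t (not_le.mp ht).le]
  have Bd : ∀ x, a ≤ x → x ≤ b → |x| ≤ |a| + |b| := by
    intro x q1 q2
    rw [abs_le]
    constructor
    · linarith [neg_abs_le a, abs_nonneg b]
    · linarith [le_abs_self b, abs_nonneg a]
  have i1 : IntegrableOn (fun t => w1 t * η t) (Ioo (-T) T) :=
    bdd_mul_int hηi hηp c1.continuous.aestronglyMeasurable (fun t _ => Bd _ (rng t0 t).1 (rng t0 t).2)
  have i2 : IntegrableOn (fun t => w2 t * η t) (Ioo (-T) T) :=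
    bdd_mul_int hηi hηp c2.continuous.aestronglyMeasurable (fun t _ => Bd _ (rng (t0 - hh) t).1 (rng (t0 - hh) t).2)
  have i0 : IntegrableOn (fun t => stepAB a b t0 t * η t) (Ioo (-T) T) :=
    bdd_mul_int hηi hηp (stepAB_meas a b t0).aestronglyMeasurable (fun t _ => stepAB_bd a b t0 t)
  set m1 := ∫ t in Ioo (-T) T, w1 t * η t with hm1
  set m2 := ∫ t in Ioo (-T) T, w2 t * η t with hm2
  have mle1 : m1 ≤ m := by
    rw [← hm]
    apply setIntegral_mono_on i1 i0 measurableSet_Ioo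
    exact fun t ht => mul_le_mul_of_nonneg_right (le1 t) (hηp t ht).le
  have mle2 : m ≤ m2 := by
    rw [← hm]
    apply setIntegral_mono_on i0 i2 measurableSet_Ioo
    exact fun t ht => mul_le_mul_of_nonneg_right (le2 t) (hηp t ht).le
  obtain ⟨θ, ⟨hθ0, hθ1⟩, hθ⟩ : ∃ θ ∈ Icc (0:ℝ) 1, (1 - θ) * m1 + θ * m2 = m := by
    have hc : ContinuousOn (fun θ : ℝ => (1 - θ) * m1 + θ * m2) (Icc 0 1) := by fun_prop
    have := intermediate_value_Icc (zero_le_one) hc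
    exact this ⟨by simpa using mle1, by simpa using mle2⟩
  set w : ℝ → ℝ := fun t => (1 - θ) * w1 t + θ * w2 t with hw
  have cw : ContDiff ℝ 1 w := (contDiff_const.mul c1).add (contDiff_const.mul c2)
  have rw' : ∀ t, a ≤ w t ∧ w t ≤ b := by
    intro t
    have q1 := rng t0 t
    have q2 := rng (t0 - hh) t
    simp only [hw]
    change a ≤ w1 t ∧ w1 t ≤ b at q1
    change a ≤ w2 t ∧ w2 t ≤ b at q2
    constructor <;> nlinarith
  have cd : Continuous (deriv w) := cw.continuous_deriv le_rfl
  obtain ⟨D, hD⟩ := (isCompact_Icc (a := -T) (b := T)).exists_bound_of_continuousOn cd.continuousOn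
  have hD' : ∀ t ∈ Ioo (-T) T, deriv w t ^ 2 ≤ D ^ 2 := by
    intro t ht
    have := hD t ⟨ht.1.le, ht.2.le⟩
    rw [Real.norm_eq_abs] at this
    exact sq_le_sq' (by linarith [neg_abs_le (deriv w t)]) ((le_abs_self _).trans this)
  refine ⟨w, ⟨⟨fun t _ => cw.differentiable (by norm_num) t, ?_⟩, ?_, ?_⟩, ?_⟩
  · refine bdd_mul_int hηi hηp (C := (|a| + |b|) ^ 2 + D ^ 2) ((cw.continuous.pow 2).add (cd.pow 2)).aestronglyMeasurable ?_
    intro t ht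
    rw [abs_of_nonneg (by positivity)]
    have q := Bd _ (rw' t).1 (rw' t).2
    have : w t ^ 2 ≤ (|a| + |b|) ^ 2 := sq_le_sq' (by linarith [neg_abs_le (w t)]) ((le_abs_self _).trans q)
    linarith [hD' t ht]
  · unfold massEq
    rw [← hθ, hm1, hm2, ← integral_const_mul, ← integral_const_mul, ← integral_add (i1.const_mul _) (i2.const_mul _)]
    congr 1; funext t; simp only [hw]; ring
  · unfold dist1
    have bdd : ∀ t, |w t - stepAB a b t0 t| ≤ (Icc (t0 - hh) (t0 + hh)).indicator (fun _ => b - a) t := by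
      intro t
      by_cases ht : t ∈ Icc (t0 - hh) (t0 + hh)
      · rw [indicator_of_mem ht, abs_le]
        have := rw' t
        unfold stepAB
        split_ifs <;> constructor <;> linarith
      · rw [indicator_of_notMem ht]
        have : w t = stepAB a b t0 t := by
          simp only [hw]
          rw [mem_Icc, not_and_or] at ht
          rcases ht with ht | ht
          · rw [not_le] at ht
            rw [z1 t (by linarith), z2 t ht.le, stepAB, if_pos (by linarith)]; ring
          · rw [not_le] at ht
            rw [o1 t ht.le, o2 t (by linarith), stepAB, if_neg (by linarith)]; ring
        rw [this]; simp
    have hsub : Icc (t0 - hh) (t0 + hh) ⊆ Ioo (-T) T := by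
      intro t ht
      exact (near t (by rw [abs_le]; constructor <;> linarith [ht.1, ht.2])).1
    calc ∫ t in Ioo (-T) T, |w t - stepAB a b t0 t| * η t
        ≤ ∫ t in Ioo (-T) T, (Icc (t0 - hh) (t0 + hh)).indicator (fun _ => (b - a) * M) t := by
          apply setIntegral_mono_on _ _ measurableSet_Ioo
          · intro t ht
            by_cases h' : t ∈ Icc (t0 - hh) (t0 + hh)
            · have q1 := bdd t
              rw [indicator_of_mem h'] at q1 ⊢
              have := (near t (by rw [abs_le]; constructor <;> linarith [h'.1, h'.2])).2
              exact mul_le_mul q1 this (hηp t ht).le (by linarith)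
            · have q1 := bdd t
              rw [indicator_of_notMem h'] at q1 ⊢
              have := hηp t ht
              nlinarith [abs_nonneg (w t - stepAB a b t0 t)]
          · refine bdd_mul_int hηi hηp (C := b - a) ((cw.continuous.measurable.sub (stepAB_meas a b t0)).abs).aestronglyMeasurable ?_
            intro t ht
            rw [abs_abs]
            refine (bdd t).trans ?_
            apply indicator_le' (fun _ _ => le_rfl)
            intro _ _; simpa using hab.le
          · rw [integrableOn_indicator_iff measurableSet_Icc]
            exact integrableOn_const (ne_of_lt ((measure_mono inter_subset_left).trans_lt (by simp)))
      _ = (b - a) * M * (2 * hh) := by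
          rw [setIntegral_indicator measurableSet_Icc, inter_eq_right.mpr hsub, setIntegral_const]
          rw [Real.volume_real_Icc_of_le (by linarith), smul_eq_mul]; ring
      _ ≤ δ := hhδ
  · intro ε
    unfold ennEnergy
    have : IntegrableOn (fun t => (W c + ε ^ 2 * D ^ 2) * η t) (Ioo (-T) T) := hηi.const_mul _
    refine lt_of_le_of_lt ?_ this.lintegral_lt_top
    apply setLIntegral_mono' measurableSet_Ioo
    intro t ht
    apply ENNReal.ofReal_le_ofReal
    apply mul_le_mul_of_nonneg_right _ (hηp t ht).le
    have q1 := h.W_le_c (rw' t).1 (rw' t).2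
    have q2 := hD' t ht
    have : ε ^ 2 * deriv w t ^ 2 ≤ ε ^ 2 * D ^ 2 := mul_le_mul_of_nonneg_left q2 (sq_nonneg _)
    linarith

lemma WF.jmin_int (h : WF W a b c) (hηi : IntegrableOn η (Ioo (-T) T)) (hηp : ∀ t ∈ Ioo (-T) T, 0 < η t)
    (hηc : ContinuousOn η (Ioo (-T) T)) {m t0 δ ε : ℝ} (ht0 : t0 ∈ Ioo (-T) T) (hm : massEq T η m (stepAB a b t0))
    (hδ : 0 < δ) (hε : 0 < ε) {v : ℝ → ℝ} (hv : IsJMin T W η m δ ε (stepAB a b t0) v) :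
    IntegrableOn (EN W η v ε) (Ioo (-T) T) ∧ IntegrableOn (fun t => v t * η t) (Ioo (-T) T) := by
  obtain ⟨w, hw, hwf⟩ := h.competitor hηi hηp hηc ht0 hm hδ
  have hfin := (hv.2 w hw).trans_lt (hwf ε)
  have hvd := hv.1.1.1
  have hvc : ContinuousOn v (Ioo (-T) T) := fun t ht => (hvd t ht).continuousAt.continuousWithinAt
  have hvm : AEMeasurable v (volume.restrict (Ioo (-T) T)) := hvc.aemeasurable measurableSet_Ioo
  have hdm : Measurable (deriv v) := measurable_deriv v
  have hηm : AEMeasurable η (volume.restrict (Ioo (-T) T)) := hηi.aestronglyMeasurable.aemeasurable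
  constructor
  · have meas : AEMeasurable (fun t => (W (v t) + ε ^ 2 * (deriv v t) ^ 2) * η t) (volume.restrict (Ioo (-T) T)) := by
      have h1 := h.meas.comp_aemeasurable hvm
      exact ((h1.add ((hdm.pow_const 2).const_mul _).aemeasurable).mul hηm)
    have hi : IntegrableOn (fun t => (W (v t) + ε ^ 2 * (deriv v t) ^ 2) * η t) (Ioo (-T) T) := by
      refine (lintegral_ofReal_ne_top_iff_integrable meas.aestronglyMeasurable ?_).mp hfin.ne
      filter_upwards [ae_restrict_mem measurableSet_Ioo] with t ht
      have := hηp t ht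
      have := h.nonneg (v t)
      positivity
    have e : EN W η v ε = fun t => ε⁻¹ * ((W (v t) + ε ^ 2 * (deriv v t) ^ 2) * η t) := by
      funext t; unfold EN; field_simp
    rw [e]
    exact hi.const_mul _
  · refine Integrable.mono' (hηi.add hv.1.1.2) (hvm.mul hηm).aestronglyMeasurable ?_
    filter_upwards [ae_restrict_mem measurableSet_Ioo] with t ht
    have := hηp t ht
    rw [norm_mul, Real.norm_eq_abs, Real.norm_eq_abs, abs_of_pos this]
    simp only [Pi.add_apply]
    have e : |v t| ≤ 1 + (v t ^ 2 + deriv v t ^ 2) := by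
      nlinarith [sq_abs (v t), sq_nonneg (|v t| - 1), sq_nonneg (deriv v t)]
    calc |v t| * η t ≤ (1 + (v t ^ 2 + deriv v t ^ 2)) * η t := mul_le_mul_of_nonneg_right e this.le
      _ = _ := by ring

end P10

end

section

/-! ### Part 11: localisation of the transition -/

section P11
variable {W : ℝ → ℝ} {a b c T : ℝ} {η v : ℝ → ℝ}

lemma WF.cross (h : WF W a b c) {ε m u w : ℝ} (hε : 0 < ε) (hm : 0 ≤ m) (huw : u ≤ w)
    (hη : ∀ t ∈ Icc u w, m ≤ η t) (hv : ∀ t ∈ Icc u w, DifferentiableAt ℝ v t)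
    (hE : IntervalIntegrable (EN W η v ε) volume u w) :
    2 * m * |psi W a b (v u) - psi W a b (v w)| ≤ ∫ t in u..w, EN W η v ε t := by
  have hd : ∀ t ∈ Icc u w, HasDerivAt (fun t => psi W a b (v t)) (-ff W a b (v t) * deriv v t) t := fun t ht =>
    (h.psi_deriv (v t)).comp t (hv t ht).hasDerivAt
  have hle : ∀ t ∈ Icc u w, 2 * m * (ff W a b (v t) * |deriv v t|) ≤ EN W η v ε t := by
    intro t ht
    have q1 := h.ff_sq_le (v t)
    have q2 := ff_nonneg W a b (v t)
    have q3 := hη t ht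
    unfold EN
    have : 2 * (ff W a b (v t) * |deriv v t|) ≤ W (v t) / ε + ε * deriv v t ^ 2 := by
      have e : ff W a b (v t) ^ 2 / ε ≤ W (v t) / ε := by gcongr
      have e2 : 2 * (ff W a b (v t) * |deriv v t|) ≤ ff W a b (v t) ^ 2 / ε + ε * deriv v t ^ 2 := by
        rw [div_add' _ _ _ hε.ne', le_div_iff₀ hε, ← sq_abs (deriv v t)]
        nlinarith [sq_nonneg (ff W a b (v t) - ε * |deriv v t|)]
      linarith
    calc 2 * m * (ff W a b (v t) * |deriv v t|) = (2 * (ff W a b (v t) * |deriv v t|)) * m := by ring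
      _ ≤ (W (v t) / ε + ε * deriv v t ^ 2) * η t := by
        apply mul_le_mul this q3 hm
        have := h.nonneg (v t)
        positivity
  have hEi : IntegrableOn (EN W η v ε) (Icc u w) := by
    rw [integrableOn_Icc_iff_integrableOn_Ioc]; exact (intervalIntegrable_iff_integrableOn_Ioc_of_le huw).mp hE
  have k1 := intervalIntegral.sub_le_integral_of_hasDeriv_right_of_le huw (g := fun t => 2 * m * psi W a b (v t))
    (g' := fun t => 2 * m * (-ff W a b (v t) * deriv v t)) (φ := EN W η v ε)
    (fun t ht => ((hd t ht).const_mul _).continuousAt.continuousWithinAt)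
    (fun t ht => ((hd t ⟨ht.1.le, ht.2.le⟩).const_mul _).hasDerivWithinAt) hEi
    (fun t ht => by
      refine le_trans ?_ (hle t ⟨ht.1.le, ht.2.le⟩)
      have : -ff W a b (v t) * deriv v t ≤ ff W a b (v t) * |deriv v t| := by
        have := neg_abs_le (deriv v t)
        nlinarith [ff_nonneg W a b (v t)]
      gcongr)
  have k2 := intervalIntegral.sub_le_integral_of_hasDeriv_right_of_le huw (g := fun t => -(2 * m) * psi W a b (v t))
    (g' := fun t => -(2 * m) * (-ff W a b (v t) * deriv v t)) (φ := EN W η v ε)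
    (fun t ht => ((hd t ht).const_mul _).continuousAt.continuousWithinAt)
    (fun t ht => ((hd t ⟨ht.1.le, ht.2.le⟩).const_mul _).hasDerivWithinAt) hEi
    (fun t ht => by
      refine le_trans ?_ (hle t ⟨ht.1.le, ht.2.le⟩)
      have : ff W a b (v t) * deriv v t ≤ ff W a b (v t) * |deriv v t| := by
        have := le_abs_self (deriv v t)
        nlinarith [ff_nonneg W a b (v t)]
      calc -(2 * m) * (-ff W a b (v t) * deriv v t) = 2 * m * (ff W a b (v t) * deriv v t) := by ring
        _ ≤ _ := by gcongr)
  rcases abs_cases (psi W a b (v u) - psi W a b (v w)) with q | q <;> rw [q.1] <;> linarith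

lemma find_pt {u1 u2 κ : ℝ} {g : ℝ → ℝ} (hu : u1 ≤ u2) (hsub : Icc u1 u2 ⊆ Ioo (-T) T) (hηp : ∀ t ∈ Ioo (-T) T, 0 < η t)
    (hηi : IntegrableOn η (Ioo (-T) T))
    (hi : IntegrableOn (fun t => |v t - g t| * η t) (Ioo (-T) T))
    (hd : dist1 T η v g < κ * ∫ t in u1..u2, η t) : ∃ t ∈ Icc u1 u2, |v t - g t| ≤ κ := by
  by_contra hc
  push Not at hc
  have : κ * ∫ t in u1..u2, η t ≤ dist1 T η v g := by
    rw [intervalIntegral.integral_of_le hu, ← integral_Icc_eq_integral_Ioc, ← integral_const_mul]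
    unfold dist1
    calc ∫ t in Icc u1 u2, κ * η t ≤ ∫ t in Icc u1 u2, |v t - g t| * η t := by
          apply setIntegral_mono_on ((hηi.mono_set hsub).const_mul _) (hi.mono_set hsub) measurableSet_Icc
          intro t ht
          exact mul_le_mul_of_nonneg_right (hc t ht).le (hηp t (hsub ht)).le
      _ ≤ _ := by
          apply setIntegral_mono_set hi _ (LE.le.eventuallyLE hsub)
          filter_upwards [ae_restrict_mem measurableSet_Ioo] with t ht
          exact mul_nonneg (abs_nonneg _) (hηp t ht).le
  linarith

set_option maxHeartbeats 2000000 in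
lemma WF.geom (h : WF W a b c) {α γ t0 A1 A2 B1 B2 r1 : ℝ} (h1 : a < α) (h2 : α < c) (h3 : c < γ) (h4 : γ < b)
    (hηp : ∀ t ∈ Ioo (-T) T, 0 < η t) (hηi : IntegrableOn η (Ioo (-T) T)) (hηc : ContinuousOn η (Ioo (-T) T))
    (hA0 : -T < A1) (hA : A1 < A2) (hA2 : A2 < t0) (hB1 : t0 < B1) (hB : B1 < B2) (hB2 : B2 < T) (hr1 : 0 < r1) :
    ∃ δ0 > 0, ∃ ρ > 0, ∀ δ ε : ℝ, ∀ v : ℝ → ℝ, δ ≤ δ0 → 0 < ε → (∀ t ∈ Ioo (-T) T, DifferentiableAt ℝ v t) →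
      IntegrableOn (EN W η v ε) (Ioo (-T) T) → IntegrableOn (fun t => |v t - stepAB a b t0 t| * η t) (Ioo (-T) T) →
      dist1 T η v (stepAB a b t0) ≤ δ → (∫ t in (-T)..T, EN W η v ε t) ≤ 2 * psi W a b a * η t0 + ρ →
      ∃ x pL pR, |x - t0| ≤ r1 ∧ pL ∈ Icc A1 A2 ∧ pR ∈ Icc B1 B2 ∧ v x = c ∧ (∀ t ∈ Icc x pR, α ≤ v t) ∧
        (∀ t ∈ Icc pL x, v t ≤ γ) ∧ γ ≤ v pR ∧ v pL ≤ α := by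
  have ht0 : t0 ∈ Ioo (-T) T := ⟨by linarith, by linarith⟩
  have hη0 := hηp t0 ht0
  have hsubK : Icc A1 B2 ⊆ Ioo (-T) T := fun t ht => ⟨by linarith [ht.1], by linarith [ht.2]⟩
  obtain ⟨tm, htm, hmin⟩ := (isCompact_Icc (a := A1) (b := B2)).exists_isMinOn ⟨t0, by constructor <;> linarith⟩
    (hηc.mono hsubK)
  set ms := η tm with hms
  have hms0 : 0 < ms := hηp tm (hsubK htm)
  have hmin' : ∀ t ∈ Icc A1 B2, ms ≤ η t := fun t ht => hmin ht
  set cW := psi W a b a with hcW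
  set Δ := min (psi W a b α - psi W a b c) (psi W a b c - psi W a b γ) with hΔ
  have hΔ0 : 0 < Δ := lt_min (by linarith [h.psi_strict h1.le h2 (by linarith)]) (by linarith [h.psi_strict h.ac.le h3 h4.le])
  have hΔ1 : Δ ≤ psi W a b α - psi W a b c := min_le_left _ _
  have hΔ2 : Δ ≤ psi W a b c - psi W a b γ := min_le_right _ _
  have hcW0 : 0 < cW := by
    have := h.psi_strict le_rfl h.ab le_rfl
    rwa [psi_b] at this
  set P := ms * Δ with hP
  have hP0 : 0 < P := by positivity
  set σ := P / (8 * cW) with hσ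
  set κ' := P / (16 * η t0) with hκ'
  have hσ0 : 0 < σ := by positivity
  have hκ'0 : 0 < κ' := by positivity
  have eσ : 2 * σ * cW = P / 4 := by rw [hσ]; field_simp; ring
  have eκ : 4 * η t0 * κ' = P / 4 := by rw [hκ']; field_simp; ring
  -- choice of κ
  obtain ⟨κ, hκ0, hκa, hκb⟩ : ∃ κ > 0, (∀ s, |s - a| ≤ κ → cW - κ' ≤ psi W a b s ∧ s ≤ α) ∧
      (∀ s, |s - b| ≤ κ → psi W a b s ≤ κ' ∧ γ ≤ s) := by
    have q1 : ∀ᶠ s in 𝓝 a, cW - κ' < psi W a b s ∧ s < α :=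
      (h.psi_cont.continuousAt.eventually (lt_mem_nhds (by linarith))).and (gt_mem_nhds h1)
    have q2 : ∀ᶠ s in 𝓝 b, psi W a b s < κ' ∧ γ < s :=
      (h.psi_cont.continuousAt.eventually (gt_mem_nhds (by rw [psi_b]; exact hκ'0))).and (lt_mem_nhds h4)
    obtain ⟨k1, hk1, q1⟩ := Metric.eventually_nhds_iff.mp q1
    obtain ⟨k2, hk2, q2⟩ := Metric.eventually_nhds_iff.mp q2
    refine ⟨min k1 k2 / 2, by positivity, fun s hs => ?_, fun s hs => ?_⟩
    · have := q1 (y := s) (by rw [Real.dist_eq]; linarith [min_le_left k1 k2, lt_min hk1 hk2])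
      exact ⟨this.1.le, this.2.le⟩
    · have := q2 (y := s) (by rw [Real.dist_eq]; linarith [min_le_right k1 k2, lt_min hk1 hk2])
      exact ⟨this.1.le, this.2.le⟩
  -- choice of r
  obtain ⟨r, hr0, hrr1, hrA, hrB, hrη⟩ : ∃ r > 0, r ≤ r1 ∧ A2 ≤ t0 - r ∧ t0 + r ≤ B1 ∧
      ∀ t ∈ Icc (t0 - r) (t0 + r), η t0 - σ ≤ η t := by
    have hca : ContinuousAt η t0 := hηc.continuousAt (Ioo_mem_nhds ht0.1 ht0.2)
    obtain ⟨k, hk, q⟩ := Metric.eventually_nhds_iff.mp (hca.eventually (lt_mem_nhds (show η t0 - σ < η t0 by linarith)))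
    have p1 : 0 < min (min r1 (k / 2)) (min (t0 - A2) (B1 - t0)) :=
      lt_min (lt_min hr1 (by linarith)) (lt_min (by linarith) (by linarith))
    refine ⟨min (min r1 (k / 2)) (min (t0 - A2) (B1 - t0)), p1, (min_le_left _ _).trans (min_le_left _ _), ?_, ?_, ?_⟩
    · linarith [(min_le_right (min r1 (k / 2)) (min (t0 - A2) (B1 - t0))).trans (min_le_left _ _)]
    · linarith [(min_le_right (min r1 (k / 2)) (min (t0 - A2) (B1 - t0))).trans (min_le_right _ _)]
    · intro t ht
      have := (min_le_left (min r1 (k / 2)) (min (t0 - A2) (B1 - t0))).trans (min_le_right _ _)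
      refine (q (y := t) ?_).le
      rw [Real.dist_eq]
      have : |t - t0| ≤ k / 2 := by rw [abs_le]; constructor <;> linarith [ht.1, ht.2]
      linarith
  have posint : ∀ u w, u < w → A1 ≤ u → w ≤ B2 → 0 < ∫ t in u..w, η t := by
    intro u w huw hu hw
    apply intervalIntegral.intervalIntegral_pos_of_pos_on _ _ huw
    · apply ContinuousOn.intervalIntegrable
      rw [uIcc_of_le huw.le]
      exact hηc.mono (fun t ht => hsubK ⟨by linarith [ht.1], by linarith [ht.2]⟩)
    · exact fun t ht => hηp t (hsubK ⟨by linarith [ht.1], by linarith [ht.2]⟩)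
  have I1 := posint A1 A2 hA le_rfl (by linarith)
  have I2 := posint B1 B2 hB (by linarith) le_rfl
  have I3 := posint (t0 - r) (t0 - r / 2) (by linarith) (by linarith) (by linarith)
  have I4 := posint (t0 + r / 2) (t0 + r) (by linarith) (by linarith) (by linarith)
  set mn := min (min (∫ t in A1..A2, η t) (∫ t in B1..B2, η t)) (min (∫ t in (t0 - r)..(t0 - r / 2), η t) (∫ t in (t0 + r / 2)..(t0 + r), η t)) with hmn
  have hmn0 : 0 < mn := lt_min (lt_min I1 I2) (lt_min I3 I4)
  have n1 : mn ≤ ∫ t in A1..A2, η t := (min_le_left _ _).trans (min_le_left _ _)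
  have n2 : mn ≤ ∫ t in B1..B2, η t := (min_le_left _ _).trans (min_le_right _ _)
  have n3 : mn ≤ ∫ t in (t0 - r)..(t0 - r / 2), η t := (min_le_right _ _).trans (min_le_left _ _)
  have n4 : mn ≤ ∫ t in (t0 + r / 2)..(t0 + r), η t := (min_le_right _ _).trans (min_le_right _ _)
  refine ⟨κ * mn / 2, by positivity, P / 2, by positivity, ?_⟩
  intro δ ε v hδ hε hv hE hi hdist hEle
  have hdlt : dist1 T η v (stepAB a b t0) < κ * mn := by
    have : 0 < κ * mn := by positivity
    linarith
  have find : ∀ u1 u2, u1 ≤ u2 → A1 ≤ u1 → u2 ≤ B2 → mn ≤ (∫ t in u1..u2, η t) → ∃ t ∈ Icc u1 u2, |v t - stepAB a b t0 t| ≤ κ := by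
    intro u1 u2 q1 q2 q3 q4
    refine find_pt q1 (fun t ht => hsubK ⟨by linarith [ht.1], by linarith [ht.2]⟩) hηp hηi hi (hdlt.trans_le ?_)
    exact mul_le_mul_of_nonneg_left q4 hκ0.le
  obtain ⟨pL, hpL, gL⟩ := find A1 A2 hA.le le_rfl (by linarith) n1
  obtain ⟨pR, hpR, gR⟩ := find B1 B2 hB.le (by linarith) le_rfl n2
  obtain ⟨p, hp, gp⟩ := find (t0 - r) (t0 - r / 2) (by linarith) (by linarith) (by linarith) n3
  obtain ⟨p', hp', gp'⟩ := find (t0 + r / 2) (t0 + r) (by linarith) (by linarith) (by linarith) n4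
  rw [stepAB, if_pos (by linarith [hpL.2])] at gL
  rw [stepAB, if_pos (by linarith [hp.2])] at gp
  rw [stepAB, if_neg (by linarith [hpR.1])] at gR
  rw [stepAB, if_neg (by linarith [hp'.1])] at gp'
  have gL := hκa _ gL
  have gp := hκa _ gp
  have gR := hκb _ gR
  have gp' := hκb _ gp'
  have hpp : p < p' := by linarith [hp.2, hp'.1]
  have hvc : ContinuousOn v (Icc p p') := fun t ht =>
    (hv t ⟨by linarith [hp.1, ht.1], by linarith [ht.2, hp'.2]⟩).continuousAt.continuousWithinAt
  obtain ⟨x, hx, hvx⟩ := intermediate_value_Icc hpp.le hvc (show c ∈ Icc (v p) (v p') from ⟨by linarith [gp.2], by linarith [gp'.2]⟩)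
  have hEI : IntervalIntegrable (EN W η v ε) volume (-T) T := by
    rw [intervalIntegrable_iff_integrableOn_Ioo_of_le (by linarith)]; exact hE
  have subE : ∀ u w, A1 ≤ u → u ≤ w → w ≤ B2 → IntervalIntegrable (EN W η v ε) volume u w := by
    intro u w q1 q2 q3
    refine hEI.mono_set ?_
    rw [uIcc_of_le q2, uIcc_of_le (by linarith)]
    exact Icc_subset_Icc (by linarith) (by linarith)
  have crs : ∀ u w, A1 ≤ u → u ≤ w → w ≤ B2 → 2 * ms * |psi W a b (v u) - psi W a b (v w)| ≤ ∫ t in u..w, EN W η v ε t := by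
    intro u w q1 q2 q3
    exact h.cross hε hms0.le q2 (fun t ht => hmin' t ⟨by linarith [ht.1], by linarith [ht.2]⟩)
      (fun t ht => hv t ⟨by linarith [ht.1], by linarith [ht.2]⟩) (subE u w q1 q2 q3)
  set mr := max ms (η t0 - σ) with hmr
  have mr_ms : ms ≤ mr := le_max_left _ _
  have mr_σ : η t0 - σ ≤ mr := le_max_right _ _
  have crr : ∀ u w, t0 - r ≤ u → u ≤ w → w ≤ t0 + r → 2 * mr * |psi W a b (v u) - psi W a b (v w)| ≤ ∫ t in u..w, EN W η v ε t := by
    intro u w q1 q2 q3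
    refine h.cross hε (hms0.le.trans mr_ms) q2 (fun t ht => ?_)
      (fun t ht => hv t ⟨by linarith [ht.1], by linarith [ht.2]⟩) (subE u w (by linarith) q2 (by linarith))
    exact max_le (hmin' t ⟨by linarith [ht.1], by linarith [ht.2]⟩) (hrη t ⟨by linarith [ht.1], by linarith [ht.2]⟩)
  have Emono : ∀ u w, A1 ≤ u → u ≤ w → w ≤ B2 → (∫ t in u..w, EN W η v ε t) ≤ 2 * cW * η t0 + P / 2 := by
    intro u w q1 q2 q3
    refine le_trans ?_ hEle
    apply intervalIntegral.integral_mono_interval (by linarith) q2 (by linarith) _ hEI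
    rw [← restrict_Ioo_eq_restrict_Ioc]
    filter_upwards [ae_restrict_mem measurableSet_Ioo] with t ht
    unfold EN
    have := hηp t ht
    have := h.nonneg (v t)
    positivity
  have Eadd : ∀ u w y, A1 ≤ u → u ≤ w → w ≤ y → y ≤ B2 → (∫ t in u..w, EN W η v ε t) + (∫ t in w..y, EN W η v ε t) = ∫ t in u..y, EN W η v ε t := by
    intro u w y q1 q2 q3 q4
    exact intervalIntegral.integral_add_adjacent_intervals (subE u w q1 q2 (by linarith)) (subE w y (by linarith) q3 q4)
  -- basic budget
  have budget : 2 * cW * η t0 - P / 2 ≤ 2 * mr * (psi W a b (v p) - psi W a b (v p')) := by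
    have d1 : cW - 2 * κ' ≤ psi W a b (v p) - psi W a b (v p') := by linarith [gp.1, gp'.1]
    have d0 : 0 ≤ psi W a b (v p) - psi W a b (v p') := by
      have := h.psi_anti (show v p ≤ v p' by linarith [gp.2, gp'.2])
      linarith
    have d2 : psi W a b (v p) - psi W a b (v p') ≤ cW := by linarith [h.psi_le (v p), h.psi_nonneg (v p')]
    have : (η t0 - σ) * (psi W a b (v p) - psi W a b (v p')) ≤ mr * (psi W a b (v p) - psi W a b (v p')) :=
      mul_le_mul_of_nonneg_right mr_σ d0
    have e1 := mul_le_mul_of_nonneg_left d1 hη0.le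
    have e2 := mul_le_mul_of_nonneg_left d2 hσ0.le
    linarith only [this, e1, e2, eσ, eκ]
  have ppsi : ∀ {s s'}, s ≤ s' → psi W a b s' ≤ psi W a b s := fun hs => h.psi_anti hs
  have hxp := hx.1
  have hxp' := hx.2
  have hp1 := hp.1
  have hp'2 := hp'.2
  have hpR1 := hpR.1
  have hpR2 := hpR.2
  have hpL1 := hpL.1
  have hpL2 := hpL.2
  have PΔ : ms * Δ = P := rfl
  refine ⟨x, pL, pR, ?_, hpL, hpR, hvx, ?_, ?_, gR.2, gL.2⟩
  · rw [abs_le]; constructor <;> linarith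
  · intro y hy
    by_contra hc
    push Not at hc
    have hy1 := hy.1
    have hy2 := hy.2
    rcases le_total y p' with hyp | hyp
    · have c1 := crr p x (by linarith) hxp (by linarith)
      have c2 := crr x y (by linarith) hy1 (by linarith)
      have c3 := crr y p' (by linarith) hyp (by linarith)
      have e1 := Eadd p x y (by linarith) hxp hy1 (by linarith)
      have e2 := Eadd p y p' (by linarith) (by linarith) hyp (by linarith)
      have e3 := Emono p p' (by linarith) hpp.le (by linarith)
      rw [hvx] at c1 c2
      have a1 : mr * (psi W a b (v p) - psi W a b c) ≤ mr * |psi W a b (v p) - psi W a b c| := by gcongr; exact le_abs_self _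
      have a2 : mr * (psi W a b (v y) - psi W a b c) ≤ mr * |psi W a b c - psi W a b (v y)| := by
        gcongr; rw [abs_sub_comm]; exact le_abs_self _
      have a3 : mr * (psi W a b (v y) - psi W a b (v p')) ≤ mr * |psi W a b (v y) - psi W a b (v p')| := by gcongr; exact le_abs_self _
      have a4 : ms * Δ ≤ mr * (psi W a b (v y) - psi W a b c) := by
        apply mul_le_mul mr_ms _ hΔ0.le (hms0.le.trans mr_ms)
        linarith [ppsi hc.le]
      linarith only [c1, c2, c3, e1, e2, e3, a1, a2, a3, a4, budget, PΔ, hP0]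
    · have c1 := crr p p' (by linarith) hpp.le (by linarith)
      have c2 := crs p' y (by linarith) hyp (by linarith)
      have e1 := Eadd p p' y (by linarith) hpp.le hyp (by linarith)
      have e3 := Emono p y (by linarith) (by linarith) (by linarith)
      have a1 : mr * (psi W a b (v p) - psi W a b (v p')) ≤ mr * |psi W a b (v p) - psi W a b (v p')| := by gcongr; exact le_abs_self _
      have a2 : ms * Δ ≤ ms * |psi W a b (v p') - psi W a b (v y)| := by
        gcongr; rw [abs_sub_comm]; refine le_trans ?_ (le_abs_self _)
        linarith [ppsi hc.le, ppsi gp'.2]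
      linarith only [c1, c2, e1, e3, a1, a2, budget, PΔ, hP0]
  · intro y hy
    by_contra hc
    push Not at hc
    have hy1 := hy.1
    have hy2 := hy.2
    rcases le_total p y with hyp | hyp
    · have c1 := crr p y (by linarith) hyp (by linarith)
      have c2 := crr y x (by linarith) hy2 (by linarith)
      have c3 := crr x p' (by linarith) hxp' (by linarith)
      have e1 := Eadd p y x (by linarith) hyp hy2 (by linarith)
      have e2 := Eadd p x p' (by linarith) hxp hxp' (by linarith)
      have e3 := Emono p p' (by linarith) hpp.le (by linarith)
      rw [hvx] at c2 c3
      have a1 : mr * (psi W a b (v p) - psi W a b (v y)) ≤ mr * |psi W a b (v p) - psi W a b (v y)| := by gcongr; exact le_abs_self _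
      have a2 : mr * (psi W a b c - psi W a b (v y)) ≤ mr * |psi W a b (v y) - psi W a b c| := by
        gcongr; rw [abs_sub_comm]; exact le_abs_self _
      have a3 : mr * (psi W a b c - psi W a b (v p')) ≤ mr * |psi W a b c - psi W a b (v p')| := by gcongr; exact le_abs_self _
      have a4 : ms * Δ ≤ mr * (psi W a b c - psi W a b (v y)) := by
        apply mul_le_mul mr_ms _ hΔ0.le (hms0.le.trans mr_ms)
        linarith [ppsi hc.le]
      linarith only [c1, c2, c3, e1, e2, e3, a1, a2, a3, a4, budget, PΔ, hP0]
    · have c1 := crr p p' (by linarith) hpp.le (by linarith)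
      have c2 := crs y p (by linarith) hyp (by linarith)
      have e1 := Eadd y p p' (by linarith) hyp hpp.le (by linarith)
      have e3 := Emono y p' (by linarith) (by linarith) (by linarith)
      have a1 : mr * (psi W a b (v p) - psi W a b (v p')) ≤ mr * |psi W a b (v p) - psi W a b (v p')| := by gcongr; exact le_abs_self _
      have a2 : ms * Δ ≤ ms * |psi W a b (v y) - psi W a b (v p)| := by
        gcongr; rw [abs_sub_comm]; refine le_trans ?_ (le_abs_self _)
        linarith [ppsi hc.le, ppsi gp.2]
      linarith only [c1, c2, e1, e3, a1, a2, budget, PΔ, hP0]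

end P11

end

section

/-! ### Part 12: abstract conclusion from the two-sided bound -/

/-- The family of lower bounds, for all admissible multipliers. -/
def KeyIneq (η : ℝ → ℝ) (J1 J2 : ℝ → ℝ) (cW L S C Λ t0 r1 M ε x E : ℝ) : Prop :=
  ∀ d μ ω : ℝ, 0 < d → d ≤ r1 → ε ≤ d ^ 2 → |μ| ≤ M →
    (∀ t ∈ Icc (x - d) (x + d), |deriv η t - deriv η x| ≤ ω) →
    2 * cW * η x - ε * (μ * η x * J1 ε - 2 * deriv η x * J2 ε) - ε * (μ ^ 2 / (4 * Λ)) * S - C * ε * d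
      - C * (ω + ε / d ^ 2) * ε * E ≤ E + μ * L * ∫ t in t0..x, η t

lemma rough {η J1 J2 : ℝ → ℝ} {cW L S C Λ t0 r1 M M1 μ1 D1 D2 K : ℝ}
    (hcW : 0 < cW) (hL : 0 < L) (hS : 0 ≤ S) (hC : 0 < C) (hΛ : 0 < Λ) (hr1 : 0 < r1) (hM1 : 0 ≤ M1)
    (hM : 0 ≤ M) (hη0 : 0 < η t0) (hK : 0 ≤ K)
    (hd : ∀ t ∈ Icc (t0 - 2 * r1) (t0 + 2 * r1), DifferentiableAt ℝ η t)
    (hb : ∀ t ∈ Icc (t0 - 2 * r1) (t0 + 2 * r1), η t0 / 2 ≤ η t ∧ η t ≤ M ∧ |deriv η t| ≤ M1)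
    (hμ0 : 0 ≤ μ1) (hμM : μ1 ≤ M) (hμ1 : 2 * cW * M1 + 1 ≤ μ1 * L * (η t0 / 2))
    (hJ1 : Tendsto J1 (𝓝[>] 0) (𝓝 D1)) (hJ2 : Tendsto J2 (𝓝[>] 0) (𝓝 D2)) :
    ∃ C3 > 0, ∀ᶠ ε in 𝓝[>] (0:ℝ), ∀ x E, |x - t0| ≤ r1 → 0 ≤ E → E ≤ 2 * cW * η t0 + ε * K →
      KeyIneq η J1 J2 cW L S C Λ t0 r1 M ε x E → |x - t0| ≤ C3 * ε := by
  set E0 := 2 * cW * η t0 + K with hE0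
  have hE00 : 0 ≤ E0 := by positivity
  refine ⟨K + M * M * (|D1| + 1) + 2 * M1 * (|D2| + 1) + M ^ 2 / (4 * Λ) * S + C * r1 + C * (2 * M1 + 1) * E0 + 1, by positivity, ?_⟩
  have j1 : ∀ᶠ ε in 𝓝[>] (0:ℝ), |J1 ε| ≤ |D1| + 1 := by
    have := hJ1.abs.eventually (gt_mem_nhds (show |D1| < |D1| + 1 by linarith))
    filter_upwards [this] with ε h using h.le
  have j2 : ∀ᶠ ε in 𝓝[>] (0:ℝ), |J2 ε| ≤ |D2| + 1 := by
    have := hJ2.abs.eventually (gt_mem_nhds (show |D2| < |D2| + 1 by linarith))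
    filter_upwards [this] with ε h using h.le
  have j3 : ∀ᶠ ε in 𝓝[>] (0:ℝ), ε ≤ r1 ^ 2 ∧ ε ≤ 1 := by
    have := (gt_mem_nhds (show (0:ℝ) < min (r1 ^ 2) 1 by positivity))
    filter_upwards [nhdsWithin_le_nhds this] with ε h
    exact ⟨h.le.trans (min_le_left _ _), h.le.trans (min_le_right _ _)⟩
  filter_upwards [j1, j2, j3, self_mem_nhdsWithin] with ε h1 h2 h3 hε x E hx hE hEK key
  have hε : 0 < ε := hε
  have hx' := abs_le.mp hx
  have xm : x ∈ Icc (t0 - 2 * r1) (t0 + 2 * r1) := ⟨by linarith, by linarith⟩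
  have tm : t0 ∈ Icc (t0 - 2 * r1) (t0 + 2 * r1) := ⟨by linarith, by linarith⟩
  obtain ⟨bx1, bx2, bx3⟩ := hb x xm
  have hEE : E ≤ E0 := by
    have : ε * K ≤ 1 * K := mul_le_mul_of_nonneg_right h3.2 hK
    linarith
  -- mean value
  have mv : η t0 - M1 * |x - t0| ≤ η x := by
    have := (convex_Icc (t0 - 2 * r1) (t0 + 2 * r1)).norm_image_sub_le_of_norm_deriv_le (f := η) (C := M1) hd
      (fun t ht => (hb t ht).2.2) tm xm
    rw [Real.norm_eq_abs, Real.norm_eq_abs] at this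
    linarith [neg_abs_le (η x - η t0)]
  have icont : ∀ u w, u ∈ Icc (t0 - 2 * r1) (t0 + 2 * r1) → w ∈ Icc (t0 - 2 * r1) (t0 + 2 * r1) → IntervalIntegrable η volume u w := by
    intro u w hu hw
    apply ContinuousOn.intervalIntegrable
    intro t ht
    exact (hd t (uIcc_subset_Icc hu hw ht)).continuousAt.continuousWithinAt
  -- choice of multiplier
  obtain ⟨μ, hμ, hμi⟩ : ∃ μ, |μ| ≤ μ1 ∧ μ * L * (∫ t in t0..x, η t) ≤ -(μ1 * L * (η t0 / 2)) * |x - t0| := by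
    rcases le_total t0 x with hle | hle
    · refine ⟨-μ1, by rw [abs_neg, abs_of_nonneg hμ0], ?_⟩
      have : (x - t0) * (η t0 / 2) ≤ ∫ t in t0..x, η t := by
        have := intervalIntegral.integral_mono_on hle (intervalIntegrable_const (c := η t0 / 2)) (icont _ _ tm xm)
          (fun t ht => (hb t ⟨by linarith [ht.1], by linarith [ht.2]⟩).1)
        rw [intervalIntegral.integral_const, smul_eq_mul] at this
        exact this
      rw [abs_of_nonneg (by linarith)]
      have := mul_le_mul_of_nonneg_left this (mul_nonneg hμ0 hL.le)
      linarith
    · refine ⟨μ1, by rw [abs_of_nonneg hμ0], ?_⟩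
      have : (t0 - x) * (η t0 / 2) ≤ ∫ t in x..t0, η t := by
        have := intervalIntegral.integral_mono_on hle (intervalIntegrable_const (c := η t0 / 2)) (icont _ _ xm tm)
          (fun t ht => (hb t ⟨by linarith [ht.1], by linarith [ht.2]⟩).1)
        rw [intervalIntegral.integral_const, smul_eq_mul] at this
        exact this
      rw [abs_of_nonpos (by linarith), intervalIntegral.integral_symm]
      have := mul_le_mul_of_nonneg_left this (mul_nonneg hμ0 hL.le)
      linarith
  have key := key r1 μ (2 * M1) hr1 le_rfl h3.1 (hμ.trans hμM) (fun t ht => by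
    have q1 := (hb t ⟨by linarith [ht.1], by linarith [ht.2]⟩).2.2
    have := abs_sub (deriv η t) (deriv η x)
    linarith)
  have hμM' := hμ.trans hμM
  have t1 : ε * (μ * η x * J1 ε - 2 * deriv η x * J2 ε) ≤ ε * (M * M * (|D1| + 1) + 2 * M1 * (|D2| + 1)) := by
    apply mul_le_mul_of_nonneg_left _ hε.le
    have s1 : μ * η x * J1 ε ≤ M * M * (|D1| + 1) := by
      refine (le_abs_self _).trans ?_
      rw [abs_mul, abs_mul]
      have : |η x| ≤ M := by rw [abs_of_nonneg (by linarith)]; exact bx2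
      gcongr
    have s2 : -(2 * deriv η x * J2 ε) ≤ 2 * M1 * (|D2| + 1) := by
      refine (neg_le_abs _).trans ?_
      rw [abs_mul, abs_mul, abs_two]
      gcongr
    linarith
  have t2 : ε * (μ ^ 2 / (4 * Λ)) * S ≤ ε * (M ^ 2 / (4 * Λ)) * S := by
    have : μ ^ 2 ≤ M ^ 2 := by rw [← sq_abs μ]; gcongr
    gcongr
  have t3 : C * (2 * M1 + ε / r1 ^ 2) * ε * E ≤ C * (2 * M1 + 1) * ε * E0 := by
    have : ε / r1 ^ 2 ≤ 1 := by rw [div_le_one (by positivity)]; exact h3.1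
    gcongr
  have t4 : 2 * cW * (η t0 - M1 * |x - t0|) ≤ 2 * cW * η x := mul_le_mul_of_nonneg_left mv (by positivity)
  have t5 := mul_le_mul_of_nonneg_right hμ1 (abs_nonneg (x - t0))
  linarith

lemma fine {η J1 J2 : ℝ → ℝ} {cW L S C Λ t0 r1 M M1 μ1 D1 D2 lam0 : ℝ}
    (hcW : 0 < cW) (hL : 0 < L) (hS : 0 ≤ S) (hC : 0 < C) (hΛ : 0 < Λ) (hr1 : 0 < r1) (hM1 : 0 ≤ M1)
    (hM : 0 ≤ M) (hη0 : 0 < η t0)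
    (hd : ∀ t ∈ Icc (t0 - 2 * r1) (t0 + 2 * r1), DifferentiableAt ℝ η t)
    (hdc : ContinuousOn (deriv η) (Icc (t0 - 2 * r1) (t0 + 2 * r1)))
    (hb : ∀ t ∈ Icc (t0 - 2 * r1) (t0 + 2 * r1), η t0 / 2 ≤ η t ∧ η t ≤ M ∧ |deriv η t| ≤ M1)
    (hμ0 : 0 ≤ μ1) (hμM : μ1 ≤ M) (hμ1 : 2 * cW * M1 + 1 ≤ μ1 * L * (η t0 / 2)) (hlM : |lam0| ≤ M)
    (hlam : lam0 * L * η t0 = 2 * deriv η t0 * cW)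
    (hJ1 : Tendsto J1 (𝓝[>] 0) (𝓝 D1)) (hJ2 : Tendsto J2 (𝓝[>] 0) (𝓝 D2)) {ζ : ℝ} (hζ : 0 < ζ) :
    ∀ᶠ ε in 𝓝[>] (0:ℝ), ∀ x E, |x - t0| ≤ r1 → 0 ≤ E →
      KeyIneq η J1 J2 cW L S C Λ t0 r1 M ε x E →
      2 * cW * η t0 + ε * (2 * deriv η t0 * D2 - lam0 * η t0 * D1 - lam0 ^ 2 / (4 * Λ) * S - ζ) ≤ E := by
  set Q := 2 * deriv η t0 * D2 - lam0 * η t0 * D1 - lam0 ^ 2 / (4 * Λ) * S with hQ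
  obtain ⟨C3, hC3, hrough⟩ := rough (K := |Q|) hcW hL hS hC hΛ hr1 hM1 hM hη0 (abs_nonneg Q) hd hb hμ0 hμM hμ1 hJ1 hJ2
  have tn : Icc (t0 - 2 * r1) (t0 + 2 * r1) ∈ 𝓝 t0 := Icc_mem_nhds (by linarith) (by linarith)
  have tm : t0 ∈ Icc (t0 - 2 * r1) (t0 + 2 * r1) := ⟨by linarith, by linarith⟩
  have hηct : ContinuousAt η t0 := (hd t0 tm).continuousAt
  have hdct : ContinuousAt (deriv η) t0 := hdc.continuousAt tn
  -- E bound
  set E0 := 2 * cW * η t0 + |Q| with hE0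
  have hE00 : 0 < E0 := by positivity
  -- ω and d
  obtain ⟨d, hd0, hdr1, hdC, hdω⟩ : ∃ d > 0, d ≤ r1 ∧ C * d ≤ ζ / 8 ∧ ∀ x t, |x - t0| ≤ r1 → |t - x| ≤ d →
      |deriv η t - deriv η x| ≤ ζ / (8 * C * E0) := by
    have uc := isCompact_Icc.uniformContinuousOn_of_continuous hdc
    rw [Metric.uniformContinuousOn_iff] at uc
    obtain ⟨s, hs, huc⟩ := uc (ζ / (8 * C * E0)) (by positivity)
    refine ⟨min (min r1 (s / 2)) (ζ / (8 * C)), by positivity, (min_le_left _ _).trans (min_le_left _ _), ?_, ?_⟩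
    · have := min_le_right (min r1 (s / 2)) (ζ / (8 * C))
      rw [le_div_iff₀ (by positivity)] at this
      linarith
    · intro x t hx ht
      have q1 : |t - x| ≤ r1 := ht.trans ((min_le_left _ _).trans (min_le_left _ _))
      have q2 : |t - x| ≤ s / 2 := ht.trans ((min_le_left _ _).trans (min_le_right _ _))
      have hx' := abs_le.mp hx
      have q1' := abs_le.mp q1
      have := huc t ⟨by linarith, by linarith⟩ x ⟨by linarith, by linarith⟩ (by rw [Real.dist_eq]; linarith)
      rw [Real.dist_eq] at this
      exact this.le
  -- stationary function
  have hPsi : HasDerivAt (fun x => 2 * cW * η x - lam0 * L * ∫ t in t0..x, η t) 0 t0 := by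
    have hi : HasDerivAt (fun x => ∫ t in t0..x, η t) (η t0) t0 := by
      apply intervalIntegral.integral_hasDerivAt_right (by simp) _ hηct
      have : ContinuousOn η (Ioo (t0 - 2 * r1) (t0 + 2 * r1)) := fun t ht =>
        (hd t ⟨ht.1.le, ht.2.le⟩).continuousAt.continuousWithinAt
      exact this.stronglyMeasurableAtFilter isOpen_Ioo t0 ⟨by linarith, by linarith⟩
    have := (((hd t0 tm).hasDerivAt).const_mul (2 * cW)).sub (hi.const_mul (lam0 * L))
    exact this.congr_deriv (by rw [hlam]; ring)
  have hlit := (hasDerivAt_iff_isLittleO.mp hPsi).def (show 0 < ζ / (8 * C3) by positivity)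
  -- limit of the corrector
  have hlim : Tendsto (fun p : ℝ × ℝ => lam0 * η p.1 * J1 p.2 - 2 * deriv η p.1 * J2 p.2) (𝓝 t0 ×ˢ 𝓝[>] 0)
      (𝓝 (lam0 * η t0 * D1 - 2 * deriv η t0 * D2)) := by
    have f1 : Tendsto (fun p : ℝ × ℝ => η p.1) (𝓝 t0 ×ˢ 𝓝[>] (0:ℝ)) (𝓝 (η t0)) := hηct.tendsto.comp tendsto_fst
    have f2 : Tendsto (fun p : ℝ × ℝ => deriv η p.1) (𝓝 t0 ×ˢ 𝓝[>] (0:ℝ)) (𝓝 (deriv η t0)) := hdct.tendsto.comp tendsto_fst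
    have f3 : Tendsto (fun p : ℝ × ℝ => J1 p.2) (𝓝 t0 ×ˢ 𝓝[>] (0:ℝ)) (𝓝 D1) := hJ1.comp tendsto_snd
    have f4 : Tendsto (fun p : ℝ × ℝ => J2 p.2) (𝓝 t0 ×ˢ 𝓝[>] (0:ℝ)) (𝓝 D2) := hJ2.comp tendsto_snd
    exact ((f1.const_mul lam0).mul f3).sub ((f2.const_mul 2).mul f4)
  have hev := hlim.eventually (gt_mem_nhds (show lam0 * η t0 * D1 - 2 * deriv η t0 * D2 < lam0 * η t0 * D1 - 2 * deriv η t0 * D2 + ζ / 8 by linarith))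
  obtain ⟨pa, hpa, pb, hpb, hpp⟩ := eventually_prod_iff.mp hev
  obtain ⟨s1, hs1, hpa'⟩ := Metric.eventually_nhds_iff.mp (hpa.and hlit)
  have small : ∀ᶠ ε in 𝓝[>] (0:ℝ), C3 * ε < s1 ∧ ε ≤ d ^ 2 ∧ ε ≤ 1 ∧ C * (ε / d ^ 2) * E0 ≤ ζ / 8 := by
    set k := min (min (s1 / C3) (d ^ 2)) (min 1 (ζ * d ^ 2 / (8 * C * E0))) with hk
    have : 0 < k := by positivity
    filter_upwards [nhdsWithin_le_nhds (gt_mem_nhds this), self_mem_nhdsWithin] with ε h hε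
    have k1 : ε < s1 / C3 := h.trans_le ((min_le_left _ _).trans (min_le_left _ _))
    have k2 : ε < d ^ 2 := h.trans_le ((min_le_left _ _).trans (min_le_right _ _))
    have k3 : ε < 1 := h.trans_le ((min_le_right _ _).trans (min_le_left _ _))
    have k4 : ε < ζ * d ^ 2 / (8 * C * E0) := h.trans_le ((min_le_right _ _).trans (min_le_right _ _))
    rw [lt_div_iff₀ hC3] at k1
    rw [lt_div_iff₀ (by positivity)] at k4
    refine ⟨by linarith, k2.le, k3.le, ?_⟩
    have e : C * (ε / d ^ 2) * E0 = ε * (8 * C * E0) / (8 * d ^ 2) := by field_simp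
    rw [e, div_le_iff₀ (by positivity)]
    linarith
  filter_upwards [hrough, small, hpb, self_mem_nhdsWithin] with ε hr hsm hpbε hε x E hx hE key
  have hε : 0 < ε := hε
  by_contra hcon
  push Not at hcon
  have hEK : E ≤ 2 * cW * η t0 + ε * |Q| := by
    have : ε * (Q - ζ) ≤ ε * |Q| := mul_le_mul_of_nonneg_left (by linarith [le_abs_self Q]) hε.le
    linarith
  have hxε := hr x E hx hE hEK key
  have hEE : E ≤ E0 := by
    have : ε * |Q| ≤ 1 * |Q| := mul_le_mul_of_nonneg_right hsm.2.2.1 (abs_nonneg _)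
    linarith
  have hxs : dist x t0 < s1 := by rw [Real.dist_eq]; exact hxε.trans_lt hsm.1
  obtain ⟨hpax, hlx⟩ := hpa' hxs
  have hcorr := hpp hpax hpbε
  have hPs : 2 * cW * η t0 - ζ / 8 * ε ≤ 2 * cW * η x - lam0 * L * ∫ t in t0..x, η t := by
    simp only [intervalIntegral.integral_same, mul_zero, sub_zero, smul_zero, Real.norm_eq_abs] at hlx
    have e : ζ / (8 * C3) * |x - t0| ≤ ζ / 8 * ε := by
      calc ζ / (8 * C3) * |x - t0| ≤ ζ / (8 * C3) * (C3 * ε) := mul_le_mul_of_nonneg_left hxε (by positivity)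
        _ = ζ / 8 * ε := by field_simp
    linarith [neg_abs_le (2 * cW * η x - lam0 * L * (∫ t in t0..x, η t) - 2 * cW * η t0)]
  have key := key d lam0 (ζ / (8 * C * E0)) hd0 hdr1 hsm.2.1 hlM
    (fun t ht => hdω x t hx (by rw [abs_le]; constructor <;> linarith [ht.1, ht.2]))
  have t1 := mul_le_mul_of_nonneg_left (le_of_lt hcorr) hε.le
  have t2 : C * ε * d ≤ ε * (ζ / 8) := by
    have := mul_le_mul_of_nonneg_left hdC hε.le
    linarith
  have t3 : C * (ζ / (8 * C * E0) + ε / d ^ 2) * ε * E ≤ ε * (ζ / 8 + ζ / 8) := by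
    have : C * (ζ / (8 * C * E0) + ε / d ^ 2) * ε * E ≤ C * (ζ / (8 * C * E0) + ε / d ^ 2) * ε * E0 := by gcongr
    refine this.trans ?_
    have e : C * (ζ / (8 * C * E0) + ε / d ^ 2) * ε * E0 = ε * (ζ / 8 + C * (ε / d ^ 2) * E0) := by field_simp
    rw [e]
    apply mul_le_mul_of_nonneg_left _ hε.le
    linarith [hsm.2.2.2]
  have t4 : 0 < ε * ζ := by positivity
  have hQe : ε * (Q - ζ) = ε * (2 * deriv η t0 * D2 - lam0 * η t0 * D1) - ε * (lam0 ^ 2 / (4 * Λ)) * S - ε * ζ := by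
    rw [hQ]; ring
  rw [hQe] at hcon
  linarith only [hcon, key, t1, t2, t3, t4, hPs]

end

section

/-! ### Part 13: endpoints of the weight -/

lemma GoodWeight.ii {T β : ℝ} {η : ℝ → ℝ} {n₁ n₂ : ℕ} {d₁ d₂ d₃ d₄ d₅ tstar : ℝ}
    (hη : GoodWeight T η β n₁ n₂ d₁ d₂ d₃ d₄ d₅ tstar) : IntervalIntegrable η volume (-T) T := by
  have := hη.tstar_mem
  have h0 : -T ≤ T := by linarith [this.1, this.2]
  exact (intervalIntegrable_iff_integrableOn_Ioo_of_le h0).mpr hη.integrable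

lemma GoodWeight.endR {T β : ℝ} {η : ℝ → ℝ} {n₁ n₂ : ℕ} {d₁ d₂ d₃ d₄ d₅ tstar : ℝ}
    (hη : GoodWeight T η β n₁ n₂ d₁ d₂ d₃ d₄ d₅ tstar) {k0 : ℝ} (hk : 0 < k0) :
    ∃ h > 0, ∀ t ∈ Ico (T - h) T, (∫ r in t..T, η r) ≤ k0 * η t := by
  have p3 := hη.d₃_pos
  have p4 := hη.d₄_pos
  have ts := hη.tstar_mem
  refine ⟨min tstar (k0 * d₃ / d₄), lt_min ts.1 (by positivity), ?_⟩
  intro t ht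
  have hts : T - tstar ≤ t := by linarith [ht.1, min_le_left tstar (k0 * d₃ / d₄)]
  have htk : T - t ≤ k0 * d₃ / d₄ := by linarith [ht.1, min_le_right tstar (k0 * d₃ / d₄)]
  have htT := ht.2
  have hsub : uIcc t T ⊆ uIcc (-T) T := by
    rw [uIcc_of_le htT.le, uIcc_of_le (by linarith [ts.1, ts.2])]
    exact Icc_subset_Icc (by linarith [ts.1, ts.2]) le_rfl
  have h1 := intervalIntegral.integral_mono_on_of_le_Ioo htT.le (hη.ii.mono_set hsub)
    (intervalIntegrable_const (c := d₄ * (T - t) ^ (n₂ - 1))) (fun r hr => by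
      refine (hη.tail₂ r ⟨by linarith [hr.1], hr.2⟩).2.trans ?_
      have : 0 ≤ T - r := by linarith [hr.2]
      gcongr
      exact hr.1.le)
  rw [intervalIntegral.integral_const, smul_eq_mul] at h1
  refine h1.trans ?_
  have h2 := (hη.tail₂ t ⟨hts, htT⟩).1
  rw [le_div_iff₀ p4] at htk
  have hp : 0 ≤ (T - t) ^ (n₂ - 1) := by apply pow_nonneg; linarith
  calc (T - t) * (d₄ * (T - t) ^ (n₂ - 1)) = (T - t) * d₄ * (T - t) ^ (n₂ - 1) := by ring
    _ ≤ k0 * d₃ * (T - t) ^ (n₂ - 1) := mul_le_mul_of_nonneg_right htk hp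
    _ = k0 * (d₃ * (T - t) ^ (n₂ - 1)) := by ring
    _ ≤ _ := mul_le_mul_of_nonneg_left h2 hk.le

lemma GoodWeight.endL {T β : ℝ} {η : ℝ → ℝ} {n₁ n₂ : ℕ} {d₁ d₂ d₃ d₄ d₅ tstar : ℝ}
    (hη : GoodWeight T η β n₁ n₂ d₁ d₂ d₃ d₄ d₅ tstar) {k0 : ℝ} (hk : 0 < k0) :
    ∃ h > 0, ∀ t ∈ Ioc (-T) (-T + h), (∫ r in (-T)..t, η r) ≤ k0 * η t := by
  have p3 := hη.d₁_pos
  have p4 := hη.d₂_pos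
  have ts := hη.tstar_mem
  refine ⟨min tstar (k0 * d₁ / d₂), lt_min ts.1 (by positivity), ?_⟩
  intro t ht
  have hts : t ≤ -T + tstar := by linarith [ht.2, min_le_left tstar (k0 * d₁ / d₂)]
  have htk : t + T ≤ k0 * d₁ / d₂ := by linarith [ht.2, min_le_right tstar (k0 * d₁ / d₂)]
  have htT := ht.1
  have hsub : uIcc (-T) t ⊆ uIcc (-T) T := by
    rw [uIcc_of_le htT.le, uIcc_of_le (by linarith [ts.1, ts.2])]
    exact Icc_subset_Icc le_rfl (by linarith [ts.1, ts.2])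
  have h1 := intervalIntegral.integral_mono_on_of_le_Ioo htT.le (hη.ii.mono_set hsub)
    (intervalIntegrable_const (c := d₂ * (t + T) ^ (n₁ - 1))) (fun r hr => by
      refine (hη.tail₁ r ⟨hr.1, by linarith [hr.2]⟩).2.trans ?_
      have : 0 ≤ r + T := by linarith [hr.1]
      gcongr
      exact hr.2.le)
  rw [intervalIntegral.integral_const, smul_eq_mul] at h1
  refine h1.trans ?_
  have h2 := (hη.tail₁ t ⟨htT, hts⟩).1
  rw [le_div_iff₀ p4] at htk
  have hp : 0 ≤ (t + T) ^ (n₁ - 1) := by apply pow_nonneg; linarith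
  calc (t - -T) * (d₂ * (t + T) ^ (n₁ - 1)) = (t + T) * d₂ * (t + T) ^ (n₁ - 1) := by ring
    _ ≤ k0 * d₁ * (t + T) ^ (n₁ - 1) := mul_le_mul_of_nonneg_right htk hp
    _ = k0 * (d₁ * (t + T) ^ (n₁ - 1)) := by ring
    _ ≤ _ := mul_le_mul_of_nonneg_left h2 hk.le

lemma step_mass {T t0 a b : ℝ} {η : ℝ → ℝ} (hηi : IntervalIntegrable η volume (-T) T) (ht0 : t0 ∈ Ioo (-T) T)
    : ∫ t in (-T)..T, stepAB a b t0 t * η t = a * (∫ t in (-T)..t0, η t) + b * (∫ t in t0..T, η t) := by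
  have s1 : uIcc (-T) t0 ⊆ uIcc (-T) T := by
    rw [uIcc_of_le ht0.1.le, uIcc_of_le (ht0.1.trans ht0.2).le]
    exact Icc_subset_Icc le_rfl ht0.2.le
  have s2 : uIcc t0 T ⊆ uIcc (-T) T := by
    rw [uIcc_of_le ht0.2.le, uIcc_of_le (ht0.1.trans ht0.2).le]
    exact Icc_subset_Icc ht0.1.le le_rfl
  have e1 : EqOn (fun t => a * η t) (fun t => stepAB a b t0 t * η t) (uIoc (-T) t0) := by
    intro t ht
    rw [uIoc_of_le ht0.1.le] at ht
    simp [stepAB, ht.2]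
  have e2 : EqOn (fun t => b * η t) (fun t => stepAB a b t0 t * η t) (uIoc t0 T) := by
    intro t ht
    rw [uIoc_of_le ht0.2.le] at ht
    simp [stepAB, not_le.mpr ht.1]
  have i1 := ((hηi.mono_set s1).const_mul a).congr e1
  have i2 := ((hηi.mono_set s2).const_mul b).congr e2
  rw [← intervalIntegral.integral_add_adjacent_intervals i1 i2]
  congr 1
  · rw [← intervalIntegral.integral_const_mul]
    exact (intervalIntegral.integral_congr_ae (Filter.Eventually.of_forall (fun t ht => e1 ht))).symm
  · rw [← intervalIntegral.integral_const_mul]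
    exact (intervalIntegral.integral_congr_ae (Filter.Eventually.of_forall (fun t ht => e2 ht))).symm

lemma Ioo_ii {T : ℝ} (hT : 0 < T) (f : ℝ → ℝ) : ∫ t in (-T)..T, f t = ∫ t in Ioo (-T) T, f t := by
  rw [intervalIntegral.integral_of_le (by linarith), integral_Ioc_eq_integral_Ioo]

end

section

/-! ### Part 14: assembly -/

lemma core_bound {W : ℝ → ℝ} {a b c T : ℝ} (h : WF W a b c) (hT : 0 < T)
    {η : ℝ → ℝ} {β : ℝ} {n₁ n₂ : ℕ} {d₁ d₂ d₃ d₄ d₅ tstar : ℝ}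
    (hη : GoodWeight T η β n₁ n₂ d₁ d₂ d₃ d₄ d₅ tstar) {m t0 : ℝ} (ht0 : t0 ∈ Ioo (-T) T)
    (hm : massEq T η m (stepAB a b t0)) {z : ℝ → ℝ} (hz : CauchyProfile W a b c z)
    {cW lam0 : ℝ} (hcW : cW = psi W a b a) (hlam : lam0 * (b - a) * η t0 = 2 * deriv η t0 * cW) :
    ∃ δ0 > 0, ∀ δ : ℝ, 0 < δ → δ ≤ δ0 → ∀ vf : ℝ → ℝ → ℝ,
      (∀ ε ∈ Ioi (0:ℝ), IsJMin T W η m δ ε (stepAB a b t0) (vf ε)) →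
      ∀ Λ > 0, QL W a Λ → QL W b Λ → ∀ ζ > 0, ∀ᶠ ε in 𝓝[>] (0:ℝ),
        2 * cW * η t0 + ε * (2 * deriv η t0 * (∫ t, W (z t) * t)
          - lam0 * η t0 * ((∫ t in Ioi 0, (b - z t)) - ∫ t in Ioi 0, (b - (a + b - z (-t))))
          - lam0 ^ 2 / (4 * Λ) * (∫ t in Ioo (-T) T, η t) - ζ) ≤ energy1 T W η ε (vf ε) := by
  have hac := h.ac
  have hcb := h.cb
  have hab : a < b := h.ab
  have hη0 : 0 < η t0 := hη.pos t0 ht0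
  have hηd : ∀ t ∈ Ioo (-T) T, DifferentiableAt ℝ η t := fun t ht =>
    (hη.smooth.differentiableOn (by norm_num)).differentiableAt (isOpen_Ioo.mem_nhds ht)
  have hηc : ContinuousOn η (Ioo (-T) T) := hη.smooth.continuousOn
  have hdc : ContinuousOn (deriv η) (Ioo (-T) T) := hη.smooth.continuousOn_deriv_of_isOpen isOpen_Ioo le_rfl
  have hcW0 : 0 < cW := by
    rw [hcW]
    have := h.psi_strict le_rfl hab le_rfl
    rwa [psi_b] at this
  set M1 := |deriv η t0| + 1 with hM1
  have hM10 : 0 < M1 := by positivity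
  have hba : 0 < b - a := by linarith
  set μ1 := (2 * cW * M1 + 1) * 2 / ((b - a) * η t0) with hμ1
  have hμ10 : 0 < μ1 := by positivity
  have hμ1e : 2 * cW * M1 + 1 ≤ μ1 * (b - a) * (η t0 / 2) := by
    rw [hμ1]; apply le_of_eq; field_simp
  set M := M1 + η t0 + 1 + μ1 + |lam0| with hM
  have hM0 : 0 < M := by positivity
  have hlam0 := abs_nonneg lam0
  obtain ⟨k0, hk0, H⟩ := h.two (α := (a + c) / 2) (γ := (c + b) / 2) (M := M) (by linarith) (by linarith)
    (by linarith) (by linarith) hM0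
  obtain ⟨C, hC, H⟩ := H (η t0 / 2) (by positivity)
  obtain ⟨hR, hR0, HR⟩ := hη.endR hk0
  obtain ⟨hL, hL0, HL⟩ := hη.endL hk0
  -- the margin
  obtain ⟨s, hs0, hsR, hsL, hs1, hs2⟩ : ∃ s > 0, s ≤ hR ∧ s ≤ hL ∧ t0 < T - s ∧ -T + s < t0 := by
    have : 0 < min (min hR hL) (min (T - t0) (t0 + T)) :=
      lt_min (lt_min hR0 hL0) (lt_min (by linarith [ht0.2]) (by linarith [ht0.1]))
    refine ⟨min (min hR hL) (min (T - t0) (t0 + T)) / 2, by positivity, ?_, ?_, ?_, ?_⟩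
    · linarith [(min_le_left (min hR hL) (min (T - t0) (t0 + T))).trans (min_le_left _ _)]
    · linarith [(min_le_left (min hR hL) (min (T - t0) (t0 + T))).trans (min_le_right _ _)]
    · linarith [(min_le_right (min hR hL) (min (T - t0) (t0 + T))).trans (min_le_left _ _)]
    · linarith [(min_le_right (min hR hL) (min (T - t0) (t0 + T))).trans (min_le_right _ _)]
  -- the radius
  obtain ⟨r1, hr10, hr11, hr2, hb⟩ : ∃ r1 > 0, r1 ≤ 1 ∧ Icc (t0 - 2 * r1) (t0 + 2 * r1) ⊆ Ioo (-T + s) (T - s) ∧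
      ∀ t ∈ Icc (t0 - 2 * r1) (t0 + 2 * r1), η t0 / 2 ≤ η t ∧ η t ≤ M ∧ |deriv η t| ≤ M1 := by
    have n0 : Ioo (-T) T ∈ 𝓝 t0 := isOpen_Ioo.mem_nhds ht0
    have c1 : ContinuousAt η t0 := hηc.continuousAt n0
    have c2 : ContinuousAt (deriv η) t0 := hdc.continuousAt n0
    have e1 := c1.eventually (lt_mem_nhds (show η t0 / 2 < η t0 by linarith))
    have e2 := c1.eventually (gt_mem_nhds (show η t0 < M by rw [hM]; linarith))
    have e3 := c2.abs.eventually (gt_mem_nhds (show |deriv η t0| < M1 by rw [hM1]; linarith))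
    have e4 : ∀ᶠ t in 𝓝 t0, t ∈ Ioo (-T + s) (T - s) := isOpen_Ioo.mem_nhds ⟨hs2, hs1⟩
    obtain ⟨r, hr, hball⟩ := Metric.eventually_nhds_iff.mp (e1.and (e2.and (e3.and e4)))
    have hall : ∀ t ∈ Icc (t0 - 2 * min (r / 4) 1) (t0 + 2 * min (r / 4) 1), dist t t0 < r := by
      intro t ht
      have := min_le_left (r / 4) 1
      rw [Real.dist_eq, abs_lt]
      constructor <;> linarith [ht.1, ht.2]
    refine ⟨min (r / 4) 1, by positivity, min_le_right _ _, fun t ht => (hball (hall t ht)).2.2.2, fun t ht => ?_⟩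
    obtain ⟨g1, g2, g3, -⟩ := hball (hall t ht)
    exact ⟨g1.le, g2.le, g3.le⟩
  have hr2' : Icc (t0 - 2 * r1) (t0 + 2 * r1) ⊆ Ioo (-T) T :=
    hr2.trans (Ioo_subset_Ioo (by linarith) (by linarith))
  have hrL := (hr2 (left_mem_Icc.mpr (by linarith))).1
  have hrR := (hr2 (right_mem_Icc.mpr (by linarith))).2
  obtain ⟨δ0, hδ0, ρ, hρ, HG⟩ := h.geom (T := T) (η := η) (α := (a + c) / 2) (γ := (c + b) / 2) (t0 := t0)
    (A1 := -T + s / 2) (A2 := -T + s) (B1 := T - s) (B2 := T - s / 2) (r1 := r1)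
    (by linarith) (by linarith) (by linarith) (by linarith) hη.pos hη.integrable hηc
    (by linarith) (by linarith) hs2 hs1 (by linarith) (by linarith) hr10
  refine ⟨δ0, hδ0, ?_⟩
  intro δ hδ hδδ vf hvf Λ hΛ hQa hQb ζ hζ
  obtain ⟨ε0, hε0, H⟩ := H Λ hΛ hQa hQb
  -- limits of the J terms
  have hJ1 := (h.JJ_tendsto hz (g := fun s => b - s) (by fun_prop) (by simp) (h.z_int hz)).sub
    (h.reflect.JJ_tendsto hz.reflect (g := fun s => b - s) (by fun_prop) (by simp) (h.reflect.z_int hz.reflect))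
  have hJ2 := (h.JJ_tendsto hz (g := psi W a b) h.psi_cont (psi_b _ _ _) (h.psiz_int hz)).sub
    (h.reflect.JJ_tendsto hz.reflect (g := psi (fun s => W (a + b - s)) a b) h.reflect.psi_cont (psi_b _ _ _)
      (h.reflect.psiz_int hz.reflect))
  rw [← h.csym_eq hz] at hJ2
  have hS : 0 ≤ ∫ t in Ioo (-T) T, η t := setIntegral_nonneg measurableSet_Ioo (fun t ht => (hη.pos t ht).le)
  have hfine := fine (C := C) (Λ := Λ) (M1 := M1) (μ1 := μ1) (M := M) hcW0 hba hS hC hΛ hr10 hM10.le hM0.le hη0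
    (fun t ht => hηd t (hr2' ht)) (hdc.mono hr2') hb hμ10.le (by rw [hM]; linarith) hμ1e (by rw [hM]; linarith) hlam
    hJ1 hJ2 hζ
  set Q := 2 * deriv η t0 * (∫ t, W (z t) * t)
          - lam0 * η t0 * ((∫ t in Ioi 0, (b - z t)) - ∫ t in Ioi 0, (b - (a + b - z (-t))))
          - lam0 ^ 2 / (4 * Λ) * (∫ t in Ioo (-T) T, η t) with hQ
  have hsmall : ∀ᶠ ε in 𝓝[>] (0:ℝ), ε < ε0 ∧ ε * (Q - ζ) ≤ ρ := by
    have e1 : ∀ᶠ ε in 𝓝 (0:ℝ), ε < ε0 := gt_mem_nhds hε0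
    have e2 : ∀ᶠ ε in 𝓝 (0:ℝ), ε * (Q - ζ) < ρ := by
      have : ContinuousAt (fun ε : ℝ => ε * (Q - ζ)) 0 := by fun_prop
      exact this.eventually (gt_mem_nhds (by simpa using hρ))
    filter_upwards [nhdsWithin_le_nhds e1, nhdsWithin_le_nhds e2] with ε g1 g2
    exact ⟨g1, g2.le⟩
  filter_upwards [hfine, hsmall, self_mem_nhdsWithin] with ε hf hsm hε
  have hε : 0 < ε := hε
  have hv := hvf ε hε
  set v := vf ε with hvdef
  obtain ⟨hEN, hvη⟩ := h.jmin_int hη.integrable hη.pos hηc ht0 hm hδ hε hv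
  have hE : energy1 T W η ε v = ∫ t in (-T)..T, EN W η v ε t := (Ioo_ii hT _).symm
  rw [hE]
  set E := ∫ t in (-T)..T, EN W η v ε t with hEdef
  have hE0 : 0 ≤ E := by
    rw [hEdef, Ioo_ii hT]
    refine setIntegral_nonneg measurableSet_Ioo (fun t ht => ?_)
    have := hη.pos t ht
    have := h.nonneg (v t)
    unfold EN
    positivity
  by_cases hbig : E ≤ 2 * psi W a b a * η t0 + ρ
  swap
  · rw [← hcW] at hbig
    push Not at hbig
    linarith [hsm.2]
  have hstep : IntegrableOn (fun t => stepAB a b t0 t * η t) (Ioo (-T) T) :=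
    bdd_mul_int hη.integrable hη.pos (stepAB_meas a b t0).aestronglyMeasurable (fun t _ => stepAB_bd a b t0 t)
  have hdiff : IntegrableOn (fun t => |v t - stepAB a b t0 t| * η t) (Ioo (-T) T) := by
    refine IntegrableOn.congr_fun (hvη.sub hstep).abs ?_ measurableSet_Ioo
    intro t ht
    simp only [Pi.sub_apply, Pi.abs_apply]
    rw [← sub_mul, abs_mul, abs_of_pos (hη.pos t ht)]
  obtain ⟨x, pL, pR, hx, hpL, hpR, hvx, hα, hγ, hvR, hvL⟩ := HG δ ε v hδδ hε hv.1.1.1 hEN hdiff hv.1.2.2 hbig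
  have hx' := abs_le.mp hx
  have hTT : -T ≤ T := by linarith
  refine hf x E hx hE0 ?_
  intro d μ ω hd hdr hεd hμ hω
  rw [hcW, ← Ioo_ii hT]
  refine H ε d x μ ω pL pR T t0 η v hε hsm.1 hd (hdr.trans hr11) hεd hμ (by linarith [hpL.2]) (by linarith [hpR.1])
    (by linarith [hpL.1]) (by linarith [hpR.2]) ht0 hη.pos hηd hη.ii ?_ ?_ ?_ hv.1.1.1 hα hγ hvR hvL hvx
    ((intervalIntegrable_iff_integrableOn_Ioo_of_le hTT).mpr hEN)
    ((intervalIntegrable_iff_integrableOn_Ioo_of_le hTT).mpr hvη) ?_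
  · intro t ht
    obtain ⟨g1, g2, g3⟩ := hb t ⟨by linarith [ht.1], by linarith [ht.2]⟩
    exact ⟨g1, g2, g3.trans (by rw [hM]; linarith), hω t ht⟩
  · intro t ht
    exact HR t ⟨by linarith [ht.1, hpR.1], ht.2⟩
  · intro t ht
    exact HL t ⟨ht.1, by linarith [ht.2, hpL.2]⟩
  · rw [← step_mass hη.ii ht0, Ioo_ii hT, Ioo_ii hT]
    exact hv.1.2.1.trans hm.symm

lemma liminf_ge_of {f : ℝ → ℝ} {R : ℝ} (h : ∀ ζ > 0, ∀ᶠ ε in 𝓝[>] (0:ℝ), R - ζ ≤ f ε) :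
    ((R : ℝ) : EReal) ≤ liminf (fun ε => ((f ε : ℝ) : EReal)) (𝓝[>] (0:ℝ)) := by
  refine le_of_forall_lt (fun y hy => ?_)
  obtain ⟨r, hr1, hr2⟩ := EReal.lt_iff_exists_real_btwn.mp hy
  refine hr1.trans_le ?_
  have hr2' : r < R := EReal.coe_lt_coe_iff.mp hr2
  refine le_liminf_of_le (by isBoundedDefault) ?_
  filter_upwards [h (R - r) (by linarith)] with ε hε
  exact EReal.coe_le_coe_iff.mpr (by linarith)

end

/-- **Second-order liminf inequality for the 1D weighted functional** (Theorem 4.16).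
For `δ` sufficiently small, every family `v_ε` of global minimizers of `J_ε`
satisfies `liminf_{ε→0⁺} (G_ε^{(1)}(v_ε) - 2 c_W η(t₀))/ε ≥ 2 η'(t₀)(τ₀ c_W + c_sym)`,
plus the extra term `(λ₀²/(2l)) ∫_I η` when `q = 1`. -/
theorem second_order_liminf_1d
    (W : ℝ → ℝ) (a b c q l : ℝ) (hW : DoubleWell W a b c q l)
    (T : ℝ) (hT : 0 < T)
    (η : ℝ → ℝ) (β : ℝ) (n₁ n₂ : ℕ) (d₁ d₂ d₃ d₄ d₅ tstar : ℝ)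
    (hη : GoodWeight T η β n₁ n₂ d₁ d₂ d₃ d₄ d₅ tstar)
    (m : ℝ)
    (hm₁ : a * (∫ t in Set.Ioo (-T) T, η t) < m)
    (hm₂ : m < b * ∫ t in Set.Ioo (-T) T, η t)
    (t₀ : ℝ) (ht₀ : t₀ ∈ Set.Ioo (-T) T)
    (hmass₀ : massEq T η m (stepAB a b t₀))
    (z : ℝ → ℝ) (hz : CauchyProfile W a b c z)
    (cW csym lam₀ : ℝ)
    (hcW : cW = ∫ s in a..b, Real.sqrt (W s))
    (hcsym : csym = ∫ t : ℝ, W (z t) * t)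
    (hlam₀ : lam₀ = 2 * deriv η t₀ * cW / ((b - a) * η t₀))
    (τ₀ : ℝ)
    (hτ₀ : η t₀ * (∫ s : ℝ, (z (s - τ₀) - stepAB a b 0 s)) =
      if q = 1 then (lam₀ / l) * ∫ t in Set.Ioo (-T) T, η t else 0) :
    ∃ δ₀ > 0, ∀ δ : ℝ, 0 < δ → δ ≤ δ₀ →
      ∀ vf : ℝ → (ℝ → ℝ),
        (∀ ε ∈ Set.Ioi (0 : ℝ), IsJMin T W η m δ ε (stepAB a b t₀) (vf ε)) →
        (q = 1 →
          ((2 * deriv η t₀ * (τ₀ * cW + csym) +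
              lam₀ ^ 2 / (2 * l) * ∫ t in Set.Ioo (-T) T, η t : ℝ) : EReal) ≤
            Filter.liminf
              (fun ε => (((energy1 T W η ε (vf ε) - 2 * cW * η t₀) / ε : ℝ) : EReal))
              (𝓝[>] (0 : ℝ))) ∧
        (q < 1 →
          ((2 * deriv η t₀ * (τ₀ * cW + csym) : ℝ) : EReal) ≤
            Filter.liminf
              (fun ε => (((energy1 T W η ε (vf ε) - 2 * cW * η t₀) / ε : ℝ) : EReal))
              (𝓝[>] (0 : ℝ))) := by
  have h := hW.toWF hz
  have hab := hW.lt_ab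
  have hη0 : 0 < η t₀ := hη.pos t₀ ht₀
  have hba : 0 < b - a := by linarith
  have hl := hW.l_pos
  have hcW' : cW = psi W a b a := by rw [h.psi_a_eq, hcW]
  have hlam : lam₀ * (b - a) * η t₀ = 2 * deriv η t₀ * cW := by
    rw [hlam₀]; field_simp
  obtain ⟨δ0, hδ0, H⟩ := core_bound h hT hη ht₀ hmass₀ hz hcW' hlam
  have hA := h.A_eq hz τ₀
  rw [hA] at hτ₀
  rw [← hcsym] at H
  have hS : 0 ≤ ∫ t in Set.Ioo (-T) T, η t := setIntegral_nonneg measurableSet_Ioo (fun t ht => (hη.pos t ht).le)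
  set S := ∫ t in Set.Ioo (-T) T, η t with hSdef
  set I1 := ∫ t in Ioi 0, (b - z t) with hI1
  set I2 := ∫ t in Ioi 0, (b - (a + b - z (-t))) with hI2
  have hK : 0 ≤ lam₀ ^ 2 * S := by positivity
  refine ⟨δ0, hδ0, fun δ hδ hδδ vf hvf => ⟨fun hq => ?_, fun hq => ?_⟩⟩
  · refine liminf_ge_of (fun ζ hζ => ?_)
    rw [if_pos hq] at hτ₀
    obtain ⟨Λ, hΛ0, hΛl, hΛ⟩ : ∃ Λ > 0, 2 * Λ < l ∧ lam₀ ^ 2 / (4 * Λ) * S < lam₀ ^ 2 / (2 * l) * S + ζ / 2 := by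
      have c1 : ContinuousAt (fun Λ : ℝ => lam₀ ^ 2 / (4 * Λ) * S) (l / 2) := by
        have : (4 * (l / 2)) ≠ 0 := by positivity
        fun_prop (disch := assumption)
      have e1 := c1.eventually (gt_mem_nhds (show lam₀ ^ 2 / (4 * (l / 2)) * S < lam₀ ^ 2 / (2 * l) * S + ζ / 2 by
        rw [show 4 * (l / 2) = 2 * l by ring]; linarith))
      have e2 : ∀ᶠ Λ in 𝓝 (l / 2), 0 < Λ := lt_mem_nhds (by linarith)
      obtain ⟨Λ, ⟨g1, g2⟩, g3⟩ := (((e1.and e2).filter_mono (nhdsWithin_le_nhds (s := Iio (l / 2)))).and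
        (eventually_mem_nhdsWithin (s := Iio (l / 2)))).exists
      exact ⟨Λ, g2, by have : Λ < l / 2 := g3
                       linarith, g1⟩
    filter_upwards [H δ hδ hδδ vf hvf Λ hΛ0 (hW.qlA Λ (fun _ => hΛl)) (hW.qlB Λ (fun _ => hΛl)) (ζ / 2) (by positivity),
      self_mem_nhdsWithin] with ε hf hε
    rw [le_div_iff₀ hε]
    have hmul : lam₀ * (η t₀ * (I2 - I1 - τ₀ * (b - a))) = lam₀ ^ 2 / (2 * l) * S * 2 := by
      rw [hτ₀]; field_simp
    have key : 2 * deriv η t₀ * (τ₀ * cW + csym) + lam₀ ^ 2 / (2 * l) * S - ζ ≤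
        2 * deriv η t₀ * csym - lam₀ * η t₀ * (I1 - I2) - lam₀ ^ 2 / (4 * Λ) * S - ζ / 2 := by
      have : 2 * deriv η t₀ * cW * τ₀ = lam₀ * (b - a) * η t₀ * τ₀ := by rw [hlam]
      linarith
    have := mul_le_mul_of_nonneg_left key (le_of_lt (show 0 < ε from hε))
    linarith
  · refine liminf_ge_of (fun ζ hζ => ?_)
    rw [if_neg hq.ne] at hτ₀
    obtain ⟨Λ, hΛ0, hΛ⟩ : ∃ Λ > 0, lam₀ ^ 2 / (4 * Λ) * S ≤ ζ / 2 := by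
      refine ⟨lam₀ ^ 2 * S / ζ + 1, by positivity, ?_⟩
      rw [div_mul_eq_mul_div, div_le_iff₀ (by positivity)]
      have : ζ / 2 * (4 * (lam₀ ^ 2 * S / ζ + 1)) = 2 * (lam₀ ^ 2 * S) + 2 * ζ := by field_simp; ring
      rw [this]; linarith
    filter_upwards [H δ hδ hδδ vf hvf Λ hΛ0 (hW.qlA Λ (fun hh => absurd hh hq.ne)) (hW.qlB Λ (fun hh => absurd hh hq.ne))
      (ζ / 2) (by positivity), self_mem_nhdsWithin] with ε hf hε
    rw [le_div_iff₀ hε]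
    have hmul : lam₀ * (η t₀ * (I2 - I1 - τ₀ * (b - a))) = 0 := by
      rw [hτ₀]; ring
    have key : 2 * deriv η t₀ * (τ₀ * cW + csym) - ζ ≤
        2 * deriv η t₀ * csym - lam₀ * η t₀ * (I1 - I2) - lam₀ ^ 2 / (4 * Λ) * S - ζ / 2 := by
      have : 2 * deriv η t₀ * cW * τ₀ = lam₀ * (b - a) * η t₀ * τ₀ := by rw [hlam]
      linarith
    have := mul_le_mul_of_nonneg_left key (le_of_lt (show 0 < ε from hε))
    linarith
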